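/- arXiv:1103.3335 — 6 statements merged into one kernel-verified Lean document; each statement's English description precedes it below -/
import Mathlib

section
/- Let k be a field. Let T and R be Hom-finite k-linear Krull–Schmidt triangulated categories, let S be a Serre functor on T and S~ a Serre functor on R, and let π : T → R be a triangle functor which satisfies the 2-orbit property and such that R is the triangulated hull of the image of π. Then π maps Auslander–Reiten triangles to Auslander–Reiten triangles: for every Auslander–Reiten triangle A → B → C → ΣA in T, the triangle πA → πB → πC → ΣπA is an Auslander–Reiten triangle in R. As a consequence, there is no irreducible morphism f : U → V in R such that exactly one of U and V is isomorphic to an object in the essential image of π. -/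
/- Statement 0: A triangle functor `π : T ⥤ R` between Hom-finite k-linear Krull–Schmidt
triangulated categories with Serre functors, satisfying the 2-orbit property and such that
`R` is the triangulated hull of the image of `π`, maps Auslander–Reiten triangles to
Auslander–Reiten triangles; consequently there is no irreducible morphism between the
essential image of `π` and its complement. -/

noncomputable section

open CategoryTheory Limits Pretriangulated

/-- A category is Hom-finite over `k` if all Hom-spaces are finite-dimensional. -/
def HomFinite (k : Type) [Field k] (C : Type) [Category C] [Preadditive C]
    [CategoryTheory.Linear k C] : Prop :=
  ∀ X Y : C, FiniteDimensional k (X ⟶ Y)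

/-- Krull–Schmidt: every object is a finite biproduct of objects with local endomorphism
rings. -/
def IsKrullSchmidt (C : Type) [Category C] [Preadditive C] [HasZeroObject C]
    [HasFiniteBiproducts C] : Prop :=
  ∀ X : C, ∃ (n : ℕ) (Z : Fin n → C) (_ : X ≅ ⨁ Z), ∀ i, IsLocalRing (End (Z i))

/-- An indecomposable object: nonzero, and any biproduct decomposition is trivial. -/
def IsIndec {C : Type} [Category C] [Preadditive C] [HasZeroObject C]
    [HasBinaryBiproducts C] (X : C) : Prop :=
  ¬ IsZero X ∧ ∀ (Y Z : C), (X ≅ Y ⊞ Z) → IsZero Y ∨ IsZero Z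

/-- A Serre functor: a triangle auto-equivalence `S` together with a bifunctorial
non-degenerate pairing `Hom(X, Y) × Hom(Y, S X) → k`, encoding the natural isomorphisms
`Hom_k(Hom(X,Y), k) ≅ Hom(Y, S X)`. -/
structure SerreFunctor (k : Type) [Field k] (C : Type) [Category C] [Preadditive C]
    [CategoryTheory.Linear k C] [HasZeroObject C] [HasShift C ℤ]
    [∀ n : ℤ, (shiftFunctor C n).Additive] [Pretriangulated C] where
  S : C ⥤ C
  commShift : S.CommShift ℤ
  isTriangulated : letI := commShift; S.IsTriangulated
  isEquivalence : S.IsEquivalence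
  pair : ∀ (X Y : C), (X ⟶ Y) →ₗ[k] (Y ⟶ S.obj X) →ₗ[k] k
  nondeg_left : ∀ (X Y : C) (f : X ⟶ Y), (∀ g : Y ⟶ S.obj X, pair X Y f g = 0) → f = 0
  nondeg_right : ∀ (X Y : C) (g : Y ⟶ S.obj X), (∀ f : X ⟶ Y, pair X Y f g = 0) → g = 0
  nat_left : ∀ {X X' Y : C} (u : X' ⟶ X) (f : X ⟶ Y) (g : Y ⟶ S.obj X'),
    pair X' Y (u ≫ f) g = pair X Y f (g ≫ S.map u)
  nat_right : ∀ {X Y Y' : C} (v : Y ⟶ Y') (f : X ⟶ Y) (g : Y' ⟶ S.obj X),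
    pair X Y' (f ≫ v) g = pair X Y f (v ≫ g)

/-- The 2-orbit property of a functor `π : T ⥤ R`: natural, composition-compatible
isomorphisms `Hom_R(πX, πY) ≅ ⊕ₙ Hom_T(X, Σ^{2n} Y)`, with only finitely many nonzero
summands for each pair of objects. -/
structure TwoOrbit (k : Type) [Field k] {T R : Type} [Category T] [Category R]
    [Preadditive T] [Preadditive R] [CategoryTheory.Linear k T] [CategoryTheory.Linear k R]
    [HasShift T ℤ] [HasShift R ℤ] (π : T ⥤ R) where
  e : ∀ X Y : T, (π.obj X ⟶ π.obj Y) ≃ₗ[k]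
    DirectSum ℤ (fun n : ℤ => (X ⟶ (shiftFunctor T (2 * n)).obj Y))
  finite : ∀ X Y : T, {n : ℤ | ∃ f : X ⟶ (shiftFunctor T (2 * n)).obj Y, f ≠ 0}.Finite
  nat_left : ∀ {X X' Y : T} (f : X' ⟶ X) (g : π.obj X ⟶ π.obj Y),
    e X' Y (π.map f ≫ g) =
      DFinsupp.mapRange (fun n (h : X ⟶ (shiftFunctor T (2 * n)).obj Y) => f ≫ h)
        (fun _ => comp_zero) (e X Y g)
  nat_right : ∀ {X Y Y' : T} (g : Y ⟶ Y') (u : π.obj X ⟶ π.obj Y),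
    e X Y' (u ≫ π.map g) =
      DFinsupp.mapRange (fun n (h : X ⟶ (shiftFunctor T (2 * n)).obj Y) =>
          h ≫ (shiftFunctor T (2 * n)).map g)
        (fun _ => zero_comp) (e X Y u)
  comp : ∀ {X Y Z : T} (m n : ℤ) (a : X ⟶ (shiftFunctor T (2 * m)).obj Y)
      (b : Y ⟶ (shiftFunctor T (2 * n)).obj Z),
    (e X Y).symm (DirectSum.of (fun n : ℤ => (X ⟶ (shiftFunctor T (2 * n)).obj Y)) m a) ≫
      (e Y Z).symm (DirectSum.of (fun n : ℤ => (Y ⟶ (shiftFunctor T (2 * n)).obj Z)) n b) =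
    (e X Z).symm (DirectSum.of (fun n : ℤ => (X ⟶ (shiftFunctor T (2 * n)).obj Z)) (m + n)
      (a ≫ (shiftFunctor T (2 * m)).map b ≫
        (shiftFunctorAdd' T (2 * n) (2 * m) (2 * (m + n)) (by ring)).inv.app Z))

/-- `R` is the triangulated hull of the image of `π`: the only subset of `R` closed under
isomorphisms, shifts, extensions and direct summands containing all `π.obj X` is all of
`R`. -/
def IsTriangulatedHullOfImage {T R : Type} [Category T] [Category R] [Preadditive R]
    [HasZeroObject R] [HasShift R ℤ] [∀ n : ℤ, (shiftFunctor R n).Additive]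
    [Pretriangulated R] (π : T ⥤ R) : Prop :=
  ∀ S : Set R,
    (∀ ⦃X Y : R⦄, (X ≅ Y) → X ∈ S → Y ∈ S) →
    (∀ (X : R) (n : ℤ), X ∈ S → (shiftFunctor R n).obj X ∈ S) →
    (∀ Tr : Triangle R, Tr ∈ (distTriang R) → Tr.obj₁ ∈ S → Tr.obj₃ ∈ S → Tr.obj₂ ∈ S) →
    (∀ (X Y : R) (i : X ⟶ Y) (r : Y ⟶ X), i ≫ r = 𝟙 X → Y ∈ S → X ∈ S) →
    (∀ X : T, π.obj X ∈ S) → ∀ Y : R, Y ∈ S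

/-- An Auslander–Reiten triangle. -/
def IsARTriangle (C : Type) [Category C] [Preadditive C] [HasZeroObject C] [HasShift C ℤ]
    [∀ n : ℤ, (shiftFunctor C n).Additive] [Pretriangulated C] [HasBinaryBiproducts C]
    (Tr : Triangle C) : Prop :=
  Tr ∈ (distTriang C) ∧ IsIndec Tr.obj₁ ∧ IsIndec Tr.obj₃ ∧ Tr.mor₃ ≠ 0 ∧
    ∀ (W : C) (w : W ⟶ Tr.obj₃), ¬ IsSplitEpi w → ∃ w' : W ⟶ Tr.obj₂, w' ≫ Tr.mor₂ = w

/-- An irreducible morphism. -/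
def IsIrreducibleHom {C : Type} [Category C] {U V : C} (f : U ⟶ V) : Prop :=
  ¬ IsSplitMono f ∧ ¬ IsSplitEpi f ∧
    ∀ (W : C) (g : U ⟶ W) (h : W ⟶ V), g ≫ h = f → IsSplitMono g ∨ IsSplitEpi h


section RingPart

lemma rp_comm {k E : Type*} [Field k] [Ring E] [Algebra k E]
    [FiniteDimensional k E] {a b : E} (h : a * b = 1) : b * a = 1 := by
  have : IsArtinianRing E := IsArtinianRing.of_finite k E
  have : IsNoetherianRing E := inferInstance
  have : IsDedekindFiniteMonoid E := inferInstance
  exact mul_eq_one_symm h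

lemma rp_unit_left {k E : Type*} [Field k] [Ring E] [Algebra k E]
    [FiniteDimensional k E] {a b : E} (h : IsUnit (a * b)) : IsUnit a := by
  obtain ⟨u, hu⟩ := h
  have h1 : a * (b * ↑u⁻¹) = 1 := by rw [← mul_assoc, ← hu]; simp
  exact ⟨⟨a, _, h1, rp_comm (k := k) h1⟩, rfl⟩

lemma rp_unit_right {k E : Type*} [Field k] [Ring E] [Algebra k E]
    [FiniteDimensional k E] {a b : E} (h : IsUnit (a * b)) : IsUnit b := by
  obtain ⟨u, hu⟩ := h
  have h1 : (↑u⁻¹ * a) * b = 1 := by rw [mul_assoc, ← hu]; simp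
  exact ⟨⟨b, _, rp_comm (k := k) h1, h1⟩, rfl⟩

lemma rp_jac_unit {k E : Type*} [Field k] [Ring E] [Algebra k E]
    [FiniteDimensional k E] {x : E} (hx : x ∈ Ideal.jacobson (⊥ : Ideal E)) :
    IsUnit (x + 1) := by
  obtain ⟨z, hz⟩ := Ideal.mem_jacobson_iff.1 hx 1
  have h1 : z * (x + 1) = 1 := by
    simp only [mul_one, Ideal.mem_bot] at hz
    rw [mul_add, mul_one]; exact sub_eq_zero.1 hz
  exact ⟨⟨x + 1, z, rp_comm (k := k) h1, h1⟩, rfl⟩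

lemma rp_semi {k E : Type*} [Field k] [Ring E] [Algebra k E]
    [FiniteDimensional k E] {s : E}
    (h : ∀ t, s * t * s ∈ Ideal.jacobson (⊥ : Ideal E)) :
    s ∈ Ideal.jacobson (⊥ : Ideal E) := by
  rw [Ideal.mem_jacobson_iff]
  intro y
  have h1 : -(y * (s * y * s)) ∈ Ideal.jacobson (⊥ : Ideal E) :=
    neg_mem (Ideal.mul_mem_left _ _ (h y))
  have h2 := rp_jac_unit (k := k) h1
  have h3 : -(y * (s * y * s)) + 1 = (1 - y * s) * (1 + y * s) := by noncomm_ring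
  rw [h3] at h2
  obtain ⟨u, hu⟩ := rp_unit_right (k := k) h2
  refine ⟨↑u⁻¹, ?_⟩
  have : (↑u⁻¹ : E) * (1 + y * s) = 1 := by rw [← hu]; simp
  rw [Ideal.mem_bot, ← this]; noncomm_ring

lemma rp_main {k E : Type*} [Field k] [Ring E] [Algebra k E]
    [FiniteDimensional k E] (H : Set E) (hmul : ∀ a ∈ H, ∀ b ∈ H, a * b ∈ H)
    (hspan : ∀ x : E, x ∈ AddSubgroup.closure H)
    (hun : ∀ a ∈ H, IsUnit a ∨ IsNilpotent a) (s : E) (hs : s ∈ H) (hsu : ¬ IsUnit s) :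
    s ∈ Ideal.jacobson (⊥ : Ideal E) := by
  induction hn : Module.finrank k (LinearMap.range (LinearMap.mulRight k s)) using
    Nat.strong_induction_on generalizing s with
  | _ n ih =>
  apply rp_semi (k := k)
  intro t
  induction hspan t using AddSubgroup.closure_induction with
  | zero => simp
  | add x y _ _ hx hy => rw [mul_add, add_mul]; exact add_mem hx hy
  | neg x _ hx => rw [mul_neg, neg_mul]; exact neg_mem hx
  | mem t ht =>
  have hle : LinearMap.range (LinearMap.mulRight k (s * t * s)) ≤
      LinearMap.range (LinearMap.mulRight k s) := by
    rintro _ ⟨x, rfl⟩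
    exact ⟨x * (s * t), by simp [mul_assoc]⟩
  rcases hle.lt_or_eq with hlt | heq
  · refine ih _ ?_ (s * t * s) (hmul _ (hmul _ hs _ ht) _ hs) ?_ rfl
    · rw [← hn]; exact Submodule.finrank_lt_finrank_of_lt hlt
    · exact fun h => hsu (rp_unit_right (k := k) h)
  · have hts : IsNilpotent (t * s) := by
      refine (hun _ (hmul _ ht _ hs)).resolve_left fun h => hsu (rp_unit_right (k := k) h)
    obtain ⟨m, hm⟩ := hts
    have key : ∀ m : ℕ, ∀ x : E, ∃ y, x * s = y * s * (t * s) ^ m := by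
      intro m
      induction m with
      | zero => intro x; exact ⟨x, by simp⟩
      | succ m ihm =>
        intro x
        obtain ⟨y, hy⟩ := ihm x
        have : y * s ∈ LinearMap.range (LinearMap.mulRight k (s * t * s)) := by
          rw [heq]; exact ⟨y, by simp⟩
        obtain ⟨z, hz⟩ := this
        refine ⟨z, ?_⟩
        rw [hy, ← hz]
        simp [pow_succ', mul_assoc]
    obtain ⟨y, hy⟩ := key m 1
    rw [hm] at hy
    have : s = 0 := by simpa using hy
    simp [this]

/-- In a finite-dimensional local algebra non-units are nilpotent. -/
lemma rp_local {k E : Type*} [Field k] [Ring E] [Algebra k E]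
    [FiniteDimensional k E] [IsLocalRing E] (f : E) : IsUnit f ∨ IsNilpotent f := by
  by_cases hf : IsUnit f
  · exact Or.inl hf
  right
  have : IsArtinianRing E := IsArtinianRing.of_finite k E
  -- f^n E stabilises
  have : ∃ n : ℕ, ∃ y, f ^ n = y * f ^ (n + 1) := by
    let F : ℕ →o (Submodule E E)ᵒᵈ := ⟨fun n => OrderDual.toDual (Ideal.span {f ^ n}), by
      intro a b hab
      change Ideal.span {f ^ b} ≤ Ideal.span {f ^ a}
      rw [Ideal.span_singleton_le_iff_mem, Ideal.mem_span_singleton']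
      exact ⟨f ^ (b - a), by rw [← pow_add]; congr 1; omega⟩⟩
    obtain ⟨n, hn⟩ := IsArtinian.monotone_stabilizes (R := E) (M := E) F
    have h1 : Ideal.span {f ^ n} = Ideal.span {f ^ (n + 1)} := hn (n + 1) (by omega)
    have h2 : f ^ n ∈ Ideal.span {f ^ (n + 1)} := by
      rw [← h1]; exact Ideal.mem_span_singleton_self _
    rw [Ideal.mem_span_singleton'] at h2
    obtain ⟨y, hy⟩ := h2
    exact ⟨n, y, hy.symm⟩
  obtain ⟨n, y, hy⟩ := this
  refine ⟨n, ?_⟩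
  have h1 : (1 - y * f) * f ^ n = 0 := by
    rw [sub_mul, one_mul, mul_assoc, ← pow_succ', ← hy, sub_self]
  have h2 : IsUnit (1 - y * f) := by
    refine (IsLocalRing.isUnit_or_isUnit_of_add_one (a := y * f) (b := 1 - y * f)
      (by abel)).resolve_left ?_
    exact fun h => hf (rp_unit_right (k := k) h)
  exact (h2.mul_right_eq_zero).1 h1

end RingPart

namespace Orb
set_option linter.unusedSectionVars false
universe v w

section Local

variable {C : Type} [Category.{v} C] [Preadditive C]

lemma isIso_of_unit {X : C} (f : X ⟶ X) (h : IsUnit (M := End X) f) : IsIso f := by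
  obtain ⟨u, rfl⟩ := h
  exact ⟨(u⁻¹).val, u.inv_mul, u.mul_inv⟩

lemma unit_of_comp {X : C} (f g : X ⟶ X) (h : f ≫ g = 𝟙 X) (h' : g ≫ f = 𝟙 X) :
    IsUnit (M := End X) f := ⟨⟨f, g, h', h⟩, rfl⟩

lemma unit_of_isIso {X : C} (f : X ⟶ X) [IsIso f] : IsUnit (M := End X) f :=
  unit_of_comp f (inv f) (by simp) (by simp)

lemma local_add {X : C} (h : IsLocalRing (End X)) (f g : X ⟶ X) (hfg : f + g = 𝟙 X) :
    IsIso f ∨ IsIso g :=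
  (IsLocalRing.isUnit_or_isUnit_of_add_one (R := End X) hfg).imp
    (isIso_of_unit _) (isIso_of_unit _)

lemma local_mk {X : C} (h0 : 𝟙 X ≠ 0)
    (h : ∀ f g : X ⟶ X, f + g = 𝟙 X → IsIso f ∨ IsIso g) : IsLocalRing (End X) := by
  have : Nontrivial (End X) := ⟨⟨𝟙 X, (0 : X ⟶ X), h0⟩⟩
  exact ⟨fun {a b} hab => (h a b hab).imp 
    (@unit_of_isIso _ _ _ _ a) (@unit_of_isIso _ _ _ _ b)⟩

lemma local_ne {X : C} (h : IsLocalRing (End X)) : 𝟙 X ≠ 0 := one_ne_zero (α := End X)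

lemma local_iso {X Y : C} (i : X ≅ Y) (h : IsLocalRing (End X)) : IsLocalRing (End Y) := by
  have key : ∀ a : Y ⟶ Y, IsIso (i.hom ≫ a ≫ i.inv) → IsIso a := by
    intro a ha
    have h2 : a = i.inv ≫ (i.hom ≫ a ≫ i.inv) ≫ i.hom := by simp
    rw [h2]; infer_instance
  apply local_mk
  · intro h1
    apply local_ne h
    rw [← i.hom_inv_id, ← Category.id_comp i.inv, h1]; simp
  intro a b hab
  have : i.hom ≫ a ≫ i.inv + i.hom ≫ b ≫ i.inv = 𝟙 X := by
    rw [← Preadditive.comp_add, ← Preadditive.add_comp, hab]; simp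
  exact (local_add h _ _ this).imp (key a) (key b)

lemma local_nz {X : C} (h : IsLocalRing (End X)) : ¬ IsZero X := by
  intro hz
  exact (zero_ne_one (α := End X)) (hz.eq_of_src (0 : X ⟶ X) (𝟙 X))

lemma local_indec [HasZeroObject C] [HasBinaryBiproducts C] {X : C}
    (h : IsLocalRing (End X)) : IsIndec X := by
  refine ⟨local_nz h, fun Y Z i => ?_⟩
  have hl := local_iso i h
  rcases local_add hl (biprod.fst ≫ biprod.inl : Y ⊞ Z ⟶ Y ⊞ Z)
    (biprod.snd ≫ biprod.inr : Y ⊞ Z ⟶ Y ⊞ Z) biprod.total with h | h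
  · right
    rw [IsZero.iff_id_eq_zero]
    have h2 : (biprod.inr : Z ⟶ Y ⊞ Z) = 0 := by
      rw [← cancel_mono (biprod.fst ≫ biprod.inl : Y ⊞ Z ⟶ Y ⊞ Z)]; simp
    rw [← biprod.inr_snd (X := Y) (Y := Z), h2]; simp
  · left
    rw [IsZero.iff_id_eq_zero]
    have h2 : (biprod.inl : Y ⟶ Y ⊞ Z) = 0 := by
      rw [← cancel_mono (biprod.snd ≫ biprod.inr : Y ⊞ Z ⟶ Y ⊞ Z)]; simp
    rw [← biprod.inl_fst (X := Y) (Y := Z), h2]; simp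

end Local

section Orbit

variable {k : Type} [Field k] {T R : Type} [Category.{v} T] [Category.{w} R]
    [Preadditive T] [Preadditive R] [CategoryTheory.Linear k T] [CategoryTheory.Linear k R]
    [HasShift T ℤ] [HasShift R ℤ]
    {π : T ⥤ R} (horb : TwoOrbit k π)

abbrev z (T : Type) [Category.{v} T] [HasShift T ℤ] : shiftFunctor T (2 * 0 : ℤ) ≅ 𝟭 T :=
  shiftFunctorZero' T _ (by ring)

def inj {X Y : T} (n : ℤ) (a : X ⟶ (shiftFunctor T (2 * n)).obj Y) : π.obj X ⟶ π.obj Y :=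
  (horb.e X Y).symm (DirectSum.of (fun n : ℤ => (X ⟶ (shiftFunctor T (2 * n)).obj Y)) n a)

def c0 (X Y : T) : (π.obj X ⟶ π.obj Y) →ₗ[k] (X ⟶ Y) :=
  (Linear.rightComp k X ((z T).hom.app Y)) ∘ₗ
    (DirectSum.component k ℤ (fun n : ℤ => (X ⟶ (shiftFunctor T (2 * n)).obj Y)) 0) ∘ₗ
      (horb.e X Y).toLinearMap

lemma c0_apply {X Y : T} (g : π.obj X ⟶ π.obj Y) :
    c0 horb X Y g = horb.e X Y g 0 ≫ (z T).hom.app Y := rfl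

lemma c0_left {X X' Y : T} (f : X' ⟶ X) (g : π.obj X ⟶ π.obj Y) :
    c0 horb X' Y (π.map f ≫ g) = f ≫ c0 horb X Y g := by
  rw [c0_apply, c0_apply, horb.nat_left]
  exact Category.assoc _ _ _

lemma c0_right {X Y Y' : T} (g : Y ⟶ Y') (u : π.obj X ⟶ π.obj Y) :
    c0 horb X Y' (u ≫ π.map g) = c0 horb X Y u ≫ g := by
  rw [c0_apply, c0_apply, horb.nat_right]
  have := (z T).hom.naturality g
  simp only [Functor.id_map] at this
  change (_ ≫ _) ≫ _ = _
  rw [Category.assoc, this, Category.assoc]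

lemma of_eq {X Y : T} {m n : ℤ} (h : m = n) (a : X ⟶ (shiftFunctor T (2 * m)).obj Y) :
    DirectSum.of (fun n : ℤ => (X ⟶ (shiftFunctor T (2 * n)).obj Y)) n
      (a ≫ eqToHom (by rw [h])) =
    DirectSum.of (fun n : ℤ => (X ⟶ (shiftFunctor T (2 * n)).obj Y)) m a := by
  subst h; simp

lemma coh (a b c : ℤ) (hb : b = 0) (hc : c = a) (h : a + b = c) (Z : T) :
    (shiftFunctorZero' T b hb).inv.app ((shiftFunctor T a).obj Z) ≫
      (shiftFunctorAdd' T a b c h).inv.app Z = eqToHom (by subst hc; rfl) := by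
  subst hb; subst hc
  rw [shiftFunctorAdd'_add_zero_inv_app]
  simp [shiftFunctorZero']

lemma inj_comp {X Y Z : T} (m n : ℤ) (a : X ⟶ (shiftFunctor T (2 * m)).obj Y)
      (b : Y ⟶ (shiftFunctor T (2 * n)).obj Z) :
    inj horb m a ≫ inj horb n b = inj horb (m + n) (a ≫ (shiftFunctor T (2 * m)).map b ≫
        (shiftFunctorAdd' T (2 * n) (2 * m) (2 * (m + n)) (by ring)).inv.app Z) :=
  horb.comp m n a b

lemma inj_zero {X Y : T} (n : ℤ) : inj horb n (0 : X ⟶ (shiftFunctor T (2 * n)).obj Y) = 0 := by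
  simp [inj]

lemma eq_sum {X Y : T} (g : π.obj X ⟶ π.obj Y) :
    g = ∑ n ∈ (horb.finite X Y).toFinset, inj horb n (horb.e X Y g n) := by
  apply (horb.e X Y).injective
  rw [map_sum]
  simp only [inj, LinearEquiv.apply_symm_apply]
  ext n
  rw [DirectSum.sum_apply]
  by_cases hn : n ∈ (horb.finite X Y).toFinset
  · rw [Finset.sum_eq_single n]
    · simp
    · intro m _ hm; exact DirectSum.of_eq_of_ne _ _ _ hm.symm
    · exact fun h => (h hn).elim
  · have h0 : horb.e X Y g n = 0 := by
      by_contra h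
      exact hn (by simpa using ⟨_, h⟩)
    rw [h0, Finset.sum_eq_zero]
    intro m hm
    exact DirectSum.of_eq_of_ne _ _ _ (by rintro rfl; exact hn hm)

lemma inj_id (X : T) : inj horb 0 ((z T).inv.app X) = 𝟙 (π.obj X) := by
  have key : ∀ {Z : T} (g : π.obj X ⟶ π.obj Z), inj horb 0 ((z T).inv.app X) ≫ g = g := by
    intro Z g
    rw [eq_sum horb g, Preadditive.comp_sum]
    refine Finset.sum_congr rfl fun n _ => ?_
    rw [inj_comp]
    have h1 := (z T).inv.naturality (horb.e X Z g n)
    simp only [Functor.id_map] at h1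
    have h2 : (z T).inv.app X ≫ (shiftFunctor T (2 * 0)).map (horb.e X Z g n) ≫
        (shiftFunctorAdd' T (2 * n) (2 * 0) (2 * (0 + n)) (by ring)).inv.app Z =
        (horb.e X Z g n) ≫ eqToHom (by rw [zero_add]) := by
      rw [← reassoc_of% h1, coh _ _ _ _ (by ring)]
    rw [h2]
    simp only [inj]
    exact congrArg _ (of_eq (zero_add n).symm _)
  have := key (𝟙 _)
  rwa [Category.comp_id] at this

lemma map_eq {X Y : T} (f : X ⟶ Y) : π.map f = inj horb 0 (f ≫ (z T).inv.app Y) := by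
  rw [← Category.comp_id (π.map f), ← inj_id horb]
  apply (horb.e X Y).injective
  have h : horb.e Y Y (inj horb 0 ((z T).inv.app Y)) =
      DirectSum.of (fun n : ℤ => (Y ⟶ (shiftFunctor T (2 * n)).obj Y)) 0 ((z T).inv.app Y) :=
    LinearEquiv.apply_symm_apply _ _
  refine (horb.nat_left f _).trans ?_
  refine (congrArg _ h).trans ?_
  refine (DFinsupp.mapRange_single
    (f := fun (n : ℤ) (h : Y ⟶ (shiftFunctor T (2 * n)).obj Y) => f ≫ h)
    (hf := fun _ => comp_zero)).trans ?_
  exact (LinearEquiv.apply_symm_apply _ _).symm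

lemma inj0 {X Y : T} (a : X ⟶ (shiftFunctor T (2 * 0)).obj Y) :
    inj horb 0 a = π.map (a ≫ (z T).hom.app Y) := by
  rw [map_eq horb]; simp

lemma c0_inj0 {X Y : T} (a : X ⟶ (shiftFunctor T (2 * 0)).obj Y) :
    c0 horb X Y (inj horb 0 a) = a ≫ (z T).hom.app Y := by
  rw [c0_apply]; simp [inj]

lemma c0_inj_ne {X Y : T} (n : ℤ) (hn : n ≠ 0) (a : X ⟶ (shiftFunctor T (2 * n)).obj Y) :
    c0 horb X Y (inj horb n a) = 0 := by
  rw [c0_apply]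
  simp only [inj, LinearEquiv.apply_symm_apply]
  rw [DirectSum.of_eq_of_ne _ _ _ hn.symm, zero_comp]

lemma c0_map {X Y : T} (f : X ⟶ Y) : c0 horb X Y (π.map f) = f := by
  rw [map_eq horb, c0_inj0]; simp

lemma c0_id (X : T) : c0 horb X X (𝟙 _) = 𝟙 X := by
  rw [← π.map_id, c0_map]

/-- Test a morphism on the right. -/
lemma test_right {X Y Z : T} (f : π.obj X ⟶ π.obj Y) (n : ℤ)
    (a : (shiftFunctor T (2 * n)).obj Y ⟶ Z) :
    ∃ g : π.obj Y ⟶ π.obj Z, c0 horb X Z (f ≫ g) = horb.e X Y f n ≫ a := by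
  have hz : n + (-n) = 0 := by ring
  let i : (shiftFunctor T (2 * n)).obj ((shiftFunctor T (2 * (-n))).obj Z) ≅ Z :=
    ((shiftFunctorAdd' T (2 * (-n)) (2 * n) (2 * (n + -n)) (by ring)).symm.app Z) ≪≫
      (shiftFunctorZero' T _ (by ring)).app Z
  obtain ⟨b, hb⟩ := (shiftFunctor T (2 * n)).map_surjective (a ≫ i.inv)
  refine ⟨inj horb (-n) b, ?_⟩
  have hs : c0 horb X Z (f ≫ inj horb (-n) b) = ∑ m ∈ (horb.finite X Y).toFinset,
      c0 horb X Z (inj horb m (horb.e X Y f m) ≫ inj horb (-n) b) := by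
    conv_lhs => rw [eq_sum horb f, Preadditive.sum_comp, map_sum]
  rw [hs]
  by_cases hn : horb.e X Y f n = 0
  · rw [hn, zero_comp]
    refine Finset.sum_eq_zero fun m _ => ?_
    by_cases hm : m = n
    · subst hm; rw [hn, inj_zero]; simp
    · rw [inj_comp, c0_inj_ne]; omega
  · rw [Finset.sum_eq_single n]
    · rw [inj_comp]
      have aux : ∀ (p : ℤ) (hp : p = 0) (u : X ⟶ (shiftFunctor T (2 * p)).obj Z),
          c0 horb X Z (inj horb p u) = u ≫ (shiftFunctorZero' T _ (by rw [hp]; rfl)).hom.app Z := by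
        rintro _ rfl u; exact c0_inj0 horb u
      rw [aux _ hz, hb]
      simp [i]
    · intro m _ hm; rw [inj_comp, c0_inj_ne]; omega
    · intro h; exact (h (by simpa using ⟨_, hn⟩)).elim

lemma test_left {X Y Z : T} (g : π.obj Y ⟶ π.obj Z) (n : ℤ) (h0 : horb.e Y Z g n ≠ 0) :
    ∃ (u : (shiftFunctor T (2 * (-n))).obj Y ⟶ Z), u ≠ 0 ∧
      ∀ a : X ⟶ (shiftFunctor T (2 * (-n))).obj Y, ∃ f : π.obj X ⟶ π.obj Y,
        c0 horb X Z (f ≫ g) = a ≫ u := by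
  have hz : (-n) + n = 0 := by ring
  let i : (shiftFunctor T (2 * (-n))).obj ((shiftFunctor T (2 * n)).obj Z) ≅ Z :=
    ((shiftFunctorAdd' T (2 * n) (2 * (-n)) (2 * (-n + n)) (by ring)).symm.app Z) ≪≫
      (shiftFunctorZero' T _ (by ring)).app Z
  refine ⟨(shiftFunctor T (2 * (-n))).map (horb.e Y Z g n) ≫ i.hom, ?_, fun a => ?_⟩
  · intro h
    apply h0
    have h1 : (shiftFunctor T (2 * (-n))).map (horb.e Y Z g n) = 0 := by
      rw [← cancel_mono i.hom, h, zero_comp]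
    apply (shiftFunctor T (2 * (-n))).map_injective
    rw [h1, Functor.map_zero]
  refine ⟨inj horb (-n) a, ?_⟩
  conv_lhs => rw [eq_sum horb g, Preadditive.comp_sum, map_sum]
  rw [Finset.sum_eq_single n]
  · rw [inj_comp]
    have aux : ∀ (p : ℤ) (hp : p = 0) (u : X ⟶ (shiftFunctor T (2 * p)).obj Z),
        c0 horb X Z (inj horb p u) = u ≫ (shiftFunctorZero' T _ (by rw [hp]; rfl)).hom.app Z := by
      rintro _ rfl u; exact c0_inj0 horb u
    rw [aux _ hz]
    simp [i]
  · intro m _ hm; rw [inj_comp, c0_inj_ne]; omega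
  · intro h; exact (h (by simpa using ⟨_, h0⟩)).elim

lemma exists_ne {X Y : T} (g : π.obj X ⟶ π.obj Y) (hg : g ≠ 0) : ∃ n, horb.e X Y g n ≠ 0 := by
  by_contra! h
  apply hg
  rw [eq_sum horb g]
  exact Finset.sum_eq_zero fun n _ => by rw [h, inj_zero]

/-- Homogeneous endomorphisms. -/
def Hom' {X : T} (n : ℤ) (x : End (π.obj X)) : Prop := ∃ a, x = inj horb n a

lemma hom_mul {X : T} {m n : ℤ} {x y : End (π.obj X)} (hx : Hom' horb m x) (hy : Hom' horb n y) :
    Hom' horb (n + m) (x * y) := by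
  obtain ⟨a, rfl⟩ := hx
  obtain ⟨b, rfl⟩ := hy
  exact ⟨_, inj_comp horb _ _ _ _⟩

lemma hom_pow {X : T} {n : ℤ} {x : End (π.obj X)} (hx : Hom' horb n x) (N : ℕ) :
    Hom' horb (N * n) (x ^ N) := by
  induction N with
  | zero =>
    simp only [Nat.cast_zero, zero_mul, pow_zero]
    exact ⟨_, (inj_id horb X).symm⟩
  | succ N ih =>
    have := hom_mul horb ih hx
    rw [pow_succ]
    convert this using 1
    push_cast; ring

lemma hom_nil {X : T} {n : ℤ} (hn : n ≠ 0) {x : End (π.obj X)} (hx : Hom' horb n x) :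
    IsNilpotent x := by
  by_contra hnil
  apply Set.infinite_univ (α := ℕ)
  refine Set.Finite.subset ((horb.finite X X).preimage (f := fun N : ℕ => (N : ℤ) * n) ?_) ?_
  · intro a _ b _ hab
    simpa [hn] using hab
  · intro N _
    obtain ⟨a, ha⟩ := hom_pow horb hx N
    refine ⟨a, fun h => hnil ⟨N, ?_⟩⟩
    rw [ha, h, inj_zero]

lemma c0_nt (horb : TwoOrbit k π) {X : T} (hX : IsLocalRing (End X)) : 𝟙 (π.obj X) ≠ 0 := by
  intro h
  apply local_ne hX
  rw [← c0_id horb, h, map_zero]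

lemma unit_of_c0 (hfinT : HomFinite k T) (hfinR : HomFinite k R) [π.Additive] {X : T}
    (hX : IsLocalRing (End X)) (x : π.obj X ⟶ π.obj X)
    (hx : IsIso (c0 horb X X x)) : IsIso x := by
  have : FiniteDimensional k (End X) := hfinT X X
  have : FiniteDimensional k (End (π.obj X)) := hfinR _ _
  have : Nontrivial (End (π.obj X)) := ⟨⟨𝟙 _, (0 : π.obj X ⟶ π.obj X), c0_nt horb hX⟩⟩
  have hmapu : ∀ f : X ⟶ X, IsUnit (M := End X) f → IsUnit (M := End (π.obj X)) (π.map f) := by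
    intro f hf
    have := isIso_of_unit _ hf
    exact unit_of_isIso (π.map f)
  let H : Set (End (π.obj X)) := {x | ∃ n, Hom' horb n x}
  let F0 : End X →* End (π.obj X) := Functor.mapEnd X π
  let F : End X →*₀ End (π.obj X) := ⟨⟨F0, π.map_zero _ _⟩, F0.map_one, F0.map_mul⟩
  have hmain := rp_main (k := k) H
    (by rintro a ⟨m, hm⟩ b ⟨n, hn⟩; exact ⟨_, hom_mul horb hm hn⟩)
    (by
      intro x
      have h : x = ∑ n ∈ (horb.finite X X).toFinset, (inj horb n (horb.e X X x n) : End (π.obj X)) :=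
        eq_sum horb (x : π.obj X ⟶ π.obj X)
      rw [h]
      exact sum_mem fun n _ => AddSubgroup.subset_closure ⟨n, _, rfl⟩)
    (by
      rintro a ⟨n, hn⟩
      by_cases h0 : n = 0
      · subst h0
        obtain ⟨a, rfl⟩ := hn
        rw [inj0]
        rcases rp_local (k := k) (E := End X) (a ≫ (z T).hom.app X) with h | h
        · exact Or.inl (hmapu _ h)
        · right
          exact h.map F
      · exact Or.inr (hom_nil horb h0 hn))
  have hdec : ∃ y : End (π.obj X), y ∈ Ideal.jacobson (⊥ : Ideal (End (π.obj X))) ∧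
      x = HAdd.hAdd (α := π.obj X ⟶ π.obj X) y (π.map (c0 horb X X x)) := by
    refine ⟨∑ n ∈ (horb.finite X X).toFinset.erase 0,
      (inj horb n (horb.e X X x n) : End (π.obj X)), ?_, ?_⟩
    · refine sum_mem fun n hn => hmain _ ⟨n, _, rfl⟩ ?_
      have hn0 : n ≠ 0 := (Finset.mem_erase.1 hn).1
      intro hu
      exact (hom_nil horb hn0 ⟨_, rfl⟩ : IsNilpotent _).not_isUnit hu
    · have h1 : π.map (c0 horb X X x) = inj horb 0 (horb.e X X x 0) := by
        rw [inj0, c0_apply]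
      rw [h1]
      by_cases hm : (0 : ℤ) ∈ (horb.finite X X).toFinset
      · conv_lhs => rw [eq_sum horb x, ← Finset.sum_erase_add _ _ hm]
      · have h2 : horb.e X X x 0 = 0 := by
          by_contra h
          exact hm (by simpa using ⟨_, h⟩)
        rw [h2, inj_zero, Finset.erase_eq_of_notMem hm]
        conv_lhs => rw [eq_sum horb x]
        exact (add_zero _).symm
  obtain ⟨y, hy, hxy⟩ := hdec
  obtain ⟨u, hu⟩ := hmapu _ (unit_of_isIso (c0 horb X X x))
  have h3 : IsUnit ((↑u⁻¹ : End (π.obj X)) * y + 1) :=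
    rp_jac_unit (k := k) (Ideal.mul_mem_left _ _ hy)
  apply isIso_of_unit
  have h4 : End.of x = u * ((↑u⁻¹ : End (π.obj X)) * y + 1) := by
    rw [mul_add, Units.mul_inv_cancel_left, mul_one, hu]; exact hxy
  change IsUnit (End.of x)
  rw [h4]
  exact u.isUnit.mul h3

lemma local_map (horb : TwoOrbit k π) (hfinT : HomFinite k T) (hfinR : HomFinite k R) [π.Additive] {X : T}
    (hX : IsLocalRing (End X)) : IsLocalRing (End (π.obj X)) := by
  refine local_mk (c0_nt horb hX) fun a b hab => ?_
  have h1 : c0 horb X X a + c0 horb X X b = 𝟙 X := by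
    rw [← map_add, ← c0_id horb, hab]
  exact (local_add hX _ _ h1).imp
    (unit_of_c0 horb hfinT hfinR hX _) (unit_of_c0 horb hfinT hfinR hX _)

end Orbit
end Orb

namespace Orb
set_option linter.unusedSectionVars false
universe v w

lemma perf {k M N : Type*} [Field k] [AddCommGroup M] [AddCommGroup N] [Module k M] [Module k N]
    [FiniteDimensional k M] (p : M →ₗ[k] N →ₗ[k] k) (h : ∀ m, (∀ n, p m n = 0) → m = 0)
    (h' : ∀ n, (∀ m, p m n = 0) → n = 0) (l : M →ₗ[k] k) : ∃ n, ∀ m, p m n = l m := by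
  have h1 : Function.Injective p := by
    rw [injective_iff_map_eq_zero]
    intro m hm; exact h m fun n => by rw [hm]; rfl
  have h2 : Function.Injective p.flip := by
    rw [injective_iff_map_eq_zero]
    intro n hn; exact h' n fun m => LinearMap.congr_fun hn m
  have h3 := LinearMap.IsPerfPair.of_injective h1 h2
  obtain ⟨n, hn⟩ := h3.bijective_right.2 l
  exact ⟨n, fun m => LinearMap.congr_fun hn m⟩

section Tri

variable {k : Type} [Field k] {C : Type} [Category.{v} C] [Preadditive C]
    [CategoryTheory.Linear k C] [HasZeroObject C] [HasShift C ℤ]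
    [∀ n : ℤ, (shiftFunctor C n).Additive] [Pretriangulated C]

lemma serre_repr (S : SerreFunctor k C) (hfin : HomFinite k C) (X Y : C)
    (l : (X ⟶ Y) →ₗ[k] k) : ∃ g : Y ⟶ S.S.obj X, ∀ f, S.pair X Y f g = l f := by
  have := hfin X Y
  exact perf (S.pair X Y) (S.nondeg_left X Y) (S.nondeg_right X Y) l

/-- "Right almost split" morphisms (third morphisms of AR triangles). -/
def RAS {X Y : C} (h : X ⟶ Y) : Prop :=
  h ≠ 0 ∧ ∀ (W : C) (w : W ⟶ X), ¬ IsSplitEpi w → w ≫ h = 0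

lemma RAS.left {X Y : C} {h : X ⟶ Y} (hh : RAS h) (hY : IsLocalRing (End Y)) {V : C} (v : Y ⟶ V)
    (hv : ¬ IsSplitMono v) : h ≫ v = 0 := by
  by_contra hne
  obtain ⟨B, g, d, hT⟩ := distinguished_cocone_triangle₁ (h ≫ v)
  have h1 : g ≫ h ≫ v = 0 := comp_distTriang_mor_zero₁₂ _ hT
  have h2 : ¬ IsSplitEpi g := by
    intro hs
    apply hne
    rw [← cancel_epi g, h1, comp_zero]
  have h3 := hh.2 _ g h2
  obtain ⟨u, hu'⟩ : ∃ u : V ⟶ Y, h = (h ≫ v) ≫ u := Triangle.yoneda_exact₂ _ hT h h3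
  have hu2 : h ≫ v ≫ u = h := by rw [← Category.assoc]; exact hu'.symm
  rcases local_add hY (v ≫ u) (𝟙 Y - v ≫ u) (by abel) with h4 | h4
  · exact hv ⟨⟨⟨u ≫ inv (v ≫ u), by rw [← Category.assoc]; simp⟩⟩⟩
  · apply hh.1
    rw [← cancel_mono (𝟙 Y - v ≫ u)]
    rw [Preadditive.comp_sub, Category.comp_id, hu2, sub_self, zero_comp]

lemma RAS.comp_iso {X Y Y' : C} {h : X ⟶ Y} (hh : RAS h) (i : Y ≅ Y') : RAS (h ≫ i.hom) := by
  refine ⟨fun h0 => hh.1 ?_, fun W w hw => ?_⟩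
  · rw [← cancel_mono i.hom, h0, zero_comp]
  · rw [← Category.assoc, hh.2 W w hw, zero_comp]

lemma RAS_exists (S : SerreFunctor k C) (hfin : HomFinite k C) {X : C}
    (hX : IsLocalRing (End X)) : ∃ h : X ⟶ S.S.obj X, RAS h := by
  have : FiniteDimensional k (End X) := hfin X X
  let N : Submodule k (End X) :=
    { carrier := nonunits (End X)
      zero_mem' := not_isUnit_zero
      add_mem' := fun ha hb => IsLocalRing.nonunits_add ha hb
      smul_mem' := by
        intro c x hx hu
        apply hx
        rw [← one_mul x, ← smul_mul_assoc] at hu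
        exact rp_unit_right (k := k) hu }
  have h1 : (1 : End X) ∉ N := fun h => h isUnit_one
  obtain ⟨l, hl1, hl⟩ := Submodule.exists_le_ker_of_notMem h1
  obtain ⟨h, hh⟩ := serre_repr S hfin X X l
  refine ⟨h, fun h0 => hl1 ?_, fun W w hw => ?_⟩
  · rw [← hh, h0, map_zero]
  · apply S.nondeg_right
    intro g
    rw [← S.nat_right, hh]
    have : (g ≫ w : End X) ∈ N := by
      intro hu
      have := isIso_of_unit _ hu
      exact hw ⟨⟨⟨inv (g ≫ w) ≫ g, by simp⟩⟩⟩
    exact hl this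

lemma RAS.psi (S : SerreFunctor k C) (hfin : HomFinite k C) {X Y : C} {h : X ⟶ Y} (hh : RAS h)
    (hY : IsLocalRing (End Y)) : ∃ ψ : Y ⟶ S.S.obj X, IsSplitMono ψ := by
  have hl : ∃ l : (X ⟶ Y) →ₗ[k] k, l h ≠ 0 := by
    by_contra! hc
    exact hh.1 ((Module.forall_dual_apply_eq_zero_iff k h).1 hc)
  obtain ⟨l, hl⟩ := hl
  obtain ⟨ψ, hψ⟩ := serre_repr S hfin X Y l
  refine ⟨ψ, by_contra fun hs => hl ?_⟩
  have h0 := hh.left hY ψ hs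
  rw [← hψ, ← Category.id_comp h, S.nat_right, h0, map_zero]

lemma compl {M U : C} (j : M ⟶ U) (q : U ⟶ M) (hjq : j ≫ q = 𝟙 M) :
    ∃ (K : C) (i : K ⟶ U) (r : U ⟶ K), i ≫ r = 𝟙 K ∧ r ≫ i = 𝟙 U - q ≫ j ∧ i ≫ q = 0 ∧
      j ≫ r = 0 := by
  obtain ⟨K, i, d, hT⟩ := distinguished_cocone_triangle₁ q
  have h1 : i ≫ q = 0 := comp_distTriang_mor_zero₁₂ _ hT
  have h2 : q ≫ d = 0 := comp_distTriang_mor_zero₂₃ _ hT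
  have hd : d = 0 := by rw [← Category.id_comp d, ← hjq, Category.assoc, h2, comp_zero]
  have hm : Mono i := Triangle.mono₁ _ hT hd
  obtain ⟨r, hr'⟩ : ∃ r : U ⟶ K, 𝟙 U - q ≫ j = r ≫ i :=
    Triangle.coyoneda_exact₂ _ hT (𝟙 U - q ≫ j)
      (by change (𝟙 U - q ≫ j) ≫ q = 0; simp [hjq])
  refine ⟨K, i, r, ?_, hr'.symm, h1, ?_⟩
  · rw [← cancel_mono i, Category.assoc, ← hr', Preadditive.comp_sub, ← Category.assoc, h1]; simp
  · rw [← cancel_mono i, Category.assoc, ← hr', Preadditive.comp_sub, ← Category.assoc, hjq]; simp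

variable [HasBinaryBiproducts C]

def isoBiprod {M U K : C} (j : M ⟶ U) (q : U ⟶ M) (hjq : j ≫ q = 𝟙 M) (i : K ⟶ U) (r : U ⟶ K)
    (h1 : i ≫ r = 𝟙 K) (h2 : r ≫ i = 𝟙 U - q ≫ j) (h3 : i ≫ q = 0) (h4 : j ≫ r = 0) :
    U ≅ M ⊞ K where
  hom := biprod.lift q r
  inv := biprod.desc j i
  hom_inv_id := by rw [biprod.lift_desc, h2]; abel
  inv_hom_id := by ext <;> simp [h1, h3, h4, hjq]

lemma indec_iso {X M : C} (hX : IsIndec X) (hM : ¬ IsZero M) (j : M ⟶ X) (q : X ⟶ M)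
    (hjq : j ≫ q = 𝟙 M) : q ≫ j = 𝟙 X := by
  obtain ⟨K, i, r, h1, h2, h3, h4⟩ := compl j q hjq
  rcases hX.2 _ _ (isoBiprod j q hjq i r h1 h2 h3 h4) with h | h
  · exact (hM h).elim
  · have : r = 0 := h.eq_of_tgt _ _
    rw [this, zero_comp] at h2
    exact (sub_eq_zero.1 h2.symm).symm

lemma local_of_indec [HasFiniteBiproducts C] (hks : IsKrullSchmidt C) {X : C} (hX : IsIndec X) :
    IsLocalRing (End X) := by
  obtain ⟨n, Z, i, hZ⟩ := hks X
  by_cases hn : ∃ a : Fin n, True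
  · obtain ⟨a, -⟩ := hn
    have h0 : (biproduct.ι Z a ≫ i.inv) ≫ (i.hom ≫ biproduct.π Z a) = 𝟙 _ := by simp
    have h1 := indec_iso hX (local_nz (hZ a)) _ _ h0
    exact local_iso ⟨_, _, h0, h1⟩ (hZ a)
  · exfalso
    apply hX.1
    refine IsZero.of_iso ?_ i
    rw [IsZero.iff_id_eq_zero]
    ext a
    exact (hn ⟨a, trivial⟩).elim

end Tri

section Main

variable {k : Type} [Field k] {T R : Type} [Category.{v} T] [Category.{w} R]
    [Preadditive T] [Preadditive R]
    [CategoryTheory.Linear k T] [CategoryTheory.Linear k R]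
    [HasZeroObject T] [HasZeroObject R] [HasShift T ℤ] [HasShift R ℤ]
    [∀ n : ℤ, (shiftFunctor T n).Additive] [∀ n : ℤ, (shiftFunctor R n).Additive]
    [Pretriangulated T] [Pretriangulated R]
    {π : T ⥤ R} [π.CommShift ℤ] [π.IsTriangulated]

lemma nondeg_l (ST : SerreFunctor k T) (horb : TwoOrbit k π) {X Y : T} (f : π.obj Y ⟶ π.obj X)
    (h : ∀ g : π.obj X ⟶ π.obj (ST.S.obj Y),
      ST.pair Y (ST.S.obj Y) (c0 horb _ _ (f ≫ g)) (𝟙 _) = 0) : f = 0 := by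
  by_contra hf
  obtain ⟨n, hn⟩ := exists_ne horb f hf
  apply hn
  apply ST.nondeg_left
  intro a
  obtain ⟨g, hg⟩ := test_right horb f n a
  have := h g
  rwa [hg, ST.nat_right, Category.comp_id] at this

lemma nondeg_r (ST : SerreFunctor k T) (horb : TwoOrbit k π) {X Y : T}
    (g : π.obj X ⟶ π.obj (ST.S.obj Y))
    (h : ∀ f : π.obj Y ⟶ π.obj X,
      ST.pair Y (ST.S.obj Y) (c0 horb _ _ (f ≫ g)) (𝟙 _) = 0) : g = 0 := by
  by_contra hg
  obtain ⟨n, hn⟩ := exists_ne horb g hg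
  obtain ⟨u, hu, ha⟩ := test_left (X := Y) horb g n hn
  apply hu
  apply ST.nondeg_right
  intro a
  obtain ⟨f, hf⟩ := ha a
  have := h f
  rwa [hf, ST.nat_right, Category.comp_id] at this

lemma hull_zero (hhull : IsTriangulatedHullOfImage π) (K : R)
    (hK : ∀ (X : T) (f : π.obj X ⟶ K), f = 0) : IsZero K := by
  let S : Set R := {W | ∀ (n : ℤ) (f : W⟦n⟧ ⟶ K), f = 0}
  have hS : ∀ Y : R, Y ∈ S := by
    apply hhull
    · intro X Y i hX n f
      rw [← cancel_epi ((shiftFunctor R n).map i.hom), comp_zero]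
      exact hX n _
    · intro X n hX m f
      rw [← cancel_epi ((shiftFunctorAdd' R n m (n + m) rfl).hom.app X), comp_zero]
      exact hX (n + m) _
    · intro Tr hTr h1 h3 n f
      have hT := Triangle.shift_distinguished Tr hTr n
      obtain ⟨g, hg⟩ := Triangle.yoneda_exact₂ _ hT f (h1 n _)
      exact hg.trans ((congrArg (fun x => _ ≫ x) (h3 n g)).trans comp_zero)
    · intro X Y i r hir hY n f
      have h1 := hY n ((shiftFunctor R n).map r ≫ f)
      rw [← Category.id_comp f, ← (shiftFunctor R n).map_id, ← hir, Functor.map_comp, Category.assoc, h1,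
        comp_zero]
    · intro X n f
      rw [← cancel_epi ((π.commShiftIso n).hom.app X), comp_zero]
      exact hK _ _
  rw [IsZero.iff_id_eq_zero, ← cancel_epi ((shiftFunctorZero R ℤ).hom.app K), comp_zero]
  exact hS K 0 _

lemma exists_theta (hfinR : HomFinite k R) (ST : SerreFunctor k T)
    (SR : SerreFunctor k R) (horb : TwoOrbit k π) (hhull : IsTriangulatedHullOfImage π) (Y : T) :
    ∃ θ : π.obj (ST.S.obj Y) ⟶ SR.S.obj (π.obj Y),
      (∀ f, SR.pair _ _ f θ = ST.pair Y (ST.S.obj Y) (c0 horb _ _ f) (𝟙 _)) ∧ IsIso θ := by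
  let φ : (π.obj Y ⟶ π.obj (ST.S.obj Y)) →ₗ[k] k :=
    ((ST.pair Y (ST.S.obj Y)).flip (𝟙 _)) ∘ₗ c0 horb Y (ST.S.obj Y)
  obtain ⟨θ, hθ⟩ := serre_repr SR hfinR _ _ φ
  have hθ' : ∀ f, SR.pair _ _ f θ = ST.pair Y (ST.S.obj Y) (c0 horb _ _ f) (𝟙 _) := hθ
  refine ⟨θ, hθ', ?_⟩
  have hinj : ∀ (X : T) (g : π.obj X ⟶ π.obj (ST.S.obj Y)), g ≫ θ = 0 → g = 0 := by
    intro X g hg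
    apply nondeg_r ST horb
    intro f
    rw [← hθ', SR.nat_right, hg, map_zero]
  have hsurj : ∀ (X : T) (t : π.obj X ⟶ SR.S.obj (π.obj Y)), ∃ g, g ≫ θ = t := by
    intro X t
    have := hfinR (π.obj Y) (π.obj X)
    obtain ⟨g, hg⟩ := perf
      ((Linear.comp (S := k) (π.obj Y) (π.obj X) (π.obj (ST.S.obj Y))).compr₂ φ)
      (fun f hf => nondeg_l ST horb f hf) (fun g hg => nondeg_r ST horb g hg)
      ((SR.pair (π.obj Y) (π.obj X)).flip t)
    refine ⟨g, ?_⟩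
    rw [← sub_eq_zero]
    apply SR.nondeg_right
    intro f
    have h1 : φ (f ≫ g) = SR.pair (π.obj Y) (π.obj X) f t := hg f
    rw [map_sub, ← SR.nat_right, hθ, h1, sub_self]
  have hinj1 : ∀ (X : T) (g : π.obj X ⟶ (π.obj (ST.S.obj Y))⟦(1 : ℤ)⟧), g ≫ θ⟦1⟧' = 0 → g = 0 := by
    intro X g hg
    let i : (π.obj (X⟦(-1 : ℤ)⟧))⟦(1 : ℤ)⟧ ≅ π.obj X :=
      ((π.commShiftIso (1 : ℤ)).app (X⟦(-1 : ℤ)⟧)).symm ≪≫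
        π.mapIso ((shiftFunctorCompIsoId T (-1 : ℤ) 1 (by norm_num)).app X)
    obtain ⟨g0, hg0⟩ := (shiftFunctor R (1 : ℤ)).map_surjective (i.hom ≫ g)
    have h1 : g0 ≫ θ = 0 := by
      apply (shiftFunctor R (1 : ℤ)).map_injective
      rw [Functor.map_comp, hg0, Category.assoc, hg, comp_zero, Functor.map_zero]
    have h2 := hinj _ _ h1
    rw [← cancel_epi i.hom, ← hg0, h2, comp_zero, Functor.map_zero]
  obtain ⟨K, c, d, hT⟩ := distinguished_cocone_triangle θ
  have hc : θ ≫ c = 0 := comp_distTriang_mor_zero₁₂ _ hT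
  have hd : d ≫ θ⟦1⟧' = 0 := comp_distTriang_mor_zero₃₁ _ hT
  refine (Triangle.isZero₃_iff_isIso₁ _ hT).1 ?_
  change IsZero K
  apply hull_zero hhull
  intro X f
  have h1 : f ≫ d = 0 := hinj1 X _ (by rw [Category.assoc, hd, comp_zero])
  obtain ⟨t, ht'⟩ : ∃ t : π.obj X ⟶ SR.S.obj (π.obj Y), f = t ≫ c :=
    Triangle.coyoneda_exact₃ _ hT f h1
  obtain ⟨g, hg⟩ := hsurj X t
  rw [ht', ← hg, Category.assoc, hc, comp_zero]

lemma RAS_map (hfinT : HomFinite k T) (hfinR : HomFinite k R) (ST : SerreFunctor k T)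
    (SR : SerreFunctor k R) (horb : TwoOrbit k π) (hhull : IsTriangulatedHullOfImage π) {X Y : T}
    (hX : IsLocalRing (End X)) {h : X ⟶ Y} (hh : RAS h) (ψ : Y ⟶ ST.S.obj X)
    (hψ : IsSplitMono ψ) : RAS (π.map h) := by
  refine ⟨fun h0 => hh.1 ?_, fun W w hw => ?_⟩
  · rw [← c0_map horb h, h0, map_zero]
  obtain ⟨θ, hθ, hiso⟩ := exists_theta hfinR ST SR horb hhull X
  rw [← cancel_mono (π.map ψ), ← cancel_mono θ, zero_comp, zero_comp]
  apply SR.nondeg_right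
  intro g
  rw [← SR.nat_right, hθ, Category.assoc, ← Category.assoc g w, ← Functor.map_comp, c0_right]
  suffices hs : c0 horb X X (g ≫ w) ≫ h = 0 by
    rw [← Category.assoc, hs, zero_comp, map_zero]; rfl
  apply hh.2
  intro hsplit
  have hiso : IsIso (c0 horb X X (g ≫ w)) := by
    have h1 := indec_iso (local_indec hX) (local_nz hX) (section_ (c0 horb X X (g ≫ w)))
      (c0 horb X X (g ≫ w)) (IsSplitEpi.id _)
    exact ⟨_, h1, IsSplitEpi.id _⟩
  have := unit_of_c0 horb hfinT hfinR hX _ hiso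
  exact hw ⟨⟨⟨inv (g ≫ w) ≫ g, by simp⟩⟩⟩

lemma ess_iso {Y Y' : R} (i : Y ≅ Y') (h : π.essImage Y) : π.essImage Y' := by
  obtain ⟨X, ⟨e⟩⟩ := h
  exact ⟨X, ⟨e ≪≫ i⟩⟩

lemma ess_sum [HasFiniteBiproducts T] [HasFiniteBiproducts R] {n : ℕ} (Z : Fin n → T) :
    π.essImage (⨁ fun i => π.obj (Z i)) :=
  ⟨⨁ Z, ⟨π.mapBiproduct Z⟩⟩

lemma ess_retract [HasFiniteBiproducts T] [HasFiniteBiproducts R]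
    [HasBinaryBiproducts T] [HasBinaryBiproducts R]
    (hfinT : HomFinite k T) (hfinR : HomFinite k R) (horb : TwoOrbit k π)
    (hksT : IsKrullSchmidt T) (hksR : IsKrullSchmidt R) {Y Y' : R}
    (hY' : π.essImage Y') (j : Y ⟶ Y') (q : Y' ⟶ Y) (hjq : j ≫ q = 𝟙 Y) : π.essImage Y := by
  obtain ⟨X, ⟨e⟩⟩ := hY'
  obtain ⟨m, W, eW, hW⟩ := hksT X
  obtain ⟨n, Z, eZ, hZ⟩ := hksR Y
  have key : ∀ i : Fin n, ∃ a : Fin m, Nonempty (π.obj (W a) ≅ Z i) := by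
    intro i
    let s : ∀ a, Z i ⟶ π.obj (W a) := fun a =>
      biproduct.ι Z i ≫ eZ.inv ≫ j ≫ e.inv ≫ π.map (eW.hom ≫ biproduct.π W a)
    let t : ∀ a, π.obj (W a) ⟶ Z i := fun a =>
      π.map (biproduct.ι W a ≫ eW.inv) ≫ e.hom ≫ q ≫ eZ.hom ≫ biproduct.π Z i
    have hs : ∑ a, s a ≫ t a = 𝟙 (Z i) := by
      have h1 : ∀ a, s a ≫ t a = (biproduct.ι Z i ≫ eZ.inv ≫ j ≫ e.inv ≫ π.map eW.hom) ≫
          π.map (biproduct.π W a ≫ biproduct.ι W a) ≫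
          (π.map eW.inv ≫ e.hom ≫ q ≫ eZ.hom ≫ biproduct.π Z i) := by
        intro a; simp [s, t]
      simp_rw [h1]
      rw [← Preadditive.comp_sum, ← Preadditive.sum_comp, ← Functor.map_sum, biproduct.total]
      have h2 : π.map eW.hom ≫ π.map eW.inv = 𝟙 _ := by rw [← Functor.map_comp]; simp
      simp only [π.map_id, Category.id_comp, Category.assoc, reassoc_of% h2,
        Iso.inv_hom_id_assoc]
      rw [reassoc_of% hjq]
      simp
    have hloc := hZ i
    let F : Fin m → End (Z i) := fun a => s a ≫ t a
    have hu : IsUnit (∑ a, F a) := by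
      have : ∑ a, F a = 1 := hs
      rw [this]; exact isUnit_one
    obtain ⟨a, -, ha⟩ := IsLocalRing.exists_of_isUnit_sum hu
    have hiso : IsIso (s a ≫ t a) := isIso_of_unit _ ha
    refine ⟨a, ?_⟩
    have h1 : s a ≫ t a ≫ inv (s a ≫ t a) = 𝟙 _ := by rw [← Category.assoc]; simp
    have h2 := indec_iso (local_indec (local_map horb hfinT hfinR (hW a))) (local_nz (hZ i)) _ _ h1
    exact ⟨⟨_, _, h2, h1⟩⟩
  choose a ha using key
  refine ess_iso ?_ (ess_sum (π := π) (fun i => W (a i)))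
  exact biproduct.mapIso (fun i => (ha i).some) ≪≫ eZ.symm

end Main
end Orb

namespace Orb
set_option linter.unusedSectionVars false
universe v w

lemma local_ff {C D : Type} [Category.{v} C] [Category.{w} D] [Preadditive C] [Preadditive D]
    (F : C ⥤ D) [F.Additive] [F.Full] [F.Faithful] {X : C} (h : IsLocalRing (End X)) :
    IsLocalRing (End (F.obj X)) := by
  apply local_mk
  · intro h0
    apply local_ne h
    apply F.map_injective
    rw [F.map_id, h0, F.map_zero]
  · intro f g hfg
    obtain ⟨f', rfl⟩ := F.map_surjective f
    obtain ⟨g', rfl⟩ := F.map_surjective g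
    have : f' + g' = 𝟙 X := by
      apply F.map_injective
      rw [F.map_add, hfg, F.map_id]
    rcases local_add h f' g' this with h1 | h1
    · left; infer_instance
    · right; infer_instance

lemma local_ff' {C D : Type} [Category.{v} C] [Category.{w} D] [Preadditive C] [Preadditive D]
    (F : C ⥤ D) [F.Additive] [F.Full] [F.Faithful] {X : C} (h : IsLocalRing (End (F.obj X))) :
    IsLocalRing (End X) := by
  apply local_mk
  · intro h0
    apply local_ne h
    rw [← F.map_id, h0, F.map_zero]
  · intro f g hfg
    have : F.map f + F.map g = 𝟙 (F.obj X) := by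
      rw [← F.map_add, hfg, F.map_id]
    rcases local_add h _ _ this with h1 | h1
    · left; exact isIso_of_fully_faithful F f
    · right; exact isIso_of_fully_faithful F g

section Main

variable {k : Type} [Field k] {T R : Type} [Category.{v} T] [Category.{w} R]
    [Preadditive T] [Preadditive R]
    [CategoryTheory.Linear k T] [CategoryTheory.Linear k R]
    [HasZeroObject T] [HasZeroObject R] [HasShift T ℤ] [HasShift R ℤ]
    [∀ n : ℤ, (shiftFunctor T n).Additive] [∀ n : ℤ, (shiftFunctor R n).Additive]
    [Pretriangulated T] [Pretriangulated R]
    [HasFiniteBiproducts T] [HasFiniteBiproducts R]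
    [HasBinaryBiproducts T] [HasBinaryBiproducts R]
    {π : T ⥤ R} [π.CommShift ℤ] [π.IsTriangulated]

theorem part1 (hfinT : HomFinite k T) (hfinR : HomFinite k R) (hksT : IsKrullSchmidt T)
    (ST : SerreFunctor k T)
    (SR : SerreFunctor k R) (horb : TwoOrbit k π) (hhull : IsTriangulatedHullOfImage π)
    (Tr : Triangle T) (hTr : IsARTriangle T Tr) : IsARTriangle R (π.mapTriangle.obj Tr) := by
  obtain ⟨hd, h1, h3, hne, hf⟩ := hTr
  have l1 := local_of_indec hksT h1
  have l3 := local_of_indec hksT h3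
  have l1s : IsLocalRing (End (Tr.obj₁⟦(1 : ℤ)⟧)) := local_ff _ l1
  have hras : RAS Tr.mor₃ := by
    refine ⟨hne, fun W w hw => ?_⟩
    obtain ⟨w', rfl⟩ := hf W w hw
    rw [Category.assoc, comp_distTriang_mor_zero₂₃ _ hd, comp_zero]
  obtain ⟨ψ, hψ⟩ := hras.psi ST hfinT l1s
  have hr2 := RAS_map hfinT hfinR ST SR horb hhull l3 hras ψ hψ
  have hr3 := hr2.comp_iso ((π.commShiftIso (1 : ℤ)).app Tr.obj₁)
  have hd' := π.map_distinguished Tr hd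
  refine ⟨hd', local_indec (local_map horb hfinT hfinR l1),
    local_indec (local_map horb hfinT hfinR l3), hr3.1, fun W w hw => ?_⟩
  obtain ⟨w', hw'⟩ := Triangle.coyoneda_exact₃ _ hd' w (hr3.2 W w hw)
  exact ⟨w', hw'.symm⟩

lemma factor_right (hfinT : HomFinite k T) (hfinR : HomFinite k R)
    (ST : SerreFunctor k T)
    (SR : SerreFunctor k R) (horb : TwoOrbit k π) (hhull : IsTriangulatedHullOfImage π)
    {X : T} (hX : IsLocalRing (End X)) : ∃ (B : T) (b : B ⟶ X), ¬ IsSplitEpi (π.map b) ∧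
      ∀ (W : R) (w : W ⟶ π.obj X), ¬ IsSplitEpi w → ∃ g, g ≫ π.map b = w := by
  obtain ⟨h, hh⟩ := RAS_exists ST hfinT hX
  have hr := RAS_map hfinT hfinR ST SR horb hhull hX hh (𝟙 _) inferInstance
  obtain ⟨B, b, d, hT⟩ := distinguished_cocone_triangle₁ h
  have hd' := π.map_distinguished _ hT
  have h0 : b ≫ h = 0 := comp_distTriang_mor_zero₁₂ _ hT
  refine ⟨B, b, fun hs => hr.1 ?_, fun W w hw => ?_⟩
  · rw [← cancel_epi (π.map b), ← π.map_comp, h0, π.map_zero, comp_zero]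
  · obtain ⟨g, hg⟩ : ∃ g : W ⟶ π.obj B, w = g ≫ π.map b :=
      Triangle.coyoneda_exact₂ _ hd' w (hr.2 W w hw)
    exact ⟨g, hg.symm⟩

lemma factor_left (hfinT : HomFinite k T) (hfinR : HomFinite k R)
    (ST : SerreFunctor k T)
    (SR : SerreFunctor k R) (horb : TwoOrbit k π) (hhull : IsTriangulatedHullOfImage π)
    {X : T} (hX : IsLocalRing (End X)) : ∃ (B : T) (b : X ⟶ B), ¬ IsSplitMono (π.map b) ∧
      ∀ (W : R) (w : π.obj X ⟶ W), ¬ IsSplitMono w → ∃ g, π.map b ≫ g = w := by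
  let _ := ST.commShift
  have := ST.isTriangulated
  have := ST.isEquivalence
  let Y := ST.S.objPreimage X
  let i : ST.S.obj Y ≅ X := ST.S.objObjPreimageIso X
  have hY : IsLocalRing (End Y) := local_ff' ST.S (local_iso i.symm hX)
  obtain ⟨h', hh'⟩ := RAS_exists ST hfinT hY
  have hh := hh'.comp_iso i
  set h := h' ≫ i.hom
  have hr := RAS_map hfinT hfinR ST SR horb hhull hY hh i.inv inferInstance
  obtain ⟨B, b, d, hT⟩ := distinguished_cocone_triangle h
  have hd' := π.map_distinguished _ hT
  have h0 : h ≫ b = 0 := comp_distTriang_mor_zero₁₂ _ hT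
  refine ⟨B, b, fun hs => hr.1 ?_, fun W w hw => ?_⟩
  · rw [← cancel_mono (π.map b), ← π.map_comp, h0, π.map_zero, zero_comp]
  · obtain ⟨g, hg⟩ : ∃ g : π.obj B ⟶ W, w = π.map b ≫ g :=
      Triangle.yoneda_exact₂ _ hd' w (hr.left (local_map horb hfinT hfinR hX) w hw)
    exact ⟨g, hg.symm⟩

lemma ess_decomp (hksT : IsKrullSchmidt T) {V : R} (hV : π.essImage V) :
    ∃ (n : ℕ) (Z : Fin n → T) (_ : V ≅ ⨁ fun i => π.obj (Z i)), ∀ i, IsLocalRing (End (Z i)) := by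
  obtain ⟨X, ⟨e⟩⟩ := hV
  obtain ⟨m, W, eW, hW⟩ := hksT X
  exact ⟨m, W, e.symm ≪≫ π.mapIso eW ≪≫ π.mapBiproduct W, hW⟩

def Radical {U V : R} (f : U ⟶ V) : Prop :=
  ∀ (M : R) (j : M ⟶ U) (p : V ⟶ M), j ≫ f ≫ p = 𝟙 M → IsZero M

lemma rad_right (hfinT : HomFinite k T) (hfinR : HomFinite k R) (hksT : IsKrullSchmidt T)
    (hksR : IsKrullSchmidt R) (ST : SerreFunctor k T)
    (SR : SerreFunctor k R) (horb : TwoOrbit k π) (hhull : IsTriangulatedHullOfImage π)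
    {U V : R} (f : U ⟶ V) (hf : IsIrreducibleHom f) (hr : Radical f) (hV : π.essImage V) :
    π.essImage U := by
  obtain ⟨n, C, e, hC⟩ := ess_decomp hksT hV
  choose B b hb hfac using fun i => factor_right hfinT hfinR ST SR horb hhull (hC i)
  have h1 : ∀ i, ¬ IsSplitEpi (f ≫ e.hom ≫ biproduct.π (fun i => π.obj (C i)) i) := by
    intro i hs
    exact local_nz (local_map horb hfinT hfinR (hC i)) (hr _ _ _
      (IsSplitEpi.id (f ≫ e.hom ≫ biproduct.π (fun i => π.obj (C i)) i)))
  choose g hg using fun i => hfac i _ _ (h1 i)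
  have h2 : biproduct.lift g ≫ biproduct.map (fun i => π.map (b i)) ≫ e.inv = f := by
    rw [← cancel_mono e.hom]
    ext i
    simp [hg]
  rcases hf.2.2 _ _ _ h2 with h3 | h3
  · exact ess_retract hfinT hfinR horb hksT hksR (ess_sum B) _ _ (IsSplitMono.id (biproduct.lift g))
  · exfalso
    by_cases hn : ∃ a : Fin n, True
    · obtain ⟨i, -⟩ := hn
      apply hb i
      have h4 := IsSplitEpi.id (biproduct.map (fun i => π.map (b i)) ≫ e.inv)
      refine ⟨⟨⟨biproduct.ι (fun i => π.obj (C i)) i ≫ e.inv ≫ section_ (biproduct.map (fun i => π.map (b i)) ≫ e.inv) ≫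
        biproduct.π (fun i => π.obj (B i)) i, ?_⟩⟩⟩
      have h5 : section_ (biproduct.map (fun i => π.map (b i)) ≫ e.inv) ≫
        biproduct.map (fun i => π.map (b i)) = e.hom := by
        rw [← cancel_mono e.inv, Category.assoc, h4]; simp
      have h6 := biproduct.map_π (fun i => π.map (b i)) i
      rw [Category.assoc, Category.assoc, Category.assoc, ← h6, reassoc_of% h5]
      simp
    · apply hf.2.1
      have hz : IsZero V := by
        refine IsZero.of_iso ?_ e
        rw [IsZero.iff_id_eq_zero]
        ext a
        exact (hn ⟨a, trivial⟩).elim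
      exact ⟨⟨⟨0, hz.eq_of_src _ _⟩⟩⟩

lemma rad_left (hfinT : HomFinite k T) (hfinR : HomFinite k R) (hksT : IsKrullSchmidt T)
    (hksR : IsKrullSchmidt R) (ST : SerreFunctor k T)
    (SR : SerreFunctor k R) (horb : TwoOrbit k π) (hhull : IsTriangulatedHullOfImage π)
    {U V : R} (f : U ⟶ V) (hf : IsIrreducibleHom f) (hr : Radical f) (hU : π.essImage U) :
    π.essImage V := by
  obtain ⟨n, C, e, hC⟩ := ess_decomp hksT hU
  choose B b hb hfac using fun i => factor_left hfinT hfinR ST SR horb hhull (hC i)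
  have h1 : ∀ i, ¬ IsSplitMono (biproduct.ι (fun i => π.obj (C i)) i ≫ e.inv ≫ f) := by
    intro i hs
    refine local_nz (local_map horb hfinT hfinR (hC i))
      (hr _ (biproduct.ι (fun i => π.obj (C i)) i ≫ e.inv) 
        (retraction (biproduct.ι (fun i => π.obj (C i)) i ≫ e.inv ≫ f)) ?_)
    rw [← IsSplitMono.id (biproduct.ι (fun i => π.obj (C i)) i ≫ e.inv ≫ f)]
    simp only [Category.assoc]
  choose g hg using fun i => hfac i _ _ (h1 i)
  have h2 : (e.hom ≫ biproduct.map (fun i => π.map (b i))) ≫ biproduct.desc g = f := by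
    rw [← cancel_epi e.inv]
    ext i
    simp [hg]
  rcases hf.2.2 _ _ _ h2 with h3 | h3
  · exfalso
    by_cases hn : ∃ a : Fin n, True
    · obtain ⟨i, -⟩ := hn
      apply hb i
      have h4 := IsSplitMono.id (e.hom ≫ biproduct.map (fun i => π.map (b i)))
      refine ⟨⟨⟨biproduct.ι (fun i => π.obj (B i)) i ≫ retraction (e.hom ≫ biproduct.map (fun i => π.map (b i))) ≫
        e.hom ≫ biproduct.π (fun i => π.obj (C i)) i, ?_⟩⟩⟩
      have h5 : biproduct.map (fun i => π.map (b i)) ≫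
        retraction (e.hom ≫ biproduct.map (fun i => π.map (b i))) = e.inv := by
        rw [← cancel_epi e.hom, ← Category.assoc, h4]; simp
      have h6 := biproduct.ι_map (fun i => π.map (b i)) i
      rw [← reassoc_of% h6, reassoc_of% h5]
      simp
    · apply hf.1
      have hz : IsZero U := by
        refine IsZero.of_iso ?_ e
        rw [IsZero.iff_id_eq_zero]
        ext a
        exact (hn ⟨a, trivial⟩).elim
      exact ⟨⟨⟨0, hz.eq_of_src _ _⟩⟩⟩
  · exact ess_retract hfinT hfinR horb hksT hksR (ess_sum B) _ _ (IsSplitEpi.id (biproduct.desc g))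

lemma irr_reduce {U V M U1 V1 : R} (f : U ⟶ V) (hf : IsIrreducibleHom f) (j : M ⟶ U) (p : V ⟶ M)
    (hjp : j ≫ f ≫ p = 𝟙 M)
    (iU : U1 ⟶ U) (rU : U ⟶ U1) (a1 : iU ≫ rU = 𝟙 U1) (a2 : rU ≫ iU = 𝟙 U - (f ≫ p) ≫ j)
    (a3 : iU ≫ f ≫ p = 0) (a4 : j ≫ rU = 0)
    (iV : V1 ⟶ V) (rV : V ⟶ V1) (b1 : iV ≫ rV = 𝟙 V1) (b2 : rV ≫ iV = 𝟙 V - p ≫ j ≫ f)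
    (b3 : iV ≫ p = 0) (b4 : (j ≫ f) ≫ rV = 0) : IsIrreducibleHom (iU ≫ f ≫ rV) := by
  have c1 : iU ≫ f = (iU ≫ f ≫ rV) ≫ iV := by
    have := reassoc_of% a3
    simp [b2, this]
  have c2 : f ≫ rV = rU ≫ iU ≫ f ≫ rV := by
    have := reassoc_of% a2
    rw [this]
    simp only [Category.assoc] at b4
    simp [b4]
  have d : ∀ x : U1 ⟶ V1, rU ≫ x ≫ iV = f - (f ≫ p) ≫ j ≫ f → iU ≫ f ≫ rV = x := by
    intro x hx
    have : iU ≫ (rU ≫ x ≫ iV) ≫ rV = x := by simp [b1, reassoc_of% a1]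
    rw [← this, hx]
    have := reassoc_of% a3
    simp [this]
  have e1 : f = (f ≫ p) ≫ j ≫ f + rU ≫ (iU ≫ f ≫ rV) ≫ iV := by
    rw [← c1, ← Category.assoc rU, a2]; simp
  generalize hf1 : iU ≫ f ≫ rV = f1 at *
  refine ⟨fun hs => hf.1 ?_, fun hs => hf.2.1 ?_, fun W g h hgh => ?_⟩
  · have h1 := IsSplitMono.id f1
    refine ⟨⟨⟨p ≫ j + rV ≫ retraction f1 ≫ iU, ?_⟩⟩⟩
    rw [Preadditive.comp_add, reassoc_of% c2, reassoc_of% h1, a2]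
    simp
  · have h1 := IsSplitEpi.id f1
    refine ⟨⟨⟨p ≫ j + rV ≫ section_ f1 ≫ iU, ?_⟩⟩⟩
    rw [Preadditive.add_comp, Category.assoc, Category.assoc, Category.assoc, c1,
      reassoc_of% h1, b2]
    simp
  · have h0 : biprod.lift (f ≫ p) (rU ≫ g) ≫ biprod.desc (j ≫ f) (h ≫ iV) = f := by
      rw [biprod.lift_desc]
      conv_rhs => rw [e1, ← hgh]
      simp
    rcases hf.2.2 _ _ _ h0 with hs | hs
    · left
      have h1 := IsSplitMono.id (biprod.lift (f ≫ p) (rU ≫ g))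
      refine ⟨⟨⟨biprod.inr ≫ retraction (biprod.lift (f ≫ p) (rU ≫ g)) ≫ rU, ?_⟩⟩⟩
      have h2 : iU ≫ biprod.lift (f ≫ p) (rU ≫ g) = g ≫ biprod.inr := by
        ext
        · simp [a3]
        · simp [reassoc_of% a1]
      rw [← reassoc_of% h2, reassoc_of% h1, a1]
    · right
      have h1 := IsSplitEpi.id (biprod.desc (j ≫ f) (h ≫ iV))
      refine ⟨⟨⟨iV ≫ section_ (biprod.desc (j ≫ f) (h ≫ iV)) ≫ biprod.snd, ?_⟩⟩⟩
      have h2 : biprod.desc (j ≫ f) (h ≫ iV) ≫ rV = biprod.snd ≫ h := by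
        ext
        · simpa using b4
        · simp [b1]
      rw [Category.assoc, Category.assoc, ← h2, reassoc_of% h1, b1]

lemma finrank_lt (hfinR : HomFinite k R) {V M V1 : R} (hM : ¬ IsZero M) (i : M ⟶ V) (p : V ⟶ M)
    (hip : i ≫ p = 𝟙 M) (iV : V1 ⟶ V) (rV : V ⟶ V1) (b1 : iV ≫ rV = 𝟙 V1)
    (b3 : iV ≫ p = 0) : Module.finrank k (V1 ⟶ V1) < Module.finrank k (V ⟶ V) := by
  have := hfinR V V
  let L : (V1 ⟶ V1) →ₗ[k] (V ⟶ V) :=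
    { toFun := fun x => rV ≫ x ≫ iV
      map_add' := by intros; simp
      map_smul' := by intros; simp }
  have hL : Function.Injective L := by
    intro x y hxy
    have h : rV ≫ x ≫ iV = rV ≫ y ≫ iV := hxy
    have h2 : iV ≫ (rV ≫ x ≫ iV) ≫ rV = iV ≫ (rV ≫ y ≫ iV) ≫ rV := by rw [h]
    simpa [b1, reassoc_of% b1] using h2
  rw [← LinearMap.finrank_range_of_inj hL]
  apply Submodule.finrank_lt
  intro htop
  have : 𝟙 V ∈ LinearMap.range L := by rw [htop]; trivial
  obtain ⟨x, hx⟩ := this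
  have hx' : rV ≫ x ≫ iV = 𝟙 V := hx
  apply hM
  rw [IsZero.iff_id_eq_zero, ← hip]
  have : p = 0 := by
    rw [← Category.id_comp p, ← hx']; simp [b3]
  rw [this, comp_zero]

lemma ess_biprod {M K : R} (hM : π.essImage M) (hK : π.essImage K) : π.essImage (M ⊞ K) := by
  obtain ⟨X, ⟨e⟩⟩ := hM
  have := preservesBinaryBiproducts_of_preservesBiproducts π
  obtain ⟨Y, ⟨e'⟩⟩ := hK
  exact ⟨X ⊞ Y, ⟨π.mapBiprod X Y ≪≫ biprod.mapIso e e'⟩⟩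

theorem part2 (hfinT : HomFinite k T) (hfinR : HomFinite k R) (hksT : IsKrullSchmidt T)
    (hksR : IsKrullSchmidt R) (ST : SerreFunctor k T)
    (SR : SerreFunctor k R) (horb : TwoOrbit k π) (hhull : IsTriangulatedHullOfImage π)
    (N : ℕ) : ∀ {U V : R} (f : U ⟶ V), Module.finrank k (V ⟶ V) = N → IsIrreducibleHom f →
      (π.essImage U ↔ π.essImage V) := by
  induction N using Nat.strong_induction_on with
  | _ N ih =>
  intro U V f hN hf
  by_cases hr : Radical f
  · exact ⟨rad_left hfinT hfinR hksT hksR ST SR horb hhull f hf hr,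
      rad_right hfinT hfinR hksT hksR ST SR horb hhull f hf hr⟩
  simp only [Radical, not_forall] at hr
  obtain ⟨M, j, p, hjp, hM⟩ := hr
  have hjp' : (j ≫ f) ≫ p = 𝟙 M := by rw [Category.assoc]; exact hjp
  obtain ⟨U1, iU, rU, a1, a2, a3, a4⟩ := compl j (f ≫ p) hjp
  obtain ⟨V1, iV, rV, b1, b2, b3, b4⟩ := compl (j ≫ f) p hjp'
  have h1 := irr_reduce f hf j p hjp iU rU a1 a2 a3 a4 iV rV b1 b2 b3 b4
  have h2 := ih _ (hN ▸ finrank_lt hfinR hM (j ≫ f) p hjp' iV rV b1 b3) _ rfl h1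
  have eU := isoBiprod j (f ≫ p) hjp iU rU a1 a2 a3 a4
  have eV := isoBiprod (j ≫ f) p hjp' iV rV b1 b2 b3 b4
  have ret := fun {Y Y' : R} => ess_retract (Y := Y) (Y' := Y') hfinT hfinR horb hksT hksR
  constructor
  · intro hU
    exact ess_iso eV.symm (ess_biprod (ret hU _ _ hjp) (h2.1 (ret hU _ _ a1)))
  · intro hV
    exact ess_iso eU.symm (ess_biprod (ret hV _ _ hjp') (h2.2 (ret hV _ _ b1)))

end Main
end Orb

theorem ar_triangles_are_preserved
    (k : Type) [Field k] (T R : Type) [Category T] [Category R]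
    [Preadditive T] [Preadditive R]
    [CategoryTheory.Linear k T] [CategoryTheory.Linear k R]
    [HasZeroObject T] [HasZeroObject R] [HasShift T ℤ] [HasShift R ℤ]
    [∀ n : ℤ, (shiftFunctor T n).Additive] [∀ n : ℤ, (shiftFunctor R n).Additive]
    [Pretriangulated T] [Pretriangulated R]
    [HasFiniteBiproducts T] [HasFiniteBiproducts R]
    [HasBinaryBiproducts T] [HasBinaryBiproducts R]
    (hfinT : HomFinite k T) (hfinR : HomFinite k R)
    (hksT : IsKrullSchmidt T) (hksR : IsKrullSchmidt R)
    (ST : SerreFunctor k T) (SR : SerreFunctor k R)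
    (π : T ⥤ R) [π.CommShift ℤ] [π.IsTriangulated]
    (horb : TwoOrbit k π)
    (hhull : IsTriangulatedHullOfImage π)
    (hARex : ∀ Z : R, IsIndec Z → ∃ Tr : Triangle R, IsARTriangle R Tr ∧ Tr.obj₃ = Z) :
    (∀ Tr : Triangle T, IsARTriangle T Tr → IsARTriangle R (π.mapTriangle.obj Tr)) ∧
    ¬ ∃ (U V : R) (f : U ⟶ V), IsIrreducibleHom f ∧
        Xor' (π.essImage U) (π.essImage V) := by
  refine ⟨fun Tr hTr => Orb.part1 hfinT hfinR hksT ST SR horb hhull Tr hTr, ?_⟩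
  rintro ⟨U, V, f, hf, hx⟩
  have h := Orb.part2 hfinT hfinR hksT hksR ST SR horb hhull _ f rfl hf
  rcases hx with ⟨h1, h2⟩ | ⟨h1, h2⟩
  · exact h2 (h.1 h1)
  · exact h2 (h.2 h1)
end
end

section
/- Let k be a field. Let T and R be Hom-finite k-linear Krull–Schmidt triangulated categories, let S be a Serre functor on T and S~ a Serre functor on R, and let π : T → R be a triangle functor which satisfies the 2-orbit property and such that R is the triangulated hull of the image of π. Then for every indecomposable object X of T there is an isomorphism π(S X) ≅ S~(π X) in R; that is, π commutes with the Serre functors on indecomposable objects. -/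
/- Statement 1: A triangle functor `π : T ⥤ R` between Hom-finite k-linear Krull–Schmidt
triangulated categories with Serre functors `S`, `S~`, satisfying the 2-orbit property and
such that `R` is the triangulated hull of the image of `π`, commutes with the Serre
functors on indecomposable objects: `π (S X) ≅ S~ (π X)` for every indecomposable `X`. -/

noncomputable section

open CategoryTheory Limits Pretriangulated

section Helpers

/-- In finite dimension, a pairing nondegenerate on both sides represents all functionals. -/
lemma exists_rep {k V W : Type*} [Field k] [AddCommGroup V] [Module k V] [AddCommGroup W]
    [Module k W] [FiniteDimensional k V] [FiniteDimensional k W]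
    (B : V →ₗ[k] W →ₗ[k] k) (h1 : ∀ v, (∀ w, B v w = 0) → v = 0)
    (l : V →ₗ[k] k) : ∃ w, ∀ v, B v w = l v := by
  have hinj : Function.Injective B := by
    rw [injective_iff_map_eq_zero]
    intro v hv
    exact h1 v (fun w => by rw [hv]; rfl)
  have hs : Function.Surjective B.flip := by
    rw [← LinearMap.range_eq_top]
    have := LinearMap.flip_injective_iff₁ (B := B.flip)
    exact LinearMap.range_eq_top.2 (this.1 (by simpa using hinj))
  obtain ⟨w, hw⟩ := hs l
  exact ⟨w, fun v => by rw [← hw]; rfl⟩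

/-- A morphism inducing bijections on `Hom(πY, -)` is an isomorphism. -/
lemma isIso_of_hull {T R : Type} [Category T] [Category R] [Preadditive R]
    [HasZeroObject R] [HasShift T ℤ] [HasShift R ℤ] [∀ n : ℤ, (shiftFunctor R n).Additive]
    [Pretriangulated R] (π : T ⥤ R) [π.CommShift ℤ] (hhull : IsTriangulatedHullOfImage π)
    {A B : R} (φ : A ⟶ B)
    (hinj : ∀ (Y : T) (g : π.obj Y ⟶ A), g ≫ φ = 0 → g = 0)
    (hsurj : ∀ (Y : T) (h : π.obj Y ⟶ B), ∃ g : π.obj Y ⟶ A, g ≫ φ = h) : IsIso φ := by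
  obtain ⟨C, β, γ, hT⟩ := distinguished_cocone_triangle φ
  have key : ∀ (Y : T) (f : π.obj Y ⟶ C), f = 0 := by
    intro Y f
    have h1 : f ≫ γ = 0 := by
      let i : (π.obj (Y⟦(-1:ℤ)⟧))⟦(1:ℤ)⟧ ≅ π.obj Y :=
        ((π.commShiftIso (1:ℤ)).app (Y⟦(-1:ℤ)⟧)).symm ≪≫
          π.mapIso ((shiftFunctorCompIsoId T (-1:ℤ) 1 (by norm_num)).app Y)
      obtain ⟨g, hg⟩ := (shiftFunctor R (1:ℤ)).map_surjective (i.hom ≫ f ≫ γ)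
      have hz : γ ≫ φ⟦(1:ℤ)⟧' = 0 := comp_distTriang_mor_zero₃₁ _ hT
      have : g ≫ φ = 0 := by
        apply (shiftFunctor R (1:ℤ)).map_injective
        rw [Functor.map_comp, hg, Functor.map_zero, Category.assoc, Category.assoc, hz]
        simp
      have := hinj _ g this
      rw [this, Functor.map_zero] at hg
      rw [← cancel_epi i.hom, ← hg, comp_zero]
    obtain ⟨h, rfl⟩ := Triangle.coyoneda_exact₃ _ hT f h1
    obtain ⟨g, rfl⟩ := hsurj Y h
    have hz : φ ≫ β = 0 := comp_distTriang_mor_zero₁₂ _ hT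
    change (g ≫ φ) ≫ β = 0
    rw [Category.assoc, hz, comp_zero]
  have all := hhull {Z | ∀ (n : ℤ) (f : Z⟦n⟧ ⟶ C), f = 0} ?_ ?_ ?_ ?_ ?_
  · have h0 : IsZero C := by
      rw [IsZero.iff_id_eq_zero]
      have := all C 0 ((shiftFunctorZero R ℤ).hom.app C)
      rw [← cancel_epi ((shiftFunctorZero R ℤ).hom.app C), comp_zero, ← this]
      exact Category.comp_id _
    exact (Triangle.isZero₃_iff_isIso₁ _ hT).1 h0
  · intro X Y i hX n f
    rw [← cancel_epi (i.hom⟦n⟧'), comp_zero]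
    exact hX n _
  · intro X m hX n f
    rw [← cancel_epi ((shiftFunctorAdd R m n).hom.app X), comp_zero]
    exact hX _ _
  · intro Tr hTr h1 h3 n f
    have hs := Triangle.shift_distinguished Tr hTr n
    obtain ⟨g, hg⟩ := Triangle.yoneda_exact₂ _ hs f (h1 n _)
    rw [hg]
    have : g = 0 := h3 n g
    rw [this, comp_zero]
    rfl
  · intro X Y i r hir hY n f
    have : f = i⟦n⟧' ≫ (r⟦n⟧' ≫ f) := by
      rw [← Category.assoc, ← Functor.map_comp, hir]; simp
    rw [this, hY n (r⟦n⟧' ≫ f), comp_zero]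
  · intro X n f
    rw [← cancel_epi ((π.commShiftIso n).hom.app X), comp_zero]
    exact key _ _

variable {k : Type} [Field k] {T R : Type} [Category T] [Category R]
    [Preadditive T] [Preadditive R]
    [CategoryTheory.Linear k T] [CategoryTheory.Linear k R]
    [HasZeroObject T] [HasShift T ℤ] [HasShift R ℤ]
    [∀ n : ℤ, (shiftFunctor T n).Additive]
    [Pretriangulated T]

/-- The trace functional on `Hom(πX, πSX)`. -/
def orbTr (ST : SerreFunctor k T) {π : T ⥤ R} (horb : TwoOrbit k π) (X : T) :
    (π.obj X ⟶ π.obj (ST.S.obj X)) →ₗ[k] k :=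
  (ST.pair X X (𝟙 X)) ∘ₗ
    (Linear.rightComp k X
      ((shiftFunctorZero' T (2 * (0:ℤ)) (by norm_num)).hom.app (ST.S.obj X))) ∘ₗ
    (DirectSum.component k ℤ
      (fun n : ℤ => (X ⟶ (shiftFunctor T (2 * n)).obj (ST.S.obj X))) 0) ∘ₗ
    (horb.e X (ST.S.obj X)).toLinearMap

lemma e_comp_zero {π : T ⥤ R} (horb : TwoOrbit k π) {X Y Z : T}
    (m n : ℤ) (h : m + n = 0) (a : X ⟶ (shiftFunctor T (2 * m)).obj Y)
      (b : Y ⟶ (shiftFunctor T (2 * n)).obj Z) :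
    horb.e X Z ((horb.e X Y).symm (DirectSum.of
      (fun n : ℤ => (X ⟶ (shiftFunctor T (2 * n)).obj Y)) m a) ≫
      (horb.e Y Z).symm (DirectSum.of
        (fun n : ℤ => (Y ⟶ (shiftFunctor T (2 * n)).obj Z)) n b)) 0 =
      a ≫ (shiftFunctor T (2 * m)).map b ≫
        (shiftFunctorAdd' T (2 * n) (2 * m) (2 * 0) (by rw [← h]; ring)).inv.app Z := by
  rw [horb.comp, LinearEquiv.apply_symm_apply]
  generalize_proofs p1 p2
  revert p1 p2
  rw [h]
  intro p1 p2
  exact DirectSum.of_eq_same _ _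

lemma e_comp_zero' {π : T ⥤ R} (horb : TwoOrbit k π) {X Y Z : T}
    (m n : ℤ) (h : m + n ≠ 0) (a : X ⟶ (shiftFunctor T (2 * m)).obj Y)
      (b : Y ⟶ (shiftFunctor T (2 * n)).obj Z) :
    horb.e X Z ((horb.e X Y).symm (DirectSum.of
      (fun n : ℤ => (X ⟶ (shiftFunctor T (2 * n)).obj Y)) m a) ≫
      (horb.e Y Z).symm (DirectSum.of
        (fun n : ℤ => (Y ⟶ (shiftFunctor T (2 * n)).obj Z)) n b)) 0 = 0 := by
  rw [horb.comp, LinearEquiv.apply_symm_apply]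
  exact DirectSum.of_eq_of_ne _ _ _ h.symm

lemma e_comp_left {π : T ⥤ R} (horb : TwoOrbit k π) {X Y Z : T}
    (m n : ℤ) (h : m + n = 0) (a : X ⟶ (shiftFunctor T (2 * m)).obj Y)
      (g : π.obj Y ⟶ π.obj Z) :
    horb.e X Z ((horb.e X Y).symm (DirectSum.of
      (fun n : ℤ => (X ⟶ (shiftFunctor T (2 * n)).obj Y)) m a) ≫ g) 0 =
      a ≫ (shiftFunctor T (2 * m)).map (horb.e Y Z g n) ≫
        (shiftFunctorAdd' T (2 * n) (2 * m) (2 * 0) (by rw [← h]; ring)).inv.app Z := by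
  obtain ⟨g, rfl⟩ := (horb.e Y Z).symm.surjective g
  rw [LinearEquiv.apply_symm_apply]
  induction g using DirectSum.induction_on with
  | zero => simp
  | of i x =>
    by_cases hi : i = n
    · subst hi
      rw [e_comp_zero horb m i h, DirectSum.of_eq_same]
    · rw [e_comp_zero' horb m i (by omega), DirectSum.of_eq_of_ne _ _ _ (Ne.symm hi)]
      simp
  | add x y hx hy =>
    rw [map_add, Preadditive.comp_add, map_add, DirectSum.add_apply, hx, hy, DirectSum.add_apply]
    simp

lemma e_comp_right {π : T ⥤ R} (horb : TwoOrbit k π) {X Y Z : T}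
    (m n : ℤ) (h : m + n = 0) (f : π.obj X ⟶ π.obj Y)
      (b : Y ⟶ (shiftFunctor T (2 * n)).obj Z) :
    horb.e X Z (f ≫ (horb.e Y Z).symm (DirectSum.of
      (fun n : ℤ => (Y ⟶ (shiftFunctor T (2 * n)).obj Z)) n b)) 0 =
      horb.e X Y f m ≫ (shiftFunctor T (2 * m)).map b ≫
        (shiftFunctorAdd' T (2 * n) (2 * m) (2 * 0) (by rw [← h]; ring)).inv.app Z := by
  obtain ⟨f, rfl⟩ := (horb.e X Y).symm.surjective f
  rw [LinearEquiv.apply_symm_apply]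
  induction f using DirectSum.induction_on with
  | zero => simp
  | of i x =>
    by_cases hi : i = m
    · subst hi
      rw [e_comp_zero horb i n h, DirectSum.of_eq_same]
    · rw [e_comp_zero' horb i n (by omega), DirectSum.of_eq_of_ne _ _ _ (Ne.symm hi)]
      simp
  | add x y hx hy =>
    rw [map_add, Preadditive.add_comp, map_add, DirectSum.add_apply, hx, hy, DirectSum.add_apply]
    simp

lemma orbTr_apply (ST : SerreFunctor k T) {π : T ⥤ R} (horb : TwoOrbit k π) (X : T)
    (h : π.obj X ⟶ π.obj (ST.S.obj X)) : orbTr ST horb X h =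
      ST.pair X X (𝟙 X) (horb.e X (ST.S.obj X) h 0 ≫
      ((shiftFunctorZero' T (2 * (0:ℤ)) (by norm_num)).hom.app (ST.S.obj X))) := rfl

lemma pair_comp (ST : SerreFunctor k T) {X Y : T} (a : X ⟶ Y) (b : Y ⟶ ST.S.obj X) :
    ST.pair X X (𝟙 X) (a ≫ b) = ST.pair X Y a b := by
  rw [← ST.nat_right, Category.id_comp]

lemma orbTr_nondeg_right (ST : SerreFunctor k T) {π : T ⥤ R} (horb : TwoOrbit k π) (X Y : T)
    (g : π.obj Y ⟶ π.obj (ST.S.obj X))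
    (hg : ∀ f : π.obj X ⟶ π.obj Y, orbTr ST horb X (f ≫ g) = 0) : g = 0 := by
  apply (horb.e _ _).injective
  rw [map_zero]
  refine DFinsupp.ext (fun n => ?_)
  change horb.e _ _ g n = 0
  apply (shiftFunctor T (2 * (-n))).map_injective
  rw [Functor.map_zero]
  have h0 : (-n) + n = 0 := by ring
  have := ST.nondeg_right X _ ((shiftFunctor T (2 * (-n))).map (horb.e _ _ g n) ≫
        (shiftFunctorAdd' T (2 * n) (2 * (-n)) (2 * 0) (by ring)).inv.app _ ≫
        (shiftFunctorZero' T (2 * (0:ℤ)) (by norm_num)).hom.app (ST.S.obj X)) (by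
    intro a
    have := hg ((horb.e X Y).symm (DirectSum.of
      (fun n : ℤ => (X ⟶ (shiftFunctor T (2 * n)).obj Y)) (-n) a))
    rw [orbTr_apply, e_comp_left horb (-n) n h0, Category.assoc, pair_comp, Category.assoc] at this
    exact this)
  rw [← Category.assoc] at this
  rwa [Preadditive.IsIso.comp_right_eq_zero, Preadditive.IsIso.comp_right_eq_zero] at this

lemma orbTr_nondeg_left (ST : SerreFunctor k T) {π : T ⥤ R} (horb : TwoOrbit k π) (X Y : T)
    (f : π.obj X ⟶ π.obj Y)
    (hf : ∀ g : π.obj Y ⟶ π.obj (ST.S.obj X), orbTr ST horb X (f ≫ g) = 0) : f = 0 := by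
  apply (horb.e _ _).injective
  rw [map_zero]
  refine DFinsupp.ext (fun n => ?_)
  change horb.e _ _ f n = 0
  have h0 : n + (-n) = 0 := by ring
  apply ST.nondeg_left
  intro c
  let i := (shiftFunctorAdd' T (2 * (-n)) (2 * n) (2 * 0) (by ring)).symm.app (ST.S.obj X) ≪≫
        (shiftFunctorZero' T (2 * (0:ℤ)) (by norm_num)).app (ST.S.obj X)
  obtain ⟨b, hb⟩ := (shiftFunctor T (2 * n)).map_surjective (c ≫ i.inv)
  have := hf ((horb.e _ _).symm (DirectSum.of
      (fun n : ℤ => (Y ⟶ (shiftFunctor T (2 * n)).obj (ST.S.obj X))) (-n) b))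
  rw [orbTr_apply, e_comp_right horb n (-n) h0, Category.assoc, pair_comp, Category.assoc] at this
  have hc : c = (shiftFunctor T (2 * n)).map b ≫ i.hom := by
    rw [hb, Category.assoc, Iso.inv_hom_id, Category.comp_id]
  rw [hc]
  exact this

end Helpers

theorem serre_functor_commutes_with_orbit_functor_on_indecomposables
    (k : Type) [Field k] (T R : Type) [Category T] [Category R]
    [Preadditive T] [Preadditive R]
    [CategoryTheory.Linear k T] [CategoryTheory.Linear k R]
    [HasZeroObject T] [HasZeroObject R] [HasShift T ℤ] [HasShift R ℤ]
    [∀ n : ℤ, (shiftFunctor T n).Additive] [∀ n : ℤ, (shiftFunctor R n).Additive]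
    [Pretriangulated T] [Pretriangulated R]
    [HasFiniteBiproducts T] [HasFiniteBiproducts R]
    [HasBinaryBiproducts T] [HasBinaryBiproducts R]
    (hfinT : HomFinite k T) (hfinR : HomFinite k R)
    (hksT : IsKrullSchmidt T) (hksR : IsKrullSchmidt R)
    (ST : SerreFunctor k T) (SR : SerreFunctor k R)
    (π : T ⥤ R) [π.CommShift ℤ] [π.IsTriangulated]
    (horb : TwoOrbit k π)
    (hhull : IsTriangulatedHullOfImage π) :
    ∀ X : T, IsIndec X → Nonempty (π.obj (ST.S.obj X) ≅ SR.S.obj (π.obj X)) := by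
  intro X _
  have := hfinR
  have fin : ∀ A B : R, FiniteDimensional k (A ⟶ B) := hfinR
  obtain ⟨φ, hφ⟩ := exists_rep (SR.pair (π.obj X) (π.obj (ST.S.obj X)))
    (SR.nondeg_left _ _) (orbTr ST horb X)
  have hpair : ∀ (Y : T) (f : π.obj X ⟶ π.obj Y) (g : π.obj Y ⟶ π.obj (ST.S.obj X)),
      SR.pair _ _ f (g ≫ φ) = orbTr ST horb X (f ≫ g) := by
    intro Y f g
    rw [← SR.nat_right, hφ]
  have : IsIso φ := by
    apply isIso_of_hull π hhull
    · intro Y g hg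
      apply orbTr_nondeg_right ST horb X Y g
      intro f
      rw [← hpair, hg, map_zero]
    · intro Y h
      let B : (π.obj X ⟶ π.obj Y) →ₗ[k] (π.obj Y ⟶ π.obj (ST.S.obj X)) →ₗ[k] k :=
        (Linear.comp (S := k) (π.obj X) (π.obj Y) (π.obj (ST.S.obj X))).compr₂ (orbTr ST horb X)
      obtain ⟨g, hg⟩ := exists_rep B (fun f hf => orbTr_nondeg_left ST horb X Y f hf)
        ((SR.pair (π.obj X) (π.obj Y)).flip h)
      refine ⟨g, ?_⟩
      rw [← sub_eq_zero]
      apply SR.nondeg_right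
      intro f
      rw [map_sub, hpair, sub_eq_zero]
      exact hg f
  exact ⟨asIso φ⟩
end
end

section
/- Fix integers m ≥ 1 and n ≥ 2 and set l = m + n + 1, with indices 0, 1, …, m+n. Let C = (c_{ij}) ∈ M_l(Z) be the symmetric integer matrix determined by: c_{ii} = 2 for all i; c_{01} = c_{10} = −2; c_{02} = c_{20} = c_{0,n+1} = c_{n+1,0} = 1; c_{ij} = c_{ji} = −1 for each unordered pair {i, i+1} with 1 ≤ i ≤ n−1, for the pair {1, n+1}, and for each pair {i, i+1} with n+1 ≤ i ≤ n+m−1; and c_{ij} = 0 otherwise. Let g' be the complex Lie algebra presented by generators h_0, …, h_{m+n}, e_0, …, e_{m+n}, f_0, …, f_{m+n} subject to the relations: [h_i, h_j] = 0; [h_i, e_j] = c_{ij} e_j; [h_i, f_j] = −c_{ij} f_j; [e_i, f_i] = h_i; (ad e_i)^{max(1, 1−c_{ij})}(e_j) = 0 and (ad f_i)^{max(1, 1−c_{ij})}(f_j) = 0 for all i ≠ j; and (ad e_i)^{max(1, 1+c_{ij})}(f_j) = 0 and (ad f_i)^{max(1, 1+c_{ij})}(e_j) = 0 for all i, j. Then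 the degree-zero homogeneous component g'_0 of g' with respect to its Z^l-grading satisfies dim_C g'_0 ≥ m + n + 2. -/
/- Statement 3: For the intersection matrix `C` attached to the algebra `A` of Section 5
(quiver with a double arrow `0 ⇉ 1` and two arms of lengths `n-1` and `m` attached at the
vertex `1`, with two zero relations), the degree-zero homogeneous component of the
`ℤ^l`-graded derived GIM Lie algebra `g' = [GIM(C), GIM(C)]` has dimension at least
`m + n + 2`. -/

noncomputable section

open LieAlgebra

/-- The intersection matrix `C = (c_{ij})`, `0 ≤ i, j ≤ m + n`. -/
def cMat (m n : ℕ) (i j : Fin (m + n + 1)) : ℤ :=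
  if i = j then 2
  else
    let p := min i.val j.val
    let q := max i.val j.val
    if p = 0 ∧ q = 1 then -2
    else if p = 0 ∧ (q = 2 ∨ q = n + 1) then 1
    else if (1 ≤ p ∧ p + 1 ≤ n ∧ q = p + 1) ∨ (p = 1 ∧ q = n + 1) ∨
        (n + 1 ≤ p ∧ p + 1 ≤ n + m ∧ q = p + 1) then -1
    else 0

/-- Generators `h_i`, `e_i`, `f_i` of the presented Lie algebra. -/
inductive GimGen (m n : ℕ) : Type
  | h (i : Fin (m + n + 1))
  | e (i : Fin (m + n + 1))
  | f (i : Fin (m + n + 1))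

/-- The free complex Lie algebra on the generators. -/
abbrev GimFree (m n : ℕ) : Type := FreeLieAlgebra ℂ (GimGen m n)

def genH (m n : ℕ) (i : Fin (m + n + 1)) : GimFree m n := FreeLieAlgebra.of ℂ (GimGen.h i)
def genE (m n : ℕ) (i : Fin (m + n + 1)) : GimFree m n := FreeLieAlgebra.of ℂ (GimGen.e i)
def genF (m n : ℕ) (i : Fin (m + n + 1)) : GimFree m n := FreeLieAlgebra.of ℂ (GimGen.f i)

/-- The defining relations of the derived GIM Lie algebra `g'` attached to `C`. -/
def gimRels (m n : ℕ) : Set (GimFree m n) :=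
  {x | ∃ i j, x = ⁅genH m n i, genH m n j⁆} ∪
  {x | ∃ i j, x = ⁅genH m n i, genE m n j⁆ - (cMat m n i j : ℂ) • genE m n j} ∪
  {x | ∃ i j, x = ⁅genH m n i, genF m n j⁆ + (cMat m n i j : ℂ) • genF m n j} ∪
  {x | ∃ i, x = ⁅genE m n i, genF m n i⁆ - genH m n i} ∪
  {x | ∃ i j, i ≠ j ∧
    x = ((ad ℂ (GimFree m n) (genE m n i)) ^ (max 1 (1 - cMat m n i j)).toNat) (genE m n j)} ∪
  {x | ∃ i j, i ≠ j ∧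
    x = ((ad ℂ (GimFree m n) (genF m n i)) ^ (max 1 (1 - cMat m n i j)).toNat) (genF m n j)} ∪
  {x | ∃ i j,
    x = ((ad ℂ (GimFree m n) (genE m n i)) ^ (max 1 (1 + cMat m n i j)).toNat) (genF m n j)} ∪
  {x | ∃ i j,
    x = ((ad ℂ (GimFree m n) (genF m n i)) ^ (max 1 (1 + cMat m n i j)).toNat) (genE m n j)}

/-- The Lie ideal generated by the relations. -/
def gimIdeal (m n : ℕ) : LieIdeal ℂ (GimFree m n) :=
  LieSubmodule.lieSpan ℂ (GimFree m n) (gimRels m n)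

/-- The derived GIM Lie algebra `g'`, presented by generators and relations. -/
abbrev GimDerived (m n : ℕ) : Type := GimFree m n ⧸ gimIdeal m n

namespace GimAux

attribute [local instance] LieRing.ofAssociativeRing

abbrev St : Type := ℤ → Bool
abbrev Fk : Type := St → ℂ

/-- exchange of the sites `k`, `k+1`. -/
def sw (k : ℤ) (s : St) : St := fun z => s (Equiv.swap k (k + 1) z)

lemma sw_left (k : ℤ) (s : St) : sw k s k = s (k + 1) := by simp [sw]
lemma sw_right (k : ℤ) (s : St) : sw k s (k + 1) = s k := by simp [sw]
lemma sw_other (k : ℤ) (s : St) (z : ℤ) (h1 : z ≠ k) (h2 : z ≠ k + 1) : sw k s z = s z := by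
  simp [sw, Equiv.swap_apply_of_ne_of_ne h1 h2]
lemma sw_sw (k : ℤ) (s : St) : sw k (sw k s) = s := by
  funext z; simp [sw]
lemma sw_comm (k l : ℤ) (h : k + 2 ≤ l ∨ l + 2 ≤ k) (s : St) : sw k (sw l s) = sw l (sw k s) := by
  funext z
  simp only [sw, Equiv.swap_apply_def]
  congr 1
  split_ifs <;> omega

/-- twisted hopping operator -/
def X (b : Bool) (k : ℤ) (τ : St → ℂ) : Module.End ℂ Fk where
  toFun φ := fun s => if s k = b ∧ s (k + 1) = !b then τ s * φ (sw k s) else 0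
  map_add' φ ψ := by
    funext s; simp only [Pi.add_apply]; split_ifs <;> ring
  map_smul' c φ := by
    funext s; simp only [Pi.smul_apply, smul_eq_mul, RingHom.id_apply]; split_ifs <;> ring

lemma X_apply (b : Bool) (k : ℤ) (τ : St → ℂ) (φ : Fk) (s : St) :
    X b k τ φ s = if s k = b ∧ s (k + 1) = !b then τ s * φ (sw k s) else 0 := rfl

lemma X_sq (b : Bool) (k : ℤ) (τ τ' : St → ℂ) : X b k τ * X b k τ' = 0 := by
  ext φ s
  simp only [Module.End.mul_apply, X_apply, sw_left, sw_right, LinearMap.zero_apply, Pi.zero_apply]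
  cases b <;> grind

lemma X_adj (b c : Bool) (k l : ℤ) (h : l = k + 1 ∨ k = l + 1) (hbc : b ≠ c) (τ τ' : St → ℂ) :
    X b k τ * X c l τ' = 0 := by
  ext φ s
  simp only [Module.End.mul_apply, X_apply, LinearMap.zero_apply, Pi.zero_apply]
  rcases h with rfl | rfl
  · rw [sw_right]; cases b <;> cases c <;> grind
  · rw [sw_left]; cases b <;> cases c <;> grind

lemma X_adj3 (b c : Bool) (k l : ℤ) (h : l = k + 1 ∨ k = l + 1) (τ τ' τ'' : St → ℂ) :
    X b k τ * X c l τ' * X b k τ'' = 0 := by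
  ext φ s
  simp only [Module.End.mul_apply, X_apply, LinearMap.zero_apply, Pi.zero_apply]
  rcases h with rfl | rfl
  · rw [sw_other (k + 1) _ k (by omega) (by omega), sw_left]; cases b <;> grind
  · rw [sw_other l _ (l + 1 + 1) (by omega) (by omega), sw_right (l + 1)]
    by_cases h : s (l + 1) = b
    · simp [h]
    · simp [h]

lemma X_far (b c : Bool) (k l : ℤ) (h : k + 2 ≤ l ∨ l + 2 ≤ k) (τ τ' : St → ℂ)
    (h1 : ∀ s, τ (sw l s) = τ s) (h2 : ∀ s, τ' (sw k s) = τ' s) :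
    X b k τ * X c l τ' = X c l τ' * X b k τ := by
  ext φ s
  simp only [Module.End.mul_apply, X_apply, h1, h2, sw_comm k l h]
  rw [sw_other k s l (by omega) (by omega), sw_other k s (l+1) (by omega) (by omega),
    sw_other l s k (by omega) (by omega), sw_other l s (k+1) (by omega) (by omega)]
  split_ifs <;> ring

/-- occupation number -/
def nn (s : St) (k : ℤ) : ℂ := if s k = true then 1 else 0

def sg (b : Bool) : ℂ := if b = true then 1 else -1

/-- diagonal Cartan operator -/
def Hh (b : Bool) (k : ℤ) : Module.End ℂ Fk where
  toFun φ := fun s => sg b * (nn s k - nn s (k + 1)) * φ s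
  map_add' φ ψ := by
    funext s; simp only [Pi.add_apply]; ring
  map_smul' c φ := by
    funext s; simp only [Pi.smul_apply, smul_eq_mul, RingHom.id_apply]; ring

lemma Hh_apply (b : Bool) (k : ℤ) (φ : Fk) (s : St) :
    Hh b k φ s = sg b * (nn s k - nn s (k + 1)) * φ s := rfl

lemma Hh_comm (b c : Bool) (k l : ℤ) : Hh b k * Hh c l = Hh c l * Hh b k := by
  ext φ s
  simp only [Module.End.mul_apply, Hh_apply]; ring

lemma X_lie (b : Bool) (k : ℤ) (τ : St → ℂ) (h0 : ∀ s, τ s ≠ 0) (h1 : ∀ s, τ (sw k s) = τ s) :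
    ⁅X b k τ, X (!b) k (fun s => (τ s)⁻¹)⁆ = Hh b k := by
  ext φ s
  rw [LieRing.of_associative_ring_bracket]
  simp only [LinearMap.sub_apply, Pi.sub_apply, Module.End.mul_apply, X_apply, Hh_apply, sw_left,
    sw_right, sw_sw, h1, nn, sg]
  have := h0 s
  rcases hs : s k with _ | _ <;> rcases hs' : s (k+1) with _ | _ <;> cases b <;>
    simp [this]

/-- type A Cartan integers on the line -/
def aa (k l : ℤ) : ℂ := if k = l then 2 else if l = k + 1 ∨ k = l + 1 then -1 else 0

lemma Hh_X (b c : Bool) (k l : ℤ) (τ : St → ℂ) :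
    ⁅Hh b k, X c l τ⁆ = (sg b * sg c * aa k l) • X c l τ := by
  ext φ s
  rw [LieRing.of_associative_ring_bracket]
  simp only [LinearMap.sub_apply, Pi.sub_apply, Module.End.mul_apply, X_apply, Hh_apply,
    LinearMap.smul_apply, Pi.smul_apply, smul_eq_mul]
  by_cases hc : s l = c ∧ s (l + 1) = !c
  swap
  · simp [hc]
  obtain ⟨hc1, hc2⟩ := hc
  simp only [hc1, hc2, and_self, if_true]
  have key : sg b * (nn s k - nn s (k + 1)) - sg b * (nn (sw l s) k - nn (sw l s) (k + 1))
      = sg b * sg c * aa k l := by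
    unfold aa
    by_cases h1 : k = l
    · subst h1
      simp only [nn, sw_left, sw_right, hc1, hc2, sg]
      cases b <;> cases c <;> simp <;> norm_num
    rw [if_neg h1]
    by_cases h2 : l = k + 1
    · subst h2
      simp only [nn, sw_left, sw_other (k+1) s k (by omega) (by omega), hc1, hc2, sg]
      cases b <;> cases c <;> cases s k <;> simp
    by_cases h3 : k = l + 1
    · subst h3
      simp only [nn, sw_right, sw_other l s (l+1+1) (by omega) (by omega), hc1, hc2, sg]
      cases b <;> cases c <;> cases s (l + 1 + 1) <;> simp
    simp only [nn, sw_other l s k (by omega) (by omega), sw_other l s (k+1) (by omega) (by omega)]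
    simp [h2, h3]
  rw [← key]; ring

lemma adpow_zero {R : Type*} [Ring R] [Algebra ℂ R] (x y : R) (N : ℕ) (hx : x * x = 0)
    (h : 3 ≤ N ∨ (2 ≤ N ∧ x * y * x = 0) ∨ (1 ≤ N ∧ x * y = y * x)) :
    ((ad ℂ R x) ^ N) y = 0 := by
  have aux : ∀ M, M ≤ N → ((ad ℂ R x) ^ M) y = 0 → ((ad ℂ R x) ^ N) y = 0 := by
    intro M hM h0
    obtain ⟨d, rfl⟩ := Nat.exists_eq_add_of_le' hM
    rw [pow_add, Module.End.mul_apply, h0, map_zero]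
  have e2 : ⁅x, ⁅x, y⁆⁆ = - (x * y * x) - x * y * x := by
    simp only [LieRing.of_associative_ring_bracket]
    have : x * (x * y - y * x) - (x * y - y * x) * x =
      (x * x) * y - x * y * x - x * y * x + y * (x * x) := by noncomm_ring
    rw [this, hx]; simp
  rcases h with h | ⟨h, h'⟩ | ⟨h, h'⟩
  · refine aux 3 h ?_
    have : ((ad ℂ R x) ^ 3) y = ⁅x, ⁅x, ⁅x, y⁆⁆⁆ := rfl
    rw [this, e2, LieRing.of_associative_ring_bracket]
    have : x * (-(x * y * x) - x * y * x) - (-(x * y * x) - x * y * x) * x =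
      - ((x * x) * y * x) - ((x * x) * y * x) + x * y * (x * x) + x * y * (x * x) := by noncomm_ring
    rw [this, hx]; simp
  · refine aux 2 h ?_
    have : ((ad ℂ R x) ^ 2) y = ⁅x, ⁅x, y⁆⁆ := rfl
    rw [this, e2, h']; simp
  · refine aux 1 h ?_
    rw [pow_one, ad_apply, LieRing.of_associative_ring_bracket, h', sub_self]

/-- generic Serre-type relation -/
lemma X_serre (b c : Bool) (k l : ℤ) (τ τ' : St → ℂ) (N : ℕ)
    (hfar : k + 2 ≤ l ∨ l + 2 ≤ k → (∀ s, τ (sw l s) = τ s) ∧ (∀ s, τ' (sw k s) = τ' s))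
    (hN : 1 ≤ N) (h1 : k = l → b ≠ c → 3 ≤ N) (h2 : l = k + 1 ∨ k = l + 1 → b = c → 2 ≤ N) :
    ((ad ℂ (Module.End ℂ Fk) (X b k τ)) ^ N) (X c l τ') = 0 := by
  apply adpow_zero _ _ _ (X_sq _ _ _ _)
  by_cases hk : k = l
  · subst hk
    by_cases hb : b = c
    · subst hb
      right; right; exact ⟨hN, (X_sq _ _ _ _).trans (X_sq _ _ _ _).symm⟩
    · left; exact h1 rfl hb
  by_cases ha : l = k + 1 ∨ k = l + 1
  · by_cases hb : b = c
    · right; left; exact ⟨h2 ha hb, X_adj3 _ _ _ _ ha _ _ _⟩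
    · right; right
      exact ⟨hN, by rw [X_adj _ _ _ _ ha hb, X_adj _ _ _ _ ha.symm (Ne.symm hb)]⟩
  · have hf : k + 2 ≤ l ∨ l + 2 ≤ k := by omega
    right; right; exact ⟨hN, X_far _ _ _ _ hf _ _ (hfar hf).1 (hfar hf).2⟩

/-- edge of the line attached to a vertex -/
def pos (m n : ℕ) (i : Fin (m + n + 1)) : ℤ :=
  if i.val = 0 then 0 else if i.val ≤ n then (i.val : ℤ) - 1 else (n : ℤ) - i.val

def sgn (m n : ℕ) (i : Fin (m + n + 1)) : Bool := decide (i.val ≠ 0)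

open Classical in
def TT (r : ℂ) (s : St) : ℂ := if ∃ z, 2 ≤ z ∧ s z = true then r else 1

lemma TT_sw (r : ℂ) (k : ℤ) (hk : k ≠ 1) (s : St) : TT r (sw k s) = TT r s := by
  have : (∃ z, 2 ≤ z ∧ sw k s z = true) ↔ (∃ z, 2 ≤ z ∧ s z = true) := by
    constructor
    · rintro ⟨z, hz, h⟩
      refine ⟨Equiv.swap k (k+1) z, ?_, h⟩
      rw [Equiv.swap_apply_def]; split_ifs <;> omega
    · rintro ⟨z, hz, h⟩
      refine ⟨Equiv.swap k (k+1) z, ?_, ?_⟩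
      · rw [Equiv.swap_apply_def]; split_ifs <;> omega
      · simpa [sw] using h
  unfold TT
  by_cases h : ∃ z, 2 ≤ z ∧ s z = true
  · rw [if_pos h, if_pos (this.2 h)]
  · rw [if_neg h, if_neg (fun h' => h (this.1 h'))]

lemma TT_ne (r : ℂ) (hr : r ≠ 0) (s : St) : TT r s ≠ 0 := by
  unfold TT; split_ifs <;> simp [hr]

def tw (m n : ℕ) (r : ℂ) (i : Fin (m + n + 1)) : St → ℂ :=
  if i.val = 0 then TT r else fun _ => 1

lemma tw_ne (m n : ℕ) (r : ℂ) (hr : r ≠ 0) (i : Fin (m + n + 1)) (s : St) : tw m n r i s ≠ 0 := by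
  unfold tw; split_ifs
  · exact TT_ne r hr s
  · simp

lemma tw_sw (m n : ℕ) (r : ℂ) (i : Fin (m + n + 1)) (k : ℤ) (h : k ≠ pos m n i + 1) (s : St) :
    tw m n r i (sw k s) = tw m n r i s := by
  unfold tw; split_ifs with h0
  · apply TT_sw; simpa [pos, h0] using h
  · rfl

/-- operators for generators -/
def opE (m n : ℕ) (r : ℂ) (i : Fin (m + n + 1)) : Module.End ℂ Fk :=
  X (sgn m n i) (pos m n i) (tw m n r i)
def opF (m n : ℕ) (r : ℂ) (i : Fin (m + n + 1)) : Module.End ℂ Fk :=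
  X (!(sgn m n i)) (pos m n i) (fun s => (tw m n r i s)⁻¹)
def opH (m n : ℕ) (i : Fin (m + n + 1)) : Module.End ℂ Fk :=
  Hh (sgn m n i) (pos m n i)

/-- the Cartan integers, described on the line -/
lemma cMat_eq (m n : ℕ) (hm : 1 ≤ m) (hn : 2 ≤ n) (i j : Fin (m + n + 1)) :
    (i = j ∧ cMat m n i j = 2) ∨
    (i ≠ j ∧ pos m n i = pos m n j ∧ sgn m n i ≠ sgn m n j ∧ cMat m n i j = -2) ∨
    ((pos m n j = pos m n i + 1 ∨ pos m n i = pos m n j + 1) ∧ sgn m n i = sgn m n j ∧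
      cMat m n i j = -1) ∨
    ((pos m n j = pos m n i + 1 ∨ pos m n i = pos m n j + 1) ∧ sgn m n i ≠ sgn m n j ∧
      cMat m n i j = 1) ∨
    ((pos m n i + 2 ≤ pos m n j ∨ pos m n j + 2 ≤ pos m n i) ∧ cMat m n i j = 0) := by
  obtain ⟨i, hi⟩ := i
  obtain ⟨j, hj⟩ := j
  simp only [cMat, pos, sgn, Fin.mk.injEq]
  by_cases hij : i = j
  · simp [hij]
  rcases Nat.eq_zero_or_pos i with h0 | h0 <;> rcases Nat.eq_zero_or_pos j with h1 | h1
  · omega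
  · subst h0
    have : j ≠ 0 := by omega
    simp [hij]
    split_ifs <;> omega
  · subst h1
    have : i ≠ 0 := by omega
    simp [hij, this]
    split_ifs <;> omega
  · have a1 : j ≠ 0 := by omega
    have a2 : i ≠ 0 := by omega
    simp [hij, a1, a2]
    split_ifs <;> omega

lemma cMat_sg (m n : ℕ) (hm : 1 ≤ m) (hn : 2 ≤ n) (i j : Fin (m + n + 1)) :
    sg (sgn m n i) * sg (sgn m n j) * aa (pos m n i) (pos m n j) = (cMat m n i j : ℂ) := by
  rcases cMat_eq m n hm hn i j with ⟨rfl, h⟩ | ⟨h1, h2, h3, h⟩ | ⟨h1, h2, h⟩ | ⟨h1, h2, h⟩ | ⟨h1, h⟩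
  · rw [h]; unfold sg aa; cases sgn m n i <;> simp
  · rw [h, h2]; unfold sg aa; revert h3; cases sgn m n i <;> cases sgn m n j <;> simp
  · have : pos m n i ≠ pos m n j := by omega
    rw [h, h2]; unfold sg aa; rw [if_neg this, if_pos h1]; cases sgn m n j <;> simp
  · have : pos m n i ≠ pos m n j := by omega
    rw [h]; unfold sg aa; rw [if_neg this, if_pos h1]; revert h2
    cases sgn m n i <;> cases sgn m n j <;> simp
  · rw [h]; unfold aa; rw [if_neg (by omega), if_neg (by omega)]; simp

/-- the representation of the free Lie algebra -/
def rep (m n : ℕ) (r : ℂ) : GimFree m n →ₗ⁅ℂ⁆ Module.End ℂ Fk :=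
  FreeLieAlgebra.lift ℂ (fun g : GimGen m n => match g with
    | GimGen.h i => opH m n i
    | GimGen.e i => opE m n r i
    | GimGen.f i => opF m n r i)

lemma rep_H (m n : ℕ) (r : ℂ) (i) : rep m n r (genH m n i) = opH m n i := by
  simp [rep, genH]
lemma rep_E (m n : ℕ) (r : ℂ) (i) : rep m n r (genE m n i) = opE m n r i := by
  simp [rep, genE]
lemma rep_F (m n : ℕ) (r : ℂ) (i) : rep m n r (genF m n i) = opF m n r i := by
  simp [rep, genF]

lemma rep_adpow (m n : ℕ) (r : ℂ) (x y : GimFree m n) (N : ℕ) :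
    rep m n r (((ad ℂ (GimFree m n) x) ^ N) y) =
      ((ad ℂ (Module.End ℂ Fk) (rep m n r x)) ^ N) (rep m n r y) := by
  induction N with
  | zero => simp
  | succ N ih =>
    rw [pow_succ', pow_succ', Module.End.mul_apply, Module.End.mul_apply, ad_apply, LieHom.map_lie,
      ih, ad_apply]

lemma rep_rels (m n : ℕ) (hm : 1 ≤ m) (hn : 2 ≤ n) (r : ℂ) (hr : r ≠ 0) (x : GimFree m n)
    (hx : x ∈ gimRels m n) : rep m n r x = 0 := by
  rcases hx with ((((((⟨i, j, rfl⟩ | ⟨i, j, rfl⟩) | ⟨i, j, rfl⟩) | ⟨i, rfl⟩) | ⟨i, j, hij, rfl⟩) |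
    ⟨i, j, hij, rfl⟩) | ⟨i, j, rfl⟩) | ⟨i, j, rfl⟩
  · rw [LieHom.map_lie, rep_H, rep_H, LieRing.of_associative_ring_bracket]
    simp only [opH]; rw [Hh_comm, sub_self]
  · rw [map_sub, LieHom.map_lie, map_smul, rep_H, rep_E]
    simp only [opH, opE]; rw [Hh_X, cMat_sg m n hm hn, sub_self]
  · rw [map_add, LieHom.map_lie, map_smul, rep_H, rep_F]
    simp only [opH, opF]; rw [Hh_X, ← cMat_sg m n hm hn]
    have : sg (!(sgn m n j)) = - sg (sgn m n j) := by cases sgn m n j <;> simp [sg]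
    rw [this, ← add_smul]; convert zero_smul ℂ _ using 2; ring
  · rw [map_sub, LieHom.map_lie, rep_H, rep_E, rep_F]
    simp only [opH, opE, opF]
    rw [X_lie _ _ _ (tw_ne m n r hr i) (fun s => tw_sw m n r i _ (by omega) s), sub_self]
  all_goals
    rw [rep_adpow]; simp only [rep_E, rep_F, opE, opF]
    apply X_serre
    · intro hf
      constructor <;> intro s <;> first
        | exact tw_sw m n r _ _ (by omega) s
        | exact congrArg _ (tw_sw m n r _ _ (by omega) s)
    · omega
    · have := cMat_eq m n hm hn i j
      intro h1 h2
      revert h2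
      cases hi : sgn m n i <;> cases hj : sgn m n j <;> simp [hi, hj] at this ⊢ <;> grind
    · have := cMat_eq m n hm hn i j
      intro h1 h2
      revert h2
      cases hi : sgn m n i <;> cases hj : sgn m n j <;> simp [hi, hj] at this ⊢ <;> grind

lemma rep_ideal (m n : ℕ) (hm : 1 ≤ m) (hn : 2 ≤ n) (r : ℂ) (hr : r ≠ 0) (x : GimFree m n)
    (hx : x ∈ gimIdeal m n) : rep m n r x = 0 := by
  have : gimIdeal m n ≤ (rep m n r).ker := by
    unfold gimIdeal
    rw [LieSubmodule.lieSpan_le]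
    intro y hy
    simp only [SetLike.mem_coe, LieHom.mem_ker]
    exact rep_rels m n hm hn r hr y hy
  exact LieHom.mem_ker.1 (this hx)


/-- two-particle state -/
def st (a b : ℤ) : St := fun z => decide (z = a ∨ z = b)

lemma sw_st (k a b a' b' : ℤ) (ha : Equiv.swap k (k + 1) a = a') (hb : Equiv.swap k (k + 1) b = b') :
    sw k (st a b) = st a' b' := by
  subst ha hb
  funext z
  simp only [sw, st, Equiv.swap_apply_eq_iff]

lemma TT_st (r : ℂ) (a b : ℤ) : TT r (st a b) = if 2 ≤ a ∨ 2 ≤ b then r else 1 := by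
  have : (∃ z, 2 ≤ z ∧ st a b z = true) ↔ (2 ≤ a ∨ 2 ≤ b) := by
    simp only [st, decide_eq_true_eq]
    constructor
    · rintro ⟨z, hz, rfl | rfl⟩ <;> tauto
    · rintro (h | h)
      · exact ⟨a, h, Or.inl rfl⟩
      · exact ⟨b, h, Or.inr rfl⟩
  unfold TT
  by_cases h : 2 ≤ a ∨ 2 ≤ b
  · rw [if_pos h, if_pos (this.2 h)]
  · rw [if_neg h, if_neg (fun h' => h (this.1 h'))]

lemma X_st (b : Bool) (k : ℤ) (τ : St → ℂ) (φ : Fk) (x y x' y' : ℤ)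
    (hx : Equiv.swap k (k + 1) x = x') (hy : Equiv.swap k (k + 1) y = y')
    (h1 : st x y k = b) (h2 : st x y (k + 1) = !b) :
    X b k τ φ (st x y) = τ (st x y) * φ (st x' y') := by
  rw [X_apply, if_pos ⟨h1, h2⟩, sw_st k x y x' y' hx hy]

lemma X_st0 (b : Bool) (k : ℤ) (τ : St → ℂ) (φ : Fk) (x y : ℤ)
    (h : ¬ (st x y k = b ∧ st x y (k + 1) = !b)) :
    X b k τ φ (st x y) = 0 := by
  rw [X_apply, if_neg h]

/-- the six relevant states -/
def S6 : Fin 6 → St := ![st (-1) 0, st (-1) 1, st (-1) 2, st 0 1, st 0 2, st 1 2]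

/-- monomial action of an operator on the six relevant states -/
def Row (O : Module.End ℂ Fk) (c : Fin 6 → ℂ) (p : Fin 6 → Fin 6) : Prop :=
  ∀ (φ : Fk) (i : Fin 6), O φ (S6 i) = c i * φ (S6 (p i))

lemma Row.lie {O O' : Module.End ℂ Fk} {c c' : Fin 6 → ℂ} {p p' : Fin 6 → Fin 6}
    (h : Row O c p) (h' : Row O' c' p') (φ : Fk) (i : Fin 6) :
    ⁅O, O'⁆ φ (S6 i) = c i * (c' (p i) * φ (S6 (p' (p i)))) -
      c' i * (c (p' i) * φ (S6 (p (p' i)))) := by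
  rw [LieRing.of_associative_ring_bracket]
  simp only [LinearMap.sub_apply, Pi.sub_apply, Module.End.mul_apply]
  rw [h, h', h', h]

lemma row_R (b : Bool) (k : ℤ) (τ : St → ℂ) (c : Fin 6 → ℂ) (p : Fin 6 → Fin 6)
    (h : ∀ i, (¬ (S6 i k = b ∧ S6 i (k + 1) = !b) ∧ c i = 0) ∨
      ((S6 i k = b ∧ S6 i (k + 1) = !b) ∧ c i = τ (S6 i) ∧ sw k (S6 i) = S6 (p i))) :
    Row (X b k τ) c p := by
  intro φ i
  rw [X_apply]
  rcases h i with ⟨h1, h2⟩ | ⟨h1, h2, h3⟩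
  · rw [if_neg h1, h2, zero_mul]
  · rw [if_pos h1, h2, h3]

section rows
variable (r : ℂ)

local notation "one" => (fun _ : St => (1 : ℂ))

lemma row_e1 : Row (X true 0 one) ![1, 0, 0, 0, 1, 0] ![1, 0, 0, 0, 5, 0] := by
  apply row_R
  intro i; fin_cases i <;> simp [S6, st] <;> apply sw_st <;> decide
lemma row_f1 : Row (X false 0 one) ![0, 1, 0, 0, 0, 1] ![0, 0, 0, 0, 0, 4] := by
  apply row_R
  intro i; fin_cases i <;> simp [S6, st] <;> apply sw_st <;> decide
lemma row_e2 : Row (X true 1 one) ![0, 1, 0, 1, 0, 0] ![0, 2, 0, 4, 0, 0] := by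
  apply row_R
  intro i; fin_cases i <;> simp [S6, st] <;> apply sw_st <;> decide
lemma row_f2 : Row (X false 1 one) ![0, 0, 1, 0, 1, 0] ![0, 0, 1, 0, 3, 0] := by
  apply row_R
  intro i; fin_cases i <;> simp [S6, st] <;> apply sw_st <;> decide
lemma row_eL : Row (X true (-1) one) ![0, 1, 1, 0, 0, 0] ![0, 3, 4, 0, 0, 0] := by
  apply row_R
  intro i; fin_cases i <;> simp [S6, st] <;> apply sw_st <;> decide
lemma row_fL : Row (X false (-1) one) ![0, 0, 0, 1, 1, 0] ![0, 0, 0, 1, 2, 0] := by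
  apply row_R
  intro i; fin_cases i <;> simp [S6, st] <;> apply sw_st <;> decide
lemma row_e0 : Row (X false 0 (TT r)) ![0, 1, 0, 0, 0, r] ![0, 0, 0, 0, 0, 4] := by
  apply row_R
  intro i; fin_cases i <;> simp [S6, st] <;> refine ⟨by erw [TT_st]; simp, ?_⟩ <;> apply sw_st <;> decide
lemma row_f0 : Row (X true 0 (fun s => (TT r s)⁻¹)) ![1, 0, 0, 0, r⁻¹, 0] ![1, 0, 0, 0, 5, 0] := by
  apply row_R
  intro i; fin_cases i <;> simp [S6, st] <;> refine ⟨by erw [TT_st]; simp, ?_⟩ <;> apply sw_st <;> decide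

variable (e0 e1 e2 eL f0 f1 f2 fL : Module.End ℂ Fk)

lemma row_Y (hr : r ≠ 0)
    (h0 : Row e0 ![0, 1, 0, 0, 0, r] ![0, 0, 0, 0, 0, 4])
    (h0' : Row f0 ![1, 0, 0, 0, r⁻¹, 0] ![1, 0, 0, 0, 5, 0])
    (h1 : Row e1 ![1, 0, 0, 0, 1, 0] ![1, 0, 0, 0, 5, 0])
    (h1' : Row f1 ![0, 1, 0, 0, 0, 1] ![0, 0, 0, 0, 0, 4])
    (h2 : Row e2 ![0, 1, 0, 1, 0, 0] ![0, 2, 0, 4, 0, 0])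
    (hL : Row eL ![0, 1, 1, 0, 0, 0] ![0, 3, 4, 0, 0, 0]) :
    Row ⁅⁅⁅e0, e1⁆, eL⁆, ⁅e1, ⁅⁅f0, f1⁆, e2⁆⁆⁆ ![r, r⁻¹, 0, 0, 0, 0] ![4, 5, 0, 0, 0, 0] := by
  have D1 : Row ⁅e0, e1⁆ ![-1, 1, 0, 0, -r, r] ![0, 1, 2, 3, 4, 5] := by
    intro φ i; rw [h0.lie h1]; fin_cases i <;> simp
  have D2 : Row ⁅f0, f1⁆ ![1, -1, 0, 0, r⁻¹, -r⁻¹] ![0, 1, 2, 3, 4, 5] := by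
    intro φ i; rw [h0'.lie h1']; fin_cases i <;> simp
  have P : Row ⁅⁅e0, e1⁆, eL⁆ ![0, 1, r, 0, 0, 0] ![0, 3, 4, 0, 0, 0] := by
    intro φ i; rw [D1.lie hL]; fin_cases i <;> simp
  have Q : Row ⁅⁅f0, f1⁆, e2⁆ ![0, -1, 0, -r⁻¹, 0, 0] ![0, 2, 0, 4, 0, 0] := by
    intro φ i; rw [D2.lie h2]; fin_cases i <;> simp
  have R : Row ⁅e1, ⁅⁅f0, f1⁆, e2⁆⁆ ![-1, 0, 0, r⁻¹, 0, 0] ![2, 0, 0, 5, 0, 0] := by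
    intro φ i; rw [h1.lie Q]; fin_cases i <;> simp
  intro φ i; rw [P.lie R]; fin_cases i <;> simp

lemma row_F
    (h1' : Row f1 ![0, 1, 0, 0, 0, 1] ![0, 0, 0, 0, 0, 4])
    (h2' : Row f2 ![0, 0, 1, 0, 1, 0] ![0, 0, 1, 0, 3, 0])
    (hL' : Row fL ![0, 0, 0, 1, 1, 0] ![0, 0, 0, 1, 2, 0]) :
    Row ⁅f2, ⁅f1, fL⁆⁆ ![0, 0, 0, 0, -1, -1] ![0, 0, 0, 0, 0, 1] := by
  have G : Row ⁅f1, fL⁆ ![0, 0, 0, -1, 0, 1] ![0, 0, 0, 0, 0, 2] := by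
    intro φ i; rw [h1'.lie hL']; fin_cases i <;> simp
  intro φ i; rw [h2'.lie G]; fin_cases i <;> simp

lemma row_W (Y F : Module.End ℂ Fk)
    (hY : Row Y ![r, r⁻¹, 0, 0, 0, 0] ![4, 5, 0, 0, 0, 0])
    (hF : Row F ![0, 0, 0, 0, -1, -1] ![0, 0, 0, 0, 0, 1]) (s : ℕ) (φ : Fk) :
    ⁅((ad ℂ (Module.End ℂ Fk) ⁅Y, F⁆) ^ s) Y, F⁆ φ (S6 0) = (1 / 2) * (-2 * r) ^ (s + 1) * φ (S6 0) := by
  have hX : Row ⁅Y, F⁆ ![-r, -r⁻¹, 0, 0, r, r⁻¹] ![0, 1, 2, 3, 4, 5] := by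
    intro φ i; rw [hY.lie hF]; fin_cases i <;> simp
  have hs : Row (((ad ℂ (Module.End ℂ Fk) ⁅Y, F⁆) ^ s) Y)
      ![(-2 * r) ^ s * r, (-2 * r⁻¹) ^ s * r⁻¹, 0, 0, 0, 0] ![4, 5, 0, 0, 0, 0] := by
    induction s with
    | zero => simpa using hY
    | succ s ih =>
      rw [pow_succ', Module.End.mul_apply, ad_apply]
      intro φ i; rw [hX.lie ih]; fin_cases i <;> simp <;> ring
  rw [hs.lie hF]; simp; ring

end rows

section main
variable (m n : ℕ)

def v0 : Fin (m + n + 1) := ⟨0, by omega⟩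
def v1 (hm : 1 ≤ m) : Fin (m + n + 1) := ⟨1, by omega⟩
def v2 (hm : 1 ≤ m) (hn : 2 ≤ n) : Fin (m + n + 1) := ⟨2, by omega⟩
def vL (hm : 1 ≤ m) : Fin (m + n + 1) := ⟨n + 1, by omega⟩

def elY (hm : 1 ≤ m) (hn : 2 ≤ n) : GimFree m n :=
  ⁅⁅⁅genE m n (v0 m n), genE m n (v1 m n hm)⁆, genE m n (vL m n hm)⁆,
    ⁅genE m n (v1 m n hm), ⁅⁅genF m n (v0 m n), genF m n (v1 m n hm)⁆, genE m n (v2 m n hm hn)⁆⁆⁆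

def elF (hm : 1 ≤ m) (hn : 2 ≤ n) : GimFree m n :=
  ⁅genF m n (v2 m n hm hn), ⁅genF m n (v1 m n hm), genF m n (vL m n hm)⁆⁆

def elW (hm : 1 ≤ m) (hn : 2 ≤ n) (s : ℕ) : GimFree m n :=
  ⁅((ad ℂ (GimFree m n) ⁅elY m n hm hn, elF m n hm hn⁆) ^ s) (elY m n hm hn), elF m n hm hn⁆

lemma rep_W (hm : 1 ≤ m) (hn : 2 ≤ n) (r : ℂ) (hr : r ≠ 0) (s : ℕ) :
    rep m n r (elW m n hm hn s) (fun _ => 1) (S6 0) = (1 / 2) * (-2 * r) ^ (s + 1) := by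
  have hY : Row (rep m n r (elY m n hm hn)) ![r, r⁻¹, 0, 0, 0, 0] ![4, 5, 0, 0, 0, 0] := by
    unfold elY
    simp only [LieHom.map_lie, rep_E, rep_F]
    apply row_Y r _ _ _ _ _ _ hr
    · simpa [opE, sgn, pos, tw, v0] using row_e0 r
    · simpa [opF, sgn, pos, tw, v0] using row_f0 r
    · have : 1 ≤ n := by omega
      simpa [opE, sgn, pos, tw, v1, this] using row_e1
    · have : 1 ≤ n := by omega
      simpa [opF, sgn, pos, tw, v1, this] using row_f1
    · simpa [opE, sgn, pos, tw, v2, hn] using row_e2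
    · simpa [opE, sgn, pos, tw, vL] using row_eL
  have hF : Row (rep m n r (elF m n hm hn)) ![0, 0, 0, 0, -1, -1] ![0, 0, 0, 0, 0, 1] := by
    unfold elF
    simp only [LieHom.map_lie, rep_E, rep_F]
    apply row_F
    · have : 1 ≤ n := by omega
      simpa [opF, sgn, pos, tw, v1, this] using row_f1
    · simpa [opF, sgn, pos, tw, v2, hn] using row_f2
    · simpa [opF, sgn, pos, tw, vL] using row_fL
  unfold elW
  rw [LieHom.map_lie, rep_adpow, LieHom.map_lie, row_W r _ _ hY hF, mul_one]

/-- the functional on the quotient, as a function of the parameter -/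
def fnl (hm : 1 ≤ m) (hn : 2 ≤ n) : GimDerived m n →ₗ[ℂ] (ℂˣ → ℂ) :=
  (gimIdeal m n).toSubmodule.liftQ
    (LinearMap.pi fun u : ℂˣ =>
      { toFun := fun x => 2 * rep m n (-(u : ℂ) / 2) x (fun _ => 1) (S6 0)
        map_add' := fun x y => by rw [map_add, LinearMap.add_apply, Pi.add_apply, mul_add]
        map_smul' := fun c x => by
          rw [map_smul, LinearMap.smul_apply, Pi.smul_apply, smul_eq_mul, RingHom.id_apply,
            smul_eq_mul]; ring })
    (by
      intro x hx
      rw [LinearMap.mem_ker]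
      funext u
      have := rep_ideal m n hm hn (-(u : ℂ) / 2) (by simp) x hx
      simp [this])

lemma fnl_W (hm : 1 ≤ m) (hn : 2 ≤ n) (s : ℕ) :
    fnl m n hm hn (LieSubmodule.Quotient.mk (N := gimIdeal m n) (elW m n hm hn s)) =
      fun u : ℂˣ => (u : ℂ) ^ (s + 1) := by
  funext u
  have h := rep_W m n hm hn (-(u : ℂ) / 2) (by simp) s
  change 2 * rep m n (-(u : ℂ) / 2) (elW m n hm hn s) (fun _ => 1) (S6 0) = _
  rw [h]
  have : (-2 * (-(u : ℂ) / 2)) = u := by ring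
  rw [this]; ring

lemma indep_pow : LinearIndependent ℂ (fun s : ℕ => fun u : ℂˣ => (u : ℂ) ^ (s + 1)) := by
  let g : ℕ → (ℂˣ →* ℂ) := fun s => (Units.coeHom ℂ).comp (powMonoidHom (s + 1))
  have hg : Function.Injective g := by
    intro s t hst
    have h2 : (2 : ℂ) ≠ 0 := two_ne_zero
    have := DFunLike.congr_fun hst (Units.mk0 2 h2)
    simp only [g, MonoidHom.comp_apply, powMonoidHom_apply, Units.coeHom_apply, Units.val_pow_eq_pow_val,
      Units.val_mk0] at this
    have h3 : (2 : ℕ) ^ (s + 1) = 2 ^ (t + 1) := by exact_mod_cast this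
    have := Nat.pow_right_injective (le_refl 2) h3
    omega
  have := (linearIndependent_monoidHom ℂˣ ℂ).comp g hg
  have e : (fun s : ℕ => fun u : ℂˣ => (u : ℂ) ^ (s + 1)) = (fun f : ℂˣ →* ℂ => (f : ℂˣ → ℂ)) ∘ g := by
    funext s u
    simp [g]
  rw [e]
  exact this

lemma indep_W (hm : 1 ≤ m) (hn : 2 ≤ n) : LinearIndependent ℂ (fun s : ℕ =>
    (LieSubmodule.Quotient.mk (N := gimIdeal m n) (elW m n hm hn s) : GimDerived m n)) := by
  apply LinearIndependent.of_comp (fnl m n hm hn)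
  convert indep_pow using 1
  funext s
  exact fnl_W m n hm hn s

end main

end GimAux

/-- Theorem: for any `ℤ^l`-grading of `g'` (with `l = m+n+1`) for which the generators are
homogeneous of degrees `0`, `ε_i`, `-ε_i` respectively, the degree-zero component has
complex dimension at least `m + n + 2`. -/
theorem gim_degree_zero_component_large (m n : ℕ) (hm : 1 ≤ m) (hn : 2 ≤ n)
    (𝒜 : (Fin (m + n + 1) → ℤ) → Submodule ℂ (GimDerived m n))
    (hInternal : DirectSum.IsInternal 𝒜)
    (hBracket : ∀ (γ δ : Fin (m + n + 1) → ℤ) (x y : GimDerived m n),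
      x ∈ 𝒜 γ → y ∈ 𝒜 δ → ⁅x, y⁆ ∈ 𝒜 (γ + δ))
    (hH : ∀ i, LieSubmodule.Quotient.mk (N := gimIdeal m n) (genH m n i) ∈ 𝒜 0)
    (hE : ∀ i, LieSubmodule.Quotient.mk (N := gimIdeal m n) (genE m n i) ∈
      𝒜 (Pi.single i 1))
    (hF : ∀ i, LieSubmodule.Quotient.mk (N := gimIdeal m n) (genF m n i) ∈
      𝒜 (-Pi.single i 1)) :
    (m + n + 2 : Cardinal) ≤ Module.rank ℂ (𝒜 0) := by
  have hl : ∀ {γ δ : Fin (m + n + 1) → ℤ} {x y : GimFree m n},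
      LieSubmodule.Quotient.mk (N := gimIdeal m n) x ∈ 𝒜 γ →
      LieSubmodule.Quotient.mk (N := gimIdeal m n) y ∈ 𝒜 δ →
      LieSubmodule.Quotient.mk (N := gimIdeal m n) ⁅x, y⁆ ∈ 𝒜 (γ + δ) := by
    intro γ δ x y hx hy
    rw [LieSubmodule.Quotient.mk_bracket]
    exact hBracket _ _ _ _ hx hy
  obtain ⟨γ, hγ⟩ : ∃ γ, γ = (Pi.single (GimAux.v1 m n hm) 1 + Pi.single (GimAux.v2 m n hm hn) 1 +
    Pi.single (GimAux.vL m n hm) 1 : Fin (m + n + 1) → ℤ) := ⟨_, rfl⟩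
  have hY : LieSubmodule.Quotient.mk (N := gimIdeal m n) (GimAux.elY m n hm hn) ∈ 𝒜 γ := by
    have := hl (hl (hl (hE (GimAux.v0 m n)) (hE (GimAux.v1 m n hm))) (hE (GimAux.vL m n hm)))
      (hl (hE (GimAux.v1 m n hm)) (hl (hl (hF (GimAux.v0 m n)) (hF (GimAux.v1 m n hm)))
        (hE (GimAux.v2 m n hm hn))))
    convert this using 2
    · rw [hγ]; abel
    · rfl
  have hFF : LieSubmodule.Quotient.mk (N := gimIdeal m n) (GimAux.elF m n hm hn) ∈ 𝒜 (-γ) := by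
    have := hl (hF (GimAux.v2 m n hm hn)) (hl (hF (GimAux.v1 m n hm)) (hF (GimAux.vL m n hm)))
    convert this using 2
    · rw [hγ]; abel
    · rfl
  have hX : LieSubmodule.Quotient.mk (N := gimIdeal m n)
      ⁅GimAux.elY m n hm hn, GimAux.elF m n hm hn⁆ ∈ 𝒜 0 := by
    have := hl hY hFF
    rwa [add_neg_cancel] at this
  have hYs : ∀ s : ℕ, LieSubmodule.Quotient.mk (N := gimIdeal m n)
      (((ad ℂ (GimFree m n) ⁅GimAux.elY m n hm hn, GimAux.elF m n hm hn⁆) ^ s)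
        (GimAux.elY m n hm hn)) ∈ 𝒜 γ := by
    intro s
    induction s with
    | zero => simpa using hY
    | succ s ih =>
      rw [pow_succ', Module.End.mul_apply, ad_apply]
      have := hl hX ih
      rwa [zero_add] at this
  have hW : ∀ s : ℕ, LieSubmodule.Quotient.mk (N := gimIdeal m n) (GimAux.elW m n hm hn s) ∈ 𝒜 0 := by
    intro s
    have := hl (hYs s) hFF
    rwa [add_neg_cancel] at this
  have hind : LinearIndependent ℂ (fun s : ℕ => (⟨_, hW s⟩ : 𝒜 0)) := by
    apply LinearIndependent.of_comp (𝒜 0).subtype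
    exact GimAux.indep_W m n hm hn
  refine le_trans ?_ hind.aleph0_le_rank
  exact_mod_cast (Cardinal.natCast_lt_aleph0 (n := m + n + 2)).le
end
end

section
/- Let k be a finite field and R a Hom-finite k-linear triangulated category with shift Σ (so all Hom-sets of R are finite). Fix objects X, Y, L of R. Let W(X,Y;L) be the set of triples (f,g,h) ∈ Hom_R(X,L) × Hom_R(L,Y) × Hom_R(Y,ΣX) such that X →f L →g Y →h ΣX is a distinguished triangle. The group Aut(X) × Aut(Y) acts on W(X,Y;L) by (a,c)·(f,g,h) = (f∘a^{-1}, c∘g, Σ(a)∘h∘c^{-1}). Then the number of orbits of Aut(X) × Aut(Y) on W(X,Y;L) equals the number of orbits of Aut(X) acting by precomposition (f ↦ f∘a^{-1}) on Hom_R(X,L)_Y, and also equals the number of orbits of Aut(Y) acting by postcomposition (g ↦ c∘g) on Hom_R(L,Y)_{ΣX}. -/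
/- Statement 5 (Xiao–Xu): In a Hom-finite k-linear triangulated category over a finite
field, for fixed objects `X, Y, L`, the number of orbits of `Aut X × Aut Y` on the set of
distinguished triangles `X → L → Y → ΣX` equals the number of `Aut X`-orbits on the set of
morphisms `X → L` with cone `Y`, and also equals the number of `Aut Y`-orbits on the set of
morphisms `L → Y` with cone `ΣX`. -/

noncomputable section

open CategoryTheory Limits Pretriangulated

variable {R : Type} [Category R] [Preadditive R] [HasZeroObject R] [HasShift R ℤ]
  [∀ n : ℤ, (shiftFunctor R n).Additive] [Pretriangulated R]

/-- The set `W(X,Y;L)` of triples `(f,g,h)` forming a distinguished triangle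
`X → L → Y → ΣX`. -/
def TriangleSet (X Y L : R) : Type _ :=
  {t : (X ⟶ L) × (L ⟶ Y) × (Y ⟶ (shiftFunctor R (1 : ℤ)).obj X) //
    Triangle.mk t.1 t.2.1 t.2.2 ∈ (distTriang R)}

/-- The orbit relation of the `Aut X × Aut Y`-action
`(a,c)·(f,g,h) = (f∘a⁻¹, c∘g, Σ(a)∘h∘c⁻¹)` on `W(X,Y;L)`. -/
def TriangleRel (X Y L : R) (t s : TriangleSet X Y L) : Prop :=
  ∃ (a : Aut X) (c : Aut Y),
    s.1.1 = a.inv ≫ t.1.1 ∧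
    s.1.2.1 = t.1.2.1 ≫ c.hom ∧
    s.1.2.2 = c.inv ≫ t.1.2.2 ≫ (shiftFunctor R (1 : ℤ)).map a.hom

/-- The set `Hom(X,L)_Y` of morphisms `X ⟶ L` whose cone is (isomorphic to) `Y`. -/
def HomWithCone (X Y L : R) : Type _ :=
  {f : X ⟶ L // ∃ (g : L ⟶ Y) (h : Y ⟶ (shiftFunctor R (1 : ℤ)).obj X),
    Triangle.mk f g h ∈ (distTriang R)}

/-- The orbit relation of the `Aut X`-action `f ↦ f∘a⁻¹` on `Hom(X,L)_Y`. -/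
def HomWithConeRel (X Y L : R) (t s : HomWithCone X Y L) : Prop :=
  ∃ a : Aut X, s.1 = a.inv ≫ t.1

/-- The set `Hom(L,Y)_{ΣX}` of morphisms `L ⟶ Y` whose cone is (isomorphic to) `ΣX`. -/
def HomWithCocone (X Y L : R) : Type _ :=
  {g : L ⟶ Y // ∃ (u : Y ⟶ (shiftFunctor R (1 : ℤ)).obj X)
      (v : (shiftFunctor R (1 : ℤ)).obj X ⟶ (shiftFunctor R (1 : ℤ)).obj L),
    Triangle.mk g u v ∈ (distTriang R)}

/-- The orbit relation of the `Aut Y`-action `g ↦ c∘g` on `Hom(L,Y)_{ΣX}`. -/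
def HomWithCoconeRel (X Y L : R) (t s : HomWithCocone X Y L) : Prop :=
  ∃ c : Aut Y, s.1 = t.1 ≫ c.hom

theorem aux_rel_one (X Y L : R) (t s : TriangleSet X Y L) (a : X ≅ X)
    (ha : s.1.1 = a.inv ≫ t.1.1) : TriangleRel X Y L t s := by
  obtain ⟨⟨f, g, h⟩, ht⟩ := t
  obtain ⟨⟨f', g', h'⟩, hs⟩ := s
  replace ht : Triangle.mk f g h ∈ distTriang R := ht
  replace hs : Triangle.mk f' g' h' ∈ distTriang R := hs
  replace ha : f' = a.inv ≫ f := ha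
  have comm : f ≫ 𝟙 L = a.hom ≫ f' := by rw [ha, Iso.hom_inv_id_assoc, Category.comp_id]
  have key : ∃ c : Y ⟶ Y, g ≫ c = 𝟙 L ≫ g' ∧
      h ≫ (shiftFunctor R (1 : ℤ)).map a.hom = c ≫ h' :=
    complete_distinguished_triangle_morphism _ _ ht hs a.hom (𝟙 L) comm
  obtain ⟨c, h1, h2⟩ := key
  let φ : Triangle.mk f g h ⟶ Triangle.mk f' g' h' :=
    { hom₁ := a.hom, hom₂ := 𝟙 L, hom₃ := c
      comm₁ := comm
      comm₂ := h1
      comm₃ := h2 }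
  have hc : IsIso c := isIso₃_of_isIso₁₂ φ ht hs
    (inferInstanceAs (IsIso a.hom)) (inferInstanceAs (IsIso (𝟙 L)))
  have h3 : g' = g ≫ c := by rw [h1, Category.id_comp]
  have h4 : h' = inv c ≫ h ≫ (shiftFunctor R (1 : ℤ)).map a.hom := by
    rw [h2, IsIso.inv_hom_id_assoc]
  exact ⟨a, asIso c, ha, h3, h4⟩

theorem aux_rel_two (X Y L : R) (t s : TriangleSet X Y L) (c : Y ≅ Y)
    (hc : s.1.2.1 = t.1.2.1 ≫ c.hom) : TriangleRel X Y L t s := by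
  obtain ⟨⟨f, g, h⟩, ht⟩ := t
  obtain ⟨⟨f', g', h'⟩, hs⟩ := s
  replace ht : Triangle.mk f g h ∈ distTriang R := ht
  replace hs : Triangle.mk f' g' h' ∈ distTriang R := hs
  replace hc : g' = g ≫ c.hom := hc
  have comm : g ≫ c.hom = 𝟙 L ≫ g' := by rw [hc, Category.id_comp]
  have key : ∃ a : X ⟶ X, f ≫ 𝟙 L = a ≫ f' ∧
      h ≫ (shiftFunctor R (1 : ℤ)).map a = c.hom ≫ h' :=
    complete_distinguished_triangle_morphism₁ _ _ ht hs (𝟙 L) c.hom comm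
  obtain ⟨a, h1, h2⟩ := key
  let φ : Triangle.mk f g h ⟶ Triangle.mk f' g' h' :=
    { hom₁ := a, hom₂ := 𝟙 L, hom₃ := c.hom
      comm₁ := h1
      comm₂ := comm
      comm₃ := h2 }
  have ha : IsIso a := isIso₁_of_isIso₂₃ φ ht hs
    (inferInstanceAs (IsIso (𝟙 L))) (inferInstanceAs (IsIso c.hom))
  have h3 : f' = inv a ≫ f := by
    rw [IsIso.eq_inv_comp, ← h1, Category.comp_id]
  have h4 : h' = c.inv ≫ h ≫ (shiftFunctor R (1 : ℤ)).map a := by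
    rw [h2, Iso.inv_hom_id_assoc]
  exact ⟨asIso a, c, h3, hc, h4⟩

theorem aux_cocone (X Y L : R) (g : HomWithCocone X Y L) :
    ∃ t : TriangleSet X Y L, t.1.2.1 = g.1 := by
  obtain ⟨g, u, v, hg⟩ := g
  refine ⟨⟨⟨-(shiftFunctor R (1 : ℤ)).preimage v, g, u⟩, ?_⟩, rfl⟩
  rw [rotate_distinguished_triangle]
  have e : -(shiftFunctor R (1 : ℤ)).map (-(shiftFunctor R (1 : ℤ)).preimage v) = v := by
    rw [Functor.map_neg, neg_neg, Functor.map_preimage]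
  change Triangle.mk g u
    (-(shiftFunctor R (1 : ℤ)).map (-(shiftFunctor R (1 : ℤ)).preimage v)) ∈ distTriang R
  rw [e]
  exact hg

theorem aux_cone (X Y L : R) (f : HomWithCone X Y L) :
    ∃ t : TriangleSet X Y L, t.1.1 = f.1 := by
  obtain ⟨f, g, h, hf⟩ := f
  exact ⟨⟨⟨f, g, h⟩, hf⟩, rfl⟩

theorem aux_card {A B : Type*} (r : A → A → Prop) (q : B → B → Prop) (F : A → B)
    (hF : ∀ x y, r x y ↔ q (F x) (F y)) (G : B → A) (hG : ∀ b, F (G b) = b) :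
    (∀ x, r x x) → Nat.card (Quot r) = Nat.card (Quot q) := fun hr =>
  Nat.card_congr
    { toFun := Quot.map F fun x y h => (hF x y).1 h
      invFun := Quot.map G fun x y h => (hF _ _).2 (by rwa [hG, hG])
      left_inv := by
        rintro ⟨x⟩
        apply Quot.sound
        rw [hF, hG, ← hF]
        exact hr x
      right_inv := by
        rintro ⟨b⟩
        exact congrArg (Quot.mk q) (hG b) }

theorem orbit_counts_agree
    (k : Type) [Field k] [Finite k] [CategoryTheory.Linear k R]
    (hfin : ∀ X Y : R, FiniteDimensional k (X ⟶ Y))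
    (X Y L : R) :
    Nat.card (Quot (TriangleRel X Y L)) = Nat.card (Quot (HomWithConeRel X Y L)) ∧
    Nat.card (Quot (TriangleRel X Y L)) = Nat.card (Quot (HomWithCoconeRel X Y L)) := by
  have hr : ∀ t, TriangleRel X Y L t t := fun t => aux_rel_one X Y L t t (Iso.refl X) (by simp)
  constructor
  · choose G hG using aux_cone X Y L
    refine aux_card _ _ (fun t => ⟨t.1.1, t.1.2.1, t.1.2.2, t.2⟩) ?_ G
      (fun b => Subtype.ext (hG b)) hr
    intro t s
    exact ⟨fun ⟨a, _, h, _⟩ => ⟨a, h⟩, fun ⟨a, h⟩ => aux_rel_one X Y L t s a h⟩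
  · choose G hG using aux_cocone X Y L
    refine aux_card _ _ (fun t => ⟨t.1.2.1, t.1.2.2, _, rot_of_distTriang _ t.2⟩) ?_ G
      (fun b => Subtype.ext (hG b)) hr
    intro t s
    exact ⟨fun ⟨_, c, _, h, _⟩ => ⟨c, h⟩, fun ⟨c, h⟩ => aux_rel_two X Y L t s c h⟩
end
end

section
/- Let k be a field and let A be the 5-dimensional k-algebra kQ/(βα), where Q is the quiver with two vertices 1, 2 and arrows α : 2 → 1 and β : 1 → 2, and βα denotes the length-two path from 2 to 2 (first α, then β); thus A has k-basis {e₁, e₂, α, β, αβ} with e₁, e₂ orthogonal idempotents summing to 1, α = e₁αe₂, β = e₂βe₁, βα = 0 and (αβ)² = 0. Let P₁ = e₁A be the indecomposable projective right A-module at vertex 1, and let h : P₁ → P₁ be the A-module endomorphism given by left multiplication by αβ (so h ≠ 0 and h∘h = 0). Let P be the unbounded cochain complex of right A-modules with P^n = P₁ for every n ∈ Z and every differential equal to h. Then P is a nonzero indecomposable object of the unbounded derived category D(Mod A) of all right A-modules: whenever P ≅ X ⊕ Y in D(Mod A), then X ≅ 0 or Y ≅ 0. -/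
/- Statement 6: For the algebra `A = kQ/(βα)` (quiver `1 ⇄ 2` with relation `βα = 0`,
`k`-basis `e₁, e₂, α, β, αβ`), the unbounded 2-periodic complex
`⋯ → P₁ →h P₁ →h P₁ → ⋯`, where `P₁ = e₁A` and `h` is left multiplication by `αβ`, is a
nonzero indecomposable object of the unbounded derived category `D(Mod A)` of right
`A`-modules. -/

noncomputable section

open CategoryTheory Limits

/-- The `ℤ`-indexed cochain complex with all terms `M` and all differentials `h`. -/
def constantComplex {S : Type} [Ring S] (M : ModuleCat S) (h : M ⟶ M)
    (hsq : h ≫ h = 0) : CochainComplex (ModuleCat S) ℤ :=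
  CochainComplex.of (fun _ => M) (fun _ => h) (fun _ => hsq)

namespace TwoPer
universe w
variable {R : Type} [Ring R] [HasDerivedCategory.{w} (ModuleCat.{0} R)]

abbrev F (R : Type) [Ring R] [HasDerivedCategory.{w} (ModuleCat.{0} R)] (n : ℤ) :
    DerivedCategory (ModuleCat.{0} R) ⥤ ModuleCat.{0} R :=
  DerivedCategory.homologyFunctor (ModuleCat.{0} R) n

abbrev io (K : CochainComplex (ModuleCat.{0} R) ℤ) (n : ℤ) :
    (F R n).obj (DerivedCategory.Q.obj K) ≅ K.homology n :=
  (DerivedCategory.homologyFunctorFactors (ModuleCat.{0} R) n).app K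

def Rep (K : CochainComplex (ModuleCat.{0} R) ℤ) (n : ℤ) (x : K.X n)
    (w : (F R n).obj (DerivedCategory.Q.obj K)) : Prop :=
  ∃ c : K.cycles n, K.iCycles n c = x ∧ (io K n).hom w = K.homologyπ n c

lemma io_inj (K : CochainComplex (ModuleCat.{0} R) ℤ) (n : ℤ) :
    Function.Injective (io K n).hom :=
  (ModuleCat.mono_iff_injective _).1 inferInstance

lemma Rep.smul {K : CochainComplex (ModuleCat.{0} R) ℤ} {n : ℤ} {x w} (h : Rep K n x w) (a : R) :
    Rep K n (a • x) (a • w) := by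
  obtain ⟨c, hc, hw⟩ := h
  exact ⟨a • c, by rw [map_smul, hc], by rw [map_smul, map_smul, hw]⟩

lemma Rep.sub {K : CochainComplex (ModuleCat.{0} R) ℤ} {n : ℤ} {x w x' w'} (h : Rep K n x w)
    (h' : Rep K n x' w') : Rep K n (x - x') (w - w') := by
  obtain ⟨c, hc, hw⟩ := h
  obtain ⟨c', hc', hw'⟩ := h'
  exact ⟨c - c', by rw [map_sub, hc, hc'], by rw [map_sub, map_sub, hw, hw']⟩

lemma Rep.map {K L : CochainComplex (ModuleCat.{0} R) ℤ} {n : ℤ} {x w} (h : Rep K n x w)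
    (f : K ⟶ L) : Rep L n (f.f n x) ((F R n).map (DerivedCategory.Q.map f) w) := by
  obtain ⟨c, hc, hw⟩ := h
  refine ⟨HomologicalComplex.cyclesMap f n c, ?_, ?_⟩
  · rw [← hc, ← ConcreteCategory.comp_apply, ← ConcreteCategory.comp_apply,
      HomologicalComplex.cyclesMap_i]
  · have e1 := congrArg (fun g => (ConcreteCategory.hom g) w)
      (DerivedCategory.homologyFunctorFactors_hom_naturality f n)
    refine Eq.trans e1 ?_
    change HomologicalComplex.homologyMap f n ((io K n).hom w) = _
    rw [hw, ← ConcreteCategory.comp_apply, ← ConcreteCategory.comp_apply,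
      HomologicalComplex.homologyπ_naturality]

lemma exists_rep (K : CochainComplex (ModuleCat.{0} R) ℤ) (n : ℤ) (w) : ∃ x, Rep K n x w := by
  obtain ⟨c, hc⟩ := (ModuleCat.epi_iff_surjective (K.homologyπ n)).1 inferInstance ((io K n).hom w)
  exact ⟨_, c, rfl, hc.symm⟩

lemma exists_cls (K : CochainComplex (ModuleCat.{0} R) ℤ) (n m : ℤ) (hm : n + 1 = m) (x : K.X n)
    (hx : K.d n m x = 0) : ∃ w, Rep K n x w := by
  let c : K.cycles n := K.cyclesMk (i := n) x m (by simpa using hm) hx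
  refine ⟨(io K n).inv (K.homologyπ n c), c, K.i_cyclesMk (i := n) x m (by simpa using hm) hx, ?_⟩
  rw [← ConcreteCategory.comp_apply, Iso.inv_hom_id]; rfl

lemma Rep.d_eq {K : CochainComplex (ModuleCat.{0} R) ℤ} {n : ℤ} {x w} (h : Rep K n x w)
    (m : ℤ) : K.d n m x = 0 := by
  obtain ⟨c, rfl, hw⟩ := h
  rw [← ConcreteCategory.comp_apply, HomologicalComplex.iCycles_d]; rfl

lemma Rep.zero_iff {K : CochainComplex (ModuleCat.{0} R) ℤ} {n : ℤ} {x w} (h : Rep K n x w)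
    (m : ℤ) (hm : m + 1 = n) : w = 0 ↔ ∃ y, K.d m n y = x := by
  obtain ⟨c, rfl, hw⟩ := h
  have inj : Function.Injective (K.iCycles n) := (ModuleCat.mono_iff_injective _).1 inferInstance
  have e : w = 0 ↔ K.homologyπ n c = 0 := by
    rw [← hw]; exact (map_eq_zero_iff _ (io_inj K n)).symm
  rw [e]
  constructor
  · intro h0
    have ex : (ShortComplex.mk (K.toCycles m n) (K.homologyπ n) (by simp)).Exact :=
      ShortComplex.exact_of_g_is_cokernel _ (K.homologyIsCokernel m n (by simp [← hm]))
    obtain ⟨y, hy⟩ := (ShortComplex.moduleCat_exact_iff _).1 ex c h0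
    refine ⟨y, ?_⟩
    rw [← hy, ← K.toCycles_i m n]; rfl
  · rintro ⟨y, hy⟩
    have : c = K.toCycles m n y := inj (by rw [← hy, ← K.toCycles_i m n]; rfl)
    rw [this, ← ConcreteCategory.comp_apply, HomologicalComplex.toCycles_comp_homologyπ]; rfl


lemma const_d (M : ModuleCat.{0} R) (h : M ⟶ M) (hsq : h ≫ h = 0) (i j : ℤ) (hij : i + 1 = j)
    (x : M) : (constantComplex M h hsq).d i j x = h x := by
  subst hij
  exact congrArg (fun g : M ⟶ M => g x) (CochainComplex.of_d (fun _ => M) (fun _ => h) i)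

structure Data (M : ModuleCat.{0} R) (h : M ⟶ M) (a b : R) (u : M) : Prop where
  h1 : ∀ y : M, b • a • y = h y
  h2 : a * b = 0
  h3 : b * b = 0
  hu : b • a • u ≠ 0
  h4 : ∀ z z' : M, h z = 0 → h z' = 0 → b • z ≠ 0 → ∃ r : R, b • r • z = b • z'
  h5 : ∀ z : M, h z = 0 → b • z = 0 → ∃ y, h y = z

variable {M : ModuleCat.{0} R} {h : M ⟶ M} {hsq : h ≫ h = 0} {a b : R} {u : M}

lemma Rep.hz {n : ℤ} {z : M} {w} (r : Rep (constantComplex M h hsq) n z w) : h z = 0 := by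
  rw [← const_d M h hsq n (n+1) rfl]; exact r.d_eq _

lemma cls' {n : ℤ} (z : M) (hz : h z = 0) : ∃ w, Rep (constantComplex M h hsq) n z w :=
  exists_cls (constantComplex M h hsq) n (n+1) rfl z ((const_d M h hsq n (n+1) rfl z).trans hz)

lemma Data.zero_iff (D : Data M h a b u) {n : ℤ} {z : M} {w}
    (r : Rep (constantComplex M h hsq) n z w) : w = 0 ↔ b • z = 0 := by
  rw [r.zero_iff (n-1) (by ring)]
  constructor
  · rintro ⟨y, hy⟩
    have hy' : h y = z := by rw [← hy]; exact (const_d M h hsq (n-1) n (by ring) y).symm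
    have : b • b • a • (show M from y) = 0 := by rw [← mul_smul, D.h3, zero_smul]
    rw [← hy']
    exact (congrArg (fun t : M => b • t) (D.h1 y)).symm.trans this
  · intro hb
    obtain ⟨y, hy⟩ := D.h5 z r.hz hb
    exact ⟨y, (const_d M h hsq (n-1) n (by ring) y).trans hy⟩

lemma Data.h_au (D : Data M h a b u) : h (a • u) = 0 := by
  rw [map_smul, ← D.h1, ← mul_smul, D.h2, zero_smul]

lemma Data.gen (D : Data M h a b u) {n : ℤ}
    {v w : (F R n).obj (DerivedCategory.Q.obj (constantComplex M h hsq))} (hv : v ≠ 0) :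
    ∃ r : R, w = r • v := by
  obtain ⟨z, hz⟩ := exists_rep _ n v
  obtain ⟨z', hz'⟩ := exists_rep _ n w
  obtain ⟨r, hr⟩ := D.h4 z z' hz.hz hz'.hz (fun H => hv ((D.zero_iff hz).2 H))
  refine ⟨r, (sub_eq_zero.1 ((D.zero_iff ((hz.smul r).sub hz')).2 ?_)).symm⟩
  refine (smul_sub b (r • z : M) z').trans (sub_eq_zero.2 hr)

lemma Data.eq_zero (D : Data M h a b u) {n : ℤ} {N : ModuleCat.{0} R}
    {v : (F R n).obj (DerivedCategory.Q.obj (constantComplex M h hsq))} (hv : v ≠ 0)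
    (f : (F R n).obj (DerivedCategory.Q.obj (constantComplex M h hsq)) ⟶ N) (hf : f v = 0) :
    f = 0 := by
  ext w
  obtain ⟨r, rfl⟩ := D.gen (w := w) hv
  change f (r • v) = 0
  rw [map_smul, hf, smul_zero]

lemma Data.ex_ne (D : Data M h a b u) (n : ℤ) :
    ∃ v : (F R n).obj (DerivedCategory.Q.obj (constantComplex M h hsq)), v ≠ 0 ∧
      Rep (constantComplex M h hsq) n (a • u : M) v := by
  obtain ⟨w, hw⟩ := cls' (hsq := hsq) (n := n) _ D.h_au
  exact ⟨w, fun H => D.hu ((D.zero_iff hw).1 H), hw⟩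

lemma Data.step (D : Data M h a b u)
    (e : DerivedCategory.Q.obj (constantComplex M h hsq) ⟶
      DerivedCategory.Q.obj (constantComplex M h hsq)) (i j : ℤ) (hij : i + 1 = j)
    (he : (F R j).map e = 0) : (F R i).map e = 0 := by
  obtain ⟨X', s, hs, g, rfl⟩ := DerivedCategory.right_fac e
  obtain ⟨w0, hw0, r0⟩ := D.ex_ne (hsq := hsq) j
  have key : ∀ (n : ℤ) (x), (F R n).map (inv (DerivedCategory.Q.map s) ≫ DerivedCategory.Q.map g)
      ((F R n).map (DerivedCategory.Q.map s) x) = (F R n).map (DerivedCategory.Q.map g) x := by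
    intro n x
    rw [← ConcreteCategory.comp_apply, ← Functor.map_comp, IsIso.hom_inv_id_assoc]
  have sinj : Function.Injective ((F R j).map (DerivedCategory.Q.map s)) :=
    (ModuleCat.mono_iff_injective _).1 inferInstance
  obtain ⟨w', rfl⟩ := (ModuleCat.epi_iff_surjective
    ((F R j).map (DerivedCategory.Q.map s))).1 inferInstance w0
  have hg0 : (F R j).map (DerivedCategory.Q.map g) w' = 0 := by
    rw [← key, he]; rfl
  obtain ⟨z', rz⟩ := exists_rep X' j w'
  have bw : b • w' = 0 := by
    apply sinj
    rw [map_smul, map_zero]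
    refine (D.zero_iff (r0.smul b)).2 ?_
    change b • b • a • u = 0
    rw [← mul_smul, D.h3, zero_smul]
  obtain ⟨y', hy'⟩ := ((rz.smul b).zero_iff i hij).1 bw
  obtain ⟨v', rv⟩ := exists_cls X' i j hij (a • y')
    (by rw [map_smul, hy', ← mul_smul, D.h2, zero_smul])
  have comm : ∀ f : X' ⟶ constantComplex M h hsq,
      (F R i).map (DerivedCategory.Q.map f) v' = 0 ↔ (F R j).map (DerivedCategory.Q.map f) w' = 0 := by
    intro f
    rw [D.zero_iff (rv.map f), D.zero_iff (rz.map f)]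
    have e1 : f.f i (a • y') = a • f.f i y' := map_smul _ _ _
    have e2 : b • a • (f.f i y' : M) = b • (f.f j z' : M) := by
      refine (D.h1 _).trans ?_
      refine (const_d M h hsq i j hij _).symm.trans ?_
      change _ = b • f.f j z'
      rw [← map_smul, ← hy', ← ConcreteCategory.comp_apply, ← ConcreteCategory.comp_apply,
        HomologicalComplex.Hom.comm]
    rw [e1]
    exact e2 ▸ Iff.rfl
  refine D.eq_zero (v := (F R i).map (DerivedCategory.Q.map s) v') ?_ _ ?_
  · exact fun H => hw0 ((comm s).1 H)
  · rw [key]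
    exact (comm g).2 hg0

lemma Data.dich (D : Data M h a b u) (n : ℤ)
    (p : (F R n).obj (DerivedCategory.Q.obj (constantComplex M h hsq)) ⟶
      (F R n).obj (DerivedCategory.Q.obj (constantComplex M h hsq)))
    (q : (F R n).obj (DerivedCategory.Q.obj (constantComplex M h hsq)) ⟶
      (F R n).obj (DerivedCategory.Q.obj (constantComplex M h hsq))) (hpq : p ≫ q = 0) :
    p = 0 ∨ q = 0 := by
  by_contra! H
  obtain ⟨v, hv, -⟩ := D.ex_ne (hsq := hsq) n
  have : p v ≠ 0 := fun h0 => H.1 (D.eq_zero hv p h0)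
  refine H.2 (D.eq_zero this q ?_)
  rw [← ConcreteCategory.comp_apply, hpq]; rfl

lemma isZero_of (X : DerivedCategory (ModuleCat.{0} R)) (hX : ∀ n, 𝟙 ((F R n).obj X) = 0) :
    IsZero X := by
  rw [IsZero.iff_id_eq_zero]
  have : IsIso (0 : X ⟶ X) := by
    rw [DerivedCategory.isIso_iff]
    intro n
    have : (DerivedCategory.homologyFunctor (ModuleCat.{0} R) n).map (0 : X ⟶ X) =
        𝟙 _ := by rw [hX n, Functor.map_zero]
    rw [this]; infer_instance
  rw [← IsIso.hom_inv_id (0 : X ⟶ X), zero_comp]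

theorem Data.main (D : Data M h a b u) :
    ¬ IsZero (DerivedCategory.Q.obj (constantComplex M h hsq)) ∧
    ∀ (X Y : DerivedCategory (ModuleCat R))
      (pX : DerivedCategory.Q.obj (constantComplex M h hsq) ⟶ X)
      (sX : X ⟶ DerivedCategory.Q.obj (constantComplex M h hsq))
      (pY : DerivedCategory.Q.obj (constantComplex M h hsq) ⟶ Y)
      (sY : Y ⟶ DerivedCategory.Q.obj (constantComplex M h hsq)),
      sX ≫ pX = 𝟙 X → sY ≫ pY = 𝟙 Y → sX ≫ pY = 0 → sY ≫ pX = 0 →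
      pX ≫ sX + pY ≫ sY = 𝟙 (DerivedCategory.Q.obj (constantComplex M h hsq)) →
      IsZero X ∨ IsZero Y := by
  have idne : ∀ n, 𝟙 ((F R n).obj (DerivedCategory.Q.obj (constantComplex M h hsq))) ≠ 0 := by
    intro n H
    obtain ⟨v, hv, -⟩ := D.ex_ne (hsq := hsq) n
    exact hv (congrArg (fun g => (ConcreteCategory.hom g) v) H)
  constructor
  · intro H
    apply idne 0
    rw [← CategoryTheory.Functor.map_id, (IsZero.iff_id_eq_zero _).1 H, Functor.map_zero]
  intro X Y pX sX pY sY hX hY hXY hYX hs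
  have red : ∀ (X : DerivedCategory (ModuleCat R))
      (p : DerivedCategory.Q.obj (constantComplex M h hsq) ⟶ X)
      (s : X ⟶ DerivedCategory.Q.obj (constantComplex M h hsq)), s ≫ p = 𝟙 X →
      (∀ n, (F R n).map (p ≫ s) = 0) → IsZero X := by
    intro X p s hsp H
    refine isZero_of X fun n => ?_
    have : 𝟙 X = s ≫ (p ≫ s) ≫ p := by simp [hsp]
    rw [← CategoryTheory.Functor.map_id, this, Functor.map_comp, Functor.map_comp, H, zero_comp, comp_zero]
  have both : ∀ n, (F R n).map (pX ≫ sX) = 0 → (F R n).map (pY ≫ sY) = 0 → False := by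
    intro n h1 h2
    apply idne n
    rw [← CategoryTheory.Functor.map_id, ← hs, Functor.map_add, h1, h2, add_zero]
  have dich : ∀ n, (F R n).map (pX ≫ sX) = 0 ∨ (F R n).map (pY ≫ sY) = 0 := by
    intro n
    apply D.dich
    rw [← Functor.map_comp, Category.assoc, reassoc_of% hXY, zero_comp, comp_zero,
      Functor.map_zero]
  have up : ∀ (n : ℤ), (F R n).map (pX ≫ sX) = 0 ↔ (F R (n+1)).map (pX ≫ sX) = 0 := by
    intro n
    refine ⟨fun h0 => (dich (n+1)).resolve_right fun h1 => both n h0 (D.step _ n _ rfl h1),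
      D.step _ n _ rfl⟩
  have all : ∀ n : ℤ, (F R n).map (pX ≫ sX) = 0 ↔ (F R 0).map (pX ≫ sX) = 0 := by
    intro n
    induction n using Int.induction_on with
    | zero => rfl
    | succ i ih => exact (up _).symm.trans ih
    | pred i ih =>
      rw [← ih, up, sub_add_cancel]
  by_cases h0 : (F R 0).map (pX ≫ sX) = 0
  · exact Or.inl (red X pX sX hX fun n => (all n).2 h0)
  · exact Or.inr (red Y pY sY hY fun n => (dich n).resolve_left fun h1 => h0 ((all n).1 h1))

theorem mkData
    (k : Type) [Field k] (A : Type) [Ring A] [Algebra k A]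
    (e₁ e₂ α β : A)
    (he₁ : e₁ * e₁ = e₁)
    (h₁₂ : e₁ * e₂ = 0) (h₂₁ : e₂ * e₁ = 0)
    (hα : e₁ * α * e₂ = α) (hβ : e₂ * β * e₁ = β) (hβα : β * α = 0)
    (hindep : LinearIndependent k ![e₁, e₂, α, β, α * β])
    (hspan : Submodule.span k {e₁, e₂, α, β, α * β} = ⊤)
    (h : ModuleCat.of Aᵐᵒᵖ ↥(Submodule.span Aᵐᵒᵖ ({e₁} : Set A)) ⟶
      ModuleCat.of Aᵐᵒᵖ ↥(Submodule.span Aᵐᵒᵖ ({e₁} : Set A)))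
    (hspec : ∀ x : ModuleCat.of Aᵐᵒᵖ ↥(Submodule.span Aᵐᵒᵖ ({e₁} : Set A)),
      (h x).val = α * β * x.val) :
    Data (ModuleCat.of Aᵐᵒᵖ ↥(Submodule.span Aᵐᵒᵖ ({e₁} : Set A))) h
      (MulOpposite.op α) (MulOpposite.op β) ⟨e₁, Submodule.mem_span_singleton_self e₁⟩ := by
  have e1α : e₁ * α = α := by rw [← hα, ← mul_assoc, ← mul_assoc, he₁]
  have αe1 : α * e₁ = 0 := by rw [← hα, mul_assoc, h₂₁, mul_zero]
  have e1β : e₁ * β = 0 := by rw [← hβ, ← mul_assoc, ← mul_assoc, h₁₂, zero_mul, zero_mul]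
  have βe1 : β * e₁ = β := by rw [← hβ, mul_assoc, he₁]
  have αα : α * α = 0 := by rw [← e1α, ← mul_assoc, mul_assoc e₁ α e₁, αe1]; simp
  have ββ : β * β = 0 := by
    calc β * β = (β * e₁) * β := by rw [βe1]
      _ = 0 := by rw [mul_assoc, e1β, mul_zero]
  have ne : α * β ≠ 0 := hindep.ne_zero 4
  have form : ∀ x : Submodule.span Aᵐᵒᵖ ({e₁} : Set A),
      ∃ p r q : k, x.val = p • e₁ + r • α + q • (α * β) := by
    rintro ⟨x, hx⟩
    obtain ⟨c, rfl⟩ := Submodule.mem_span_singleton.1 hx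
    have hm : c.unop ∈ Submodule.span k {e₁, e₂, α, β, α * β} := hspan ▸ Submodule.mem_top
    simp only [Submodule.mem_span_insert, Submodule.mem_span_singleton] at hm
    obtain ⟨p, _, ⟨p2, _, ⟨r, _, ⟨b, _, ⟨q, rfl⟩, rfl⟩, rfl⟩, rfl⟩, hc⟩ := hm
    refine ⟨p, r, q, ?_⟩
    change e₁ * c.unop = _
    rw [hc]
    simp only [mul_add, mul_smul_comm, he₁, h₁₂, e1α, e1β, ← mul_assoc, smul_zero, zero_add]
    abel
  have hval : ∀ (x : Submodule.span Aᵐᵒᵖ ({e₁} : Set A)) (p r q : k),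
      x.val = p • e₁ + r • α + q • (α * β) → (h x).val = p • (α * β) := by
    intro x p r q hx
    rw [hspec]
    change α * β * x.val = _
    rw [hx]
    simp only [mul_add, mul_smul_comm, mul_assoc, βe1, hβα]
    simp only [← mul_assoc β α β, hβα, zero_mul, mul_zero, smul_zero, add_zero]
  have bval : ∀ (x : Submodule.span Aᵐᵒᵖ ({e₁} : Set A)) (p r q : k),
      x.val = p • e₁ + r • α + q • (α * β) → x.val * β = r • (α * β) := by
    intro x p r q hx
    rw [hx]
    simp only [add_mul, smul_mul_assoc, mul_assoc, e1β, ββ]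
    simp
  have aval : ∀ (x : Submodule.span Aᵐᵒᵖ ({e₁} : Set A)) (p r q : k),
      x.val = p • e₁ + r • α + q • (α * β) → x.val * α = p • α := by
    intro x p r q hx
    rw [hx]
    simp only [add_mul, smul_mul_assoc, mul_assoc, e1α, αα, hβα]
    simp
  have hp : ∀ (x : Submodule.span Aᵐᵒᵖ ({e₁} : Set A)) (p r q : k),
      x.val = p • e₁ + r • α + q • (α * β) → h x = 0 → p = 0 := by
    intro x p r q hx h0
    have := hval x p r q hx
    rw [h0] at this
    exact (smul_eq_zero.1 this.symm).resolve_right ne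
  refine ⟨?_, ?_, ?_, ?_, ?_, ?_⟩
  · intro y
    obtain ⟨p, r, q, hy⟩ := form y
    apply Subtype.ext
    rw [hval y p r q hy]
    change y.val * α * β = _
    rw [aval y p r q hy, smul_mul_assoc]
  · rw [← MulOpposite.op_mul, hβα, MulOpposite.op_zero]
  · rw [← MulOpposite.op_mul, ββ, MulOpposite.op_zero]
  · intro H
    have : e₁ * α * β = 0 := congrArg Subtype.val H
    rw [e1α] at this
    exact ne this
  · intro z z' hz hz' hb
    obtain ⟨p, r, q, hy⟩ := form z
    obtain ⟨p', r', q', hy'⟩ := form z'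
    have hr : r ≠ 0 := by
      rintro rfl
      apply hb
      apply Subtype.ext
      change z.val * β = 0
      rw [bval z _ _ _ hy, zero_smul]
    refine ⟨MulOpposite.op (algebraMap k A (r' / r)), ?_⟩
    apply Subtype.ext
    change z.val * algebraMap k A (r' / r) * β = z'.val * β
    rw [← Algebra.commutes, mul_assoc, bval z _ _ _ hy, bval z' _ _ _ hy', ← Algebra.smul_def,
      smul_smul, div_mul_cancel₀ _ hr]
  · intro z hz hb
    obtain ⟨p, r, q, hy⟩ := form z
    have hp0 := hp z p r q hy hz
    have hb' : z.val * β = 0 := congrArg Subtype.val hb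
    rw [bval z _ _ _ hy] at hb'
    have hr0 : r = 0 := (smul_eq_zero.1 hb').resolve_right ne
    subst hp0 hr0
    refine ⟨⟨e₁ * algebraMap k A q, Submodule.mem_span_singleton.2
      ⟨MulOpposite.op (algebraMap k A q), rfl⟩⟩, Subtype.ext ?_⟩
    rw [hval _ q 0 0 (by simp [Algebra.smul_def, Algebra.commutes]), hy]
    simp

end TwoPer

theorem two_periodic_complex_indecomposable
    (k : Type) [Field k] (A : Type) [Ring A] [Algebra k A]
    (e₁ e₂ α β : A)
    -- `e₁, e₂` are orthogonal idempotents summing to `1`: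
    (he₁ : e₁ * e₁ = e₁) (he₂ : e₂ * e₂ = e₂)
    (h₁₂ : e₁ * e₂ = 0) (h₂₁ : e₂ * e₁ = 0) (hsum : e₁ + e₂ = 1)
    -- the arrows `α : 2 → 1` and `β : 1 → 2`, with the relation `βα = 0`:
    (hα : e₁ * α * e₂ = α) (hβ : e₂ * β * e₁ = β) (hβα : β * α = 0)
    -- `{e₁, e₂, α, β, αβ}` is a `k`-basis of `A`:
    (hindep : LinearIndependent k ![e₁, e₂, α, β, α * β])
    (hspan : Submodule.span k {e₁, e₂, α, β, α * β} = ⊤)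
    -- `h` is the endomorphism of the right `A`-module `P₁ = e₁A` given by left
    -- multiplication by `αβ` (so `h ≠ 0` and `h ∘ h = 0`):
    (h : ModuleCat.of Aᵐᵒᵖ ↥(Submodule.span Aᵐᵒᵖ ({e₁} : Set A)) ⟶
      ModuleCat.of Aᵐᵒᵖ ↥(Submodule.span Aᵐᵒᵖ ({e₁} : Set A)))
    (hspec : ∀ x : ModuleCat.of Aᵐᵒᵖ ↥(Submodule.span Aᵐᵒᵖ ({e₁} : Set A)),
      (h x).val = α * β * x.val)
    (hne : h ≠ 0) (hsq : h ≫ h = 0)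
    [HasDerivedCategory (ModuleCat Aᵐᵒᵖ)] :
    ¬ IsZero (DerivedCategory.Q.obj
        (constantComplex (ModuleCat.of Aᵐᵒᵖ ↥(Submodule.span Aᵐᵒᵖ ({e₁} : Set A))) h hsq)) ∧
    ∀ (X Y : DerivedCategory (ModuleCat Aᵐᵒᵖ))
      (pX : DerivedCategory.Q.obj
          (constantComplex (ModuleCat.of Aᵐᵒᵖ ↥(Submodule.span Aᵐᵒᵖ ({e₁} : Set A))) h hsq)
          ⟶ X)
      (sX : X ⟶ DerivedCategory.Q.obj
          (constantComplex (ModuleCat.of Aᵐᵒᵖ ↥(Submodule.span Aᵐᵒᵖ ({e₁} : Set A))) h hsq))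
      (pY : DerivedCategory.Q.obj
          (constantComplex (ModuleCat.of Aᵐᵒᵖ ↥(Submodule.span Aᵐᵒᵖ ({e₁} : Set A))) h hsq)
          ⟶ Y)
      (sY : Y ⟶ DerivedCategory.Q.obj
          (constantComplex (ModuleCat.of Aᵐᵒᵖ ↥(Submodule.span Aᵐᵒᵖ ({e₁} : Set A))) h hsq)),
      sX ≫ pX = 𝟙 X → sY ≫ pY = 𝟙 Y → sX ≫ pY = 0 → sY ≫ pX = 0 →
      pX ≫ sX + pY ≫ sY = 𝟙 (DerivedCategory.Q.obj
        (constantComplex (ModuleCat.of Aᵐᵒᵖ ↥(Submodule.span Aᵐᵒᵖ ({e₁} : Set A))) h hsq)) →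
      IsZero X ∨ IsZero Y := by
  exact (TwoPer.mkData k A e₁ e₂ α β he₁ h₁₂ h₂₁ hα hβ hβα hindep hspan h hspec).main
end
end

section
/- Let D', D, D'' be triangulated categories. Let i_* : D' → D be a fully faithful triangle functor with right adjoint i^! : D → D', and let j_* : D'' → D be a fully faithful triangle functor with left adjoint j^* : D → D''. Assume j^* ∘ i_* = 0 and i^! ∘ j_* = 0. Call an object X of D glued if the counit morphism i_* i^! X → X and the unit morphism X → j_* j^* X fit into a distinguished triangle i_* i^! X → X → j_* j^* X → Σ i_* i^! X whose first two morphisms are exactly the adjunction counit and unit. Then the class of glued objects is closed under cones: if X → Y → Z → ΣX is a distinguished triangle in D with X and Y glued, then Z is glued. -/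
/- Statement 8: Let `i_* : D' → D` be a fully faithful triangle functor with right adjoint
`i^!`, and `j_* : D'' → D` a fully faithful triangle functor with left adjoint `j^*`, with
`j^* ∘ i_* = 0` and `i^! ∘ j_* = 0`.  Call `X` glued if the counit `i_* i^! X → X` and the
unit `X → j_* j^* X` fit into a distinguished triangle
`i_* i^! X → X → j_* j^* X → Σ i_* i^! X`.  Then the glued objects are closed under cones:
if `X → Y → Z → ΣX` is distinguished with `X`, `Y` glued, then `Z` is glued. -/

noncomputable section

open CategoryTheory Limits Pretriangulated

/-- `X` is glued if the adjunction counit and unit fit into a distinguished triangle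
`i_* i^! X → X → j_* j^* X → Σ i_* i^! X`. -/
def IsGlued {D' D D'' : Type} [Category D'] [Category D] [Category D'']
    [Preadditive D] [HasZeroObject D] [HasShift D ℤ]
    [∀ n : ℤ, (shiftFunctor D n).Additive] [Pretriangulated D]
    (iS : D' ⥤ D) (iE : D ⥤ D') (jS : D ⥤ D'') (jU : D'' ⥤ D)
    (adjI : iS ⊣ iE) (adjJ : jS ⊣ jU) (X : D) : Prop :=
  ∃ δ : jU.obj (jS.obj X) ⟶ (shiftFunctor D (1 : ℤ)).obj (iS.obj (iE.obj X)),
    Triangle.mk (adjI.counit.app X) (adjJ.unit.app X) δ ∈ (distTriang D)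

section GluedHelpers

variable {D : Type} [Category D] [Preadditive D] [HasZeroObject D] [HasShift D ℤ]
    [∀ n : ℤ, (shiftFunctor D n).Additive] [Pretriangulated D]

/-- Postcomposition with `f` is bijective on maps from objects of `P`. -/
structure GBij (P : D → Prop) {A B : D} (f : A ⟶ B) : Prop where
  inj : ∀ N, P N → ∀ a : N ⟶ A, a ≫ f = 0 → a = 0
  surj : ∀ N, P N → ∀ b : N ⟶ B, ∃ a : N ⟶ A, a ≫ f = b

lemma GBij.shift {P : D → Prop} (hs : ∀ N, P N → P (N⟦(-1 : ℤ)⟧)) {A B : D} {f : A ⟶ B}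
    (h : GBij P f) : GBij P (f⟦(1 : ℤ)⟧') where
  inj N hN a ha := by
    let e : (N⟦(-1 : ℤ)⟧)⟦(1 : ℤ)⟧ ≅ N := shiftNegShift N (1 : ℤ)
    obtain ⟨a', ha'⟩ := (shiftFunctor D (1 : ℤ)).map_surjective (e.hom ≫ a)
    have : a' = 0 := h.inj _ (hs N hN) a' (by
      apply (shiftFunctor D (1 : ℤ)).map_injective
      rw [Functor.map_comp, ha', Category.assoc, ha, comp_zero, Functor.map_zero])
    rw [← cancel_epi e.hom, ← ha', this, Functor.map_zero, comp_zero]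
  surj N hN b := by
    let e : (N⟦(-1 : ℤ)⟧)⟦(1 : ℤ)⟧ ≅ N := shiftNegShift N (1 : ℤ)
    obtain ⟨b', hb'⟩ := (shiftFunctor D (1 : ℤ)).map_surjective (e.hom ≫ b)
    obtain ⟨a, ha⟩ := h.surj _ (hs N hN) b'
    refine ⟨e.inv ≫ a⟦(1 : ℤ)⟧', ?_⟩
    rw [Category.assoc, ← Functor.map_comp, ha, hb', Iso.inv_hom_id_assoc]

lemma GBij.of_dist {P : D → Prop} (hs : ∀ N, P N → P (N⟦(1 : ℤ)⟧)) (T : Triangle D)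
    (hT : T ∈ distTriang D) (h : ∀ N, P N → ∀ g : N ⟶ T.obj₃, g = 0) : GBij P T.mor₁ where
  inj N hN a ha := by
    obtain ⟨g, hg⟩ := T.coyoneda_exact₁ hT (a⟦(1 : ℤ)⟧') (by
      rw [← Functor.map_comp, ha, Functor.map_zero])
    apply (shiftFunctor D (1 : ℤ)).map_injective
    rw [hg, h _ (hs N hN) g, zero_comp, Functor.map_zero]
  surj N hN b := by
    obtain ⟨a, ha⟩ := T.coyoneda_exact₂ hT b (h N hN _)
    exact ⟨a, ha.symm⟩

lemma GBij.zero_of_dist {P : D → Prop} (hs : ∀ N, P N → P (N⟦(-1 : ℤ)⟧)) (T : Triangle D)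
    (hT : T ∈ distTriang D) (h : GBij P T.mor₁) (N : D) (hN : P N) (g : N ⟶ T.obj₃) : g = 0 := by
  have h1 : g ≫ T.mor₃ = 0 := (h.shift hs).inj N hN _ (by
    rw [Category.assoc, comp_distTriang_mor_zero₃₁ _ hT, comp_zero])
  obtain ⟨z, rfl⟩ := T.coyoneda_exact₃ hT g h1
  obtain ⟨a, rfl⟩ := h.surj N hN z
  rw [Category.assoc, comp_distTriang_mor_zero₁₂ _ hT, comp_zero]

lemma GBij.five {P : D → Prop} (hs : ∀ N, P N → P (N⟦(-1 : ℤ)⟧)) {T T' : Triangle D}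
    (hT : T ∈ distTriang D) (hT' : T' ∈ distTriang D) (φ : T ⟶ T')
    (h₁ : GBij P φ.hom₁) (h₂ : GBij P φ.hom₂) : GBij P φ.hom₃ where
  inj N hN z hz := by
    have h0 : z ≫ T.mor₃ = 0 := (h₁.shift hs).inj N hN _ (by
      rw [Category.assoc, φ.comm₃, reassoc_of% hz, zero_comp])
    obtain ⟨y, rfl⟩ := T.coyoneda_exact₃ hT z h0
    obtain ⟨x, hx⟩ := T'.coyoneda_exact₂ hT' (y ≫ φ.hom₂) (by
      rw [Category.assoc, ← φ.comm₂, ← Category.assoc, hz])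
    obtain ⟨x', rfl⟩ := h₁.surj N hN x
    have h3 : y - x' ≫ T.mor₁ = 0 := h₂.inj N hN _ (by
      rw [Preadditive.sub_comp, hx, Category.assoc, Category.assoc, φ.comm₁, sub_self])
    rw [sub_eq_zero.1 h3, Category.assoc, comp_distTriang_mor_zero₁₂ _ hT, comp_zero]
  surj N hN z := by
    obtain ⟨a, ha⟩ := (h₁.shift hs).surj N hN (z ≫ T'.mor₃)
    have h0 : a ≫ T.mor₁⟦(1 : ℤ)⟧' = 0 := (h₂.shift hs).inj N hN _ (by
      rw [Category.assoc, ← Functor.map_comp, φ.comm₁, Functor.map_comp, reassoc_of% ha,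
        comp_distTriang_mor_zero₃₁ _ hT', comp_zero])
    obtain ⟨b, rfl⟩ := T.coyoneda_exact₁ hT a h0
    obtain ⟨y, hy⟩ := T'.coyoneda_exact₃ hT' (z - b ≫ φ.hom₃) (by
      rw [Preadditive.sub_comp, ← ha, Category.assoc, Category.assoc, φ.comm₃, sub_self])
    obtain ⟨y', rfl⟩ := h₂.surj N hN y
    refine ⟨b + y' ≫ T.mor₂, ?_⟩
    rw [Preadditive.add_comp, Category.assoc, φ.comm₂, ← Category.assoc, ← hy]
    abel

lemma dist_replace₃ {X Y C E : D} (f : X ⟶ Y) (p : Y ⟶ C) (δ : C ⟶ X⟦(1 : ℤ)⟧)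
    (h : Triangle.mk f p δ ∈ distTriang D) (u : Y ⟶ E) (e : C ≅ E) (he : p ≫ e.hom = u) :
    Triangle.mk f u (e.inv ≫ δ) ∈ distTriang D := by
  subst he
  refine isomorphic_distinguished _ h _ ?_
  have h1 : f ≫ 𝟙 Y = 𝟙 X ≫ f := by simp
  have h2 : (p ≫ e.hom) ≫ e.inv = 𝟙 Y ≫ p := by simp
  have h3 : (e.inv ≫ δ) ≫ (shiftFunctor D (1 : ℤ)).map (𝟙 X) = e.inv ≫ δ := by simp
  exact Triangle.isoMk _ _ (Iso.refl X) (Iso.refl Y) e.symm h1 h2 h3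

lemma glued_aux {D' D'' : Type} [Category D'] [Category D'']
    [Preadditive D'] [Preadditive D'']
    [HasZeroObject D'] [HasZeroObject D'']
    [HasShift D' ℤ] [HasShift D'' ℤ]
    [∀ n : ℤ, (shiftFunctor D' n).Additive]
    [∀ n : ℤ, (shiftFunctor D'' n).Additive]
    [Pretriangulated D'] [Pretriangulated D'']
    (iS : D' ⥤ D) [iS.CommShift ℤ] [iS.IsTriangulated]
    (iE : D ⥤ D')
    (jS : D ⥤ D'') [jS.CommShift ℤ] [jS.IsTriangulated]
    (jU : D'' ⥤ D)
    (adjI : iS ⊣ iE) (adjJ : jS ⊣ jU)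
    [jU.Full] [jU.Faithful]
    (hJI : ∀ X : D', IsZero (jS.obj (iS.obj X)))
    (Tr : Triangle D) (hTr : Tr ∈ (distTriang D))
    (hX : IsGlued iS iE jS jU adjI adjJ Tr.obj₁)
    (hY : IsGlued iS iE jS jU adjI adjJ Tr.obj₂) :
    IsGlued iS iE jS jU adjI adjJ Tr.obj₃ := by
  letI := adjI.rightAdjointCommShift ℤ
  haveI := adjI.commShift_of_leftAdjoint ℤ
  haveI : iE.IsTriangulated := adjI.isTriangulated_rightAdjoint
  let P : D → Prop := fun N => IsZero (jS.obj N)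
  have hs : ∀ n : ℤ, ∀ N, P N → P (N⟦n⟧) := fun n N hN =>
    IsZero.of_iso ((shiftFunctor D'' n).map_isZero hN) ((jS.commShiftIso n).app N)
  have hz : ∀ N, P N → ∀ (B : D'') (g : N ⟶ jU.obj B), g = 0 := fun N hN B g => by
    apply (adjJ.homEquiv _ _).symm.injective
    exact IsZero.eq_of_src hN _ _
  have hg : ∀ X, IsGlued iS iE jS jU adjI adjJ X → GBij P (adjI.counit.app X) := by
    rintro X ⟨δ, hδ⟩
    exact GBij.of_dist (hs 1) _ hδ (fun N hN g => hz N hN _ g)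
  let φ : (iE ⋙ iS).mapTriangle.obj Tr ⟶ Tr :=
    { hom₁ := adjI.counit.app _
      hom₂ := adjI.counit.app _
      hom₃ := adjI.counit.app _
      comm₁ := adjI.counit.naturality _
      comm₂ := adjI.counit.naturality _
      comm₃ := by
        have h1 := NatTrans.shift_app_comm adjI.counit (1 : ℤ) Tr.obj₁
        have h2 := adjI.counit.naturality Tr.mor₃
        simp only [Functor.commShiftIso_id_hom_app] at h1
        have key : ((iE ⋙ iS).map Tr.mor₃ ≫
            ((iE ⋙ iS).commShiftIso (1 : ℤ)).hom.app Tr.obj₁) ≫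
              (shiftFunctor D (1 : ℤ)).map (adjI.counit.app Tr.obj₁) =
            adjI.counit.app Tr.obj₃ ≫ Tr.mor₃ := by
          refine (Category.assoc _ _ _).trans ?_
          refine (congrArg (fun t => (iE ⋙ iS).map Tr.mor₃ ≫ t)
            (h1.trans (Category.comp_id _))).trans ?_
          exact h2
        exact key }
  have hZ : GBij P (adjI.counit.app Tr.obj₃) :=
    GBij.five (hs (-1)) ((iE ⋙ iS).map_distinguished _ hTr) hTr φ (hg _ hX) (hg _ hY)
  generalize Tr.obj₃ = Z at hZ ⊢
  obtain ⟨C, p, δ, hC⟩ := distinguished_cocone_triangle (adjI.counit.app Z)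
  have hC0 := GBij.zero_of_dist (hs (-1)) _ hC hZ
  -- the cone of the unit at `C` vanishes
  obtain ⟨M, q, r, hM⟩ := distinguished_cocone_triangle (adjJ.unit.app C)
  have hPM : P M := by
    have := (Triangle.isZero₃_iff_isIso₁ _ (jS.map_distinguished _ hM)).2
      (inferInstanceAs (IsIso (jS.map (adjJ.unit.app C))))
    exact this
  have hr : r = 0 := by
    have hP0 : GBij P (0 : C ⟶ C) :=
      ⟨fun N hN a _ => hC0 N hN a, fun N hN b => ⟨0, (hC0 N hN _).trans (hC0 N hN b).symm⟩⟩
    exact (hP0.shift (hs (-1))).inj M hPM r (by rw [Functor.map_zero, comp_zero])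
  have hq : q = 0 := by
    obtain ⟨s, hs'⟩ := Triangle.coyoneda_exact₃ _ hM (𝟙 M)
      ((Category.id_comp r).trans hr)
    have h0 : s = 0 := hz M hPM _ s
    have : 𝟙 M = 0 := by
      refine hs'.trans ?_
      rw [h0]
      exact zero_comp
    rw [← Category.comp_id q, this, comp_zero]
  have hM0 : IsZero M := (Triangle.isZero₃_iff _ hM).2 ⟨hq, hr⟩
  have i1 : IsIso (adjJ.unit.app C) := (Triangle.isZero₃_iff_isIso₁ _ hM).1 hM0
  have i2 : IsIso (jS.map p) :=
    (Triangle.isZero₁_iff_isIso₂ _ (jS.map_distinguished _ hC)).1 (hJI _)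
  let e : C ≅ jU.obj (jS.obj Z) := asIso (adjJ.unit.app C) ≪≫ (asIso (jU.map (jS.map p))).symm
  have he : p ≫ e.hom = adjJ.unit.app Z := by
    have := adjJ.unit.naturality p
    dsimp at this
    simp only [e, Iso.trans_hom, asIso_hom, Iso.symm_hom, asIso_inv]
    rw [← Category.assoc, this, Category.assoc, IsIso.hom_inv_id, Category.comp_id]
  exact ⟨e.inv ≫ δ, dist_replace₃ _ p δ hC _ e he⟩

end GluedHelpers

theorem glued_objects_closed_under_cones
    (D' D D'' : Type) [Category D'] [Category D] [Category D'']
    [Preadditive D'] [Preadditive D] [Preadditive D'']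
    [HasZeroObject D'] [HasZeroObject D] [HasZeroObject D'']
    [HasShift D' ℤ] [HasShift D ℤ] [HasShift D'' ℤ]
    [∀ n : ℤ, (shiftFunctor D' n).Additive] [∀ n : ℤ, (shiftFunctor D n).Additive]
    [∀ n : ℤ, (shiftFunctor D'' n).Additive]
    [Pretriangulated D'] [Pretriangulated D] [Pretriangulated D'']
    -- the triangle functors:
    (iS : D' ⥤ D) [iS.CommShift ℤ] [iS.IsTriangulated]
    (iE : D ⥤ D') [iE.CommShift ℤ] [iE.IsTriangulated]
    (jS : D ⥤ D'') [jS.CommShift ℤ] [jS.IsTriangulated]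
    (jU : D'' ⥤ D) [jU.CommShift ℤ] [jU.IsTriangulated]
    -- adjointness, full faithfulness and the vanishing conditions:
    (adjI : iS ⊣ iE) (adjJ : jS ⊣ jU)
    [iS.Full] [iS.Faithful] [jU.Full] [jU.Faithful]
    (hJI : ∀ X : D', IsZero (jS.obj (iS.obj X)))
    (hIJ : ∀ Z : D'', IsZero (iE.obj (jU.obj Z)))
    -- a distinguished triangle with glued first and second terms:
    (Tr : Triangle D) (hTr : Tr ∈ (distTriang D))
    (hX : IsGlued iS iE jS jU adjI adjJ Tr.obj₁)
    (hY : IsGlued iS iE jS jU adjI adjJ Tr.obj₂) :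
    IsGlued iS iE jS jU adjI adjJ Tr.obj₃ := by
  exact glued_aux iS iE jS jU adjI adjJ hJI Tr hTr hX hY
end
end
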